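/- Let X be a simplicial complex that is weakly Cohen–Macaulay of dimension d. Then X has the sphere local injectivity property up to dimension d and the disc local injectivity property up to dimension d−1. -/

import Mathlib

/-! Shared simplicial-complex framework. -/

/-- The model `m`-sphere, for an integer `m`; it is empty when `m < 0`,
and is the unit sphere in `ℝ^{m+1}` when `m ≥ 0`. -/
def sphereSpace (m : ℤ) : Type :=
  {x : EuclideanSpace ℝ (Fin (m + 1).toNat) // ‖x‖ = 1 ∧ 0 ≤ m}

noncomputable instance (m : ℤ) : TopologicalSpace (sphereSpace m) := by
  unfold sphereSpace; infer_instance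

/-- The model `m`-disc: empty for `m < 0`, a point for `m = 0`,
the closed unit ball in `ℝ^m` for `m ≥ 0`. -/
def discSpace (m : ℤ) : Type :=
  {x : EuclideanSpace ℝ (Fin m.toNat) // ‖x‖ ≤ 1 ∧ 0 ≤ m}

noncomputable instance (m : ℤ) : TopologicalSpace (discSpace m) := by
  unfold discSpace; infer_instance

/-- The inclusion of the model `m`-sphere as the boundary of the model `(m+1)`-disc. -/
noncomputable local instance (priority := low) (α : Type*) : DecidableEq α :=
  fun _ _ => Classical.propDecidable _

def sphereToDisc (m : ℤ) (x : sphereSpace m) : discSpace (m + 1) :=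
  ⟨x.1, le_of_eq x.2.1, by have := x.2.2; omega⟩

/-- An abstract simplicial complex on a vertex set `V`: a collection of nonempty
finite subsets of `V` closed under passing to nonempty subsets. -/
def IsComplex {V : Type*} (K : Set (Finset V)) : Prop :=
  ∀ σ ∈ K, σ ≠ ∅ ∧ ∀ τ ⊆ σ, τ ≠ ∅ → τ ∈ K

/-- The link of a simplex `σ` in `K`. -/
def link {V : Type*} (K : Set (Finset V)) (σ : Finset V) : Set (Finset V) :=
  {τ | τ ∈ K ∧ Disjoint σ τ ∧ σ ∪ τ ∈ K}

/-- The geometric realization of `K`: formal convex combinations of vertices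
supported on a simplex of `K`. -/
def spc {V : Type*} (K : Set (Finset V)) : Type _ :=
  {w : V →₀ ℝ // w.support ∈ K ∧ (∀ v, 0 ≤ w v) ∧ (w.sum fun _ c => c) = 1}

instance {V : Type*} (K : Set (Finset V)) : TopologicalSpace (spc K) :=
  TopologicalSpace.induced (fun w => ((w.1 : V →₀ ℝ) : V → ℝ)) inferInstance

/-- A simplicial map from `K` to `X`, given on vertices by `f`. -/
def IsSimplicial {V U : Type*} (K : Set (Finset V)) (X : Set (Finset U)) (f : V → U) : Prop :=
  ∀ σ ∈ K, σ.image f ∈ X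

/-- `f` is locally injective on `K`: it preserves dimensions of simplices. -/
def LocInj {V U : Type*} (K : Set (Finset V)) (f : V → U) : Prop :=
  ∀ σ ∈ K, (σ.image f).card = σ.card

/-- `K` is a combinatorial triangulation of the `m`-sphere. -/
def IsCombTriSphere {V : Type*} (m : ℤ) (K : Set (Finset V)) : Prop :=
  IsComplex K ∧ Nonempty (spc K ≃ₜ sphereSpace m) ∧
    ∀ σ ∈ K, Nonempty (spc (link K σ) ≃ₜ sphereSpace (m - σ.card))

/-- `K` is a combinatorial triangulation of the `m`-disc. -/
def IsCombTriDisc {V : Type*} (m : ℤ) (K : Set (Finset V)) : Prop :=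
  IsComplex K ∧ Nonempty (spc K ≃ₜ discSpace m) ∧
    ∀ σ ∈ K, Nonempty (spc (link K σ) ≃ₜ sphereSpace (m - σ.card)) ∨
      Nonempty (spc (link K σ) ≃ₜ discSpace (m - σ.card))

/-- The boundary of a combinatorial triangulation of the `m`-disc:
the simplices whose link is not a sphere of the complementary dimension. -/
def discBoundary {V : Type*} (m : ℤ) (K : Set (Finset V)) : Set (Finset V) :=
  {σ ∈ K | ¬ Nonempty (spc (link K σ) ≃ₜ sphereSpace (m - σ.card))}

/-- The locally injective simplicial map `f` from a triangulated `m`-sphere `K` to `X`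
extends to a locally injective simplicial map on a combinatorial triangulation of the
`(m+1)`-disc whose boundary is `K`. -/
def ExtendsToDisc {U V : Type} (X : Set (Finset U)) (m : ℤ) (K : Set (Finset V))
    (f : V → U) : Prop :=
  ∃ (W : Type) (L : Set (Finset W)) (j : V → W) (F : W → U),
    IsCombTriDisc (m + 1) L ∧ Function.Injective j ∧
    (∀ σ ∈ K, σ.image j ∈ L) ∧
    ((fun σ : Finset V => σ.image j) '' K = discBoundary (m + 1) L) ∧
    (∀ v, F (j v) = f v) ∧ IsSimplicial L X F ∧ LocInj L F

/-- `X` has the disc local injectivity property up to dimension `d`. -/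
def HasDiscLII {U : Type} (X : Set (Finset U)) (d : ℤ) : Prop :=
  ∀ m : ℤ, m ≤ d → ∀ (V : Type) (K : Set (Finset V)) (f : V → U),
    IsCombTriSphere m K → IsSimplicial K X f → LocInj K f → ExtendsToDisc X m K f

/-- The continuous map `G` realizes the simplicial map `g`. -/
def Realizes {V U : Type} (K : Set (Finset V)) (X : Set (Finset U)) (g : V → U)
    (G : C(spc K, spc X)) : Prop :=
  ∀ w : spc K, ((G w).1 : U →₀ ℝ) = Finsupp.mapDomain g w.1

/-- `X` has the sphere local injectivity property up to dimension `d`. -/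
def HasSphereLII {U : Type} (X : Set (Finset U)) (d : ℤ) : Prop :=
  ∀ m : ℤ, m ≤ d → ∀ f : C(sphereSpace m, spc X),
    ∃ (V : Type) (K : Set (Finset V)) (g : V → U) (e : spc K ≃ₜ sphereSpace m)
      (G : C(spc K, spc X)),
      IsCombTriSphere m K ∧ IsSimplicial K X g ∧ LocInj K g ∧ Realizes K X g G ∧
      (f.comp (e : C(spc K, sphereSpace m))).Homotopic G

/-- A space is `d`-connected (`d ∈ ℤ`): every map from a sphere of dimension `≤ d`
extends over the disc. -/
def DConnected (X : Type*) [TopologicalSpace X] (d : ℤ) : Prop :=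
  ∀ m : ℤ, m ≤ d → ∀ f : C(sphereSpace m, X),
    ∃ F : C(discSpace (m + 1), X), ∀ x, F (sphereToDisc m x) = f x

/-- `K` is weakly Cohen–Macaulay of dimension `d`. -/
def WCM {V : Type*} (K : Set (Finset V)) (d : ℤ) : Prop :=
  DConnected (spc K) (d - 1) ∧ ∀ σ ∈ K, DConnected (spc (link K σ)) (d - σ.card - 1)

open Set Topology

/-- Down-closed families of finite sets (possibly void, possibly containing the empty set). -/
def DC {α : Type} (K : Set (Finset α)) : Prop := ∀ σ ∈ K, ∀ τ ⊆ σ, τ ∈ K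

/-- Link in an augmented complex. -/
def lk {α : Type} (K : Set (Finset α)) (σ : Finset α) : Set (Finset α) :=
  {τ | Disjoint σ τ ∧ σ ∪ τ ∈ K}

/-- Cone with apex `c`. -/
def coneC {α : Type} (c : α) (K : Set (Finset α)) : Set (Finset α) := {τ | τ.erase c ∈ K}

/-- Replacement of the star of `σ` by the join of the boundary of `σ` and `A`. -/
def Repl {α : Type} (L : Set (Finset α)) (σ : Finset α) (A : Set (Finset α)) : Set (Finset α) :=
  {τ | ¬ σ ⊆ τ ∧ (τ ∈ L ∨ τ \ σ ∈ A)}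

/-- The linear cone over the realization. -/
def cn {α : Type} (K : Set (Finset α)) : Set (α → ℝ) :=
  {w | (∀ v, 0 ≤ w v) ∧ ∃ σ ∈ K, ∀ v, v ∉ σ → w v = 0}

theorem mem_lk {α : Type} {K : Set (Finset α)} {σ τ : Finset α} :
    τ ∈ lk K σ ↔ Disjoint σ τ ∧ σ ∪ τ ∈ K := Iff.rfl

theorem mem_coneC {α : Type} {K : Set (Finset α)} {c : α} {τ : Finset α} :
    τ ∈ coneC c K ↔ τ.erase c ∈ K := Iff.rfl

theorem mem_Repl {α : Type} {L A : Set (Finset α)} {σ τ : Finset α} :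
    τ ∈ Repl L σ A ↔ ¬ σ ⊆ τ ∧ (τ ∈ L ∨ τ \ σ ∈ A) := Iff.rfl

theorem mem_cn {α : Type} {K : Set (Finset α)} {w : α → ℝ} :
    w ∈ cn K ↔ (∀ v, 0 ≤ w v) ∧ ∃ σ ∈ K, ∀ v, v ∉ σ → w v = 0 := Iff.rfl

theorem DC.lk {α : Type} {K : Set (Finset α)} (h : DC K) (σ : Finset α) : DC (lk K σ) := by
  rintro τ ⟨h1, h2⟩ ρ hρ
  exact ⟨h1.mono_right hρ, h _ h2 _ (Finset.union_subset_union_right hρ)⟩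

theorem DC.lk_sub {α : Type} {K : Set (Finset α)} (h : DC K) {σ τ : Finset α} (ht : τ ∈ _root_.lk K σ) :
    τ ∈ K := h _ ht.2 _ Finset.subset_union_right

theorem DC.cone {α : Type} {K : Set (Finset α)} (h : DC K) (c : α) : DC (coneC c K) := by
  intro τ h1 ρ hρ
  exact h _ h1 _ (Finset.erase_subset_erase _ hρ)

theorem DC.rep {α : Type} {L A : Set (Finset α)} (h : DC L) (hA : DC A) (σ : Finset α) :
    DC (Repl L σ A) := by
  rintro τ ⟨h1, h2⟩ ρ hρ
  refine ⟨fun h3 => h1 (h3.trans hρ), ?_⟩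
  rcases h2 with h2 | h2
  · exact Or.inl (h _ h2 _ hρ)
  · exact Or.inr (hA _ h2 _ (Finset.sdiff_subset_sdiff hρ le_rfl))

/-- finite support within a finset -/
def FinC {α : Type} (K : Set (Finset α)) (S : Finset α) : Prop := ∀ σ ∈ K, σ ⊆ S

theorem FinC.finite {α : Type} {K : Set (Finset α)} {S : Finset α} (h : FinC K S) : K.Finite :=
  (S.powerset.finite_toSet).subset fun σ hσ => by simpa using h σ hσ

theorem FinC.mono {α : Type} {K : Set (Finset α)} {S T : Finset α} (h : FinC K S) (hST : S ⊆ T) :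
    FinC K T := fun σ hσ => (h σ hσ).trans hST

theorem FinC.lk {α : Type} {K : Set (Finset α)} {S : Finset α} (h : FinC K S) (σ : Finset α) :
    FinC (lk K σ) S := fun τ hτ => Finset.subset_union_right.trans (h _ hτ.2)

theorem FinC.cn_zero {α : Type} {K : Set (Finset α)} {S : Finset α} (h : FinC K S) {x : α → ℝ}
    (hx : x ∈ cn K) {v : α} (hv : v ∉ S) : x v = 0 := by
  obtain ⟨_, σ, hσ, h2⟩ := hx
  exact h2 v fun h3 => hv (h σ hσ h3)

theorem cn_supp {α : Type} {K : Set (Finset α)} (h : DC K) {x : α → ℝ} (hx : x ∈ cn K) :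
    ∃ σ ∈ K, ∀ v, x v ≠ 0 ↔ v ∈ σ := by
  obtain ⟨h1, σ, hσ, h2⟩ := hx
  refine ⟨σ.filter (fun v => x v ≠ 0), h _ hσ _ (Finset.filter_subset _ _), fun v => ?_⟩
  simp only [Finset.mem_filter]
  constructor
  · intro h3
    exact ⟨by_contra fun h4 => h3 (h2 v h4), h3⟩
  · exact fun h => h.2

theorem cn_mono {α : Type} {K L : Set (Finset α)} (h : K ⊆ L) : cn K ⊆ cn L := by
  rintro x ⟨h1, σ, hσ, h2⟩
  exact ⟨h1, σ, h hσ, h2⟩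

theorem cn_smul {α : Type} {K : Set (Finset α)} {x : α → ℝ} (hx : x ∈ cn K) {r : ℝ} (hr : 0 ≤ r) :
    r • x ∈ cn K := by
  obtain ⟨h1, σ, hσ, h2⟩ := hx
  exact ⟨fun v => mul_nonneg hr (h1 v), σ, hσ, fun v hv => by simp [h2 v hv]⟩

theorem cn_smul_iff {α : Type} {K : Set (Finset α)} {x : α → ℝ} {r : ℝ} (hr : 0 < r) :
    r • x ∈ cn K ↔ x ∈ cn K := by
  refine ⟨fun h => ?_, fun h => cn_smul h hr.le⟩
  have := cn_smul h (inv_nonneg.2 hr.le)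
  rwa [smul_smul, inv_mul_cancel₀ hr.ne', one_smul] at this

theorem zero_mem_cn {α : Type} {K : Set (Finset α)} (h : K.Nonempty) : (0 : α → ℝ) ∈ cn K := by
  obtain ⟨σ, hσ⟩ := h
  exact ⟨fun _ => le_rfl, σ, hσ, fun _ _ => rfl⟩

theorem cn_closed {α : Type} {K : Set (Finset α)} (h : K.Finite) : IsClosed (cn K) := by
  have : cn K = {w : α → ℝ | ∀ v, 0 ≤ w v} ∩ ⋃ σ ∈ K, {w : α → ℝ | ∀ v, v ∉ σ → w v = 0} := by
    ext w; simp [mem_cn]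
  rw [this]
  refine IsClosed.inter ?_ (h.isClosed_biUnion fun σ _ => ?_)
  · simp only [ofPred_forall]
    exact isClosed_iInter fun v => isClosed_le continuous_const (continuous_apply v)
  · simp only [ofPred_forall]
    exact isClosed_iInter fun v => isClosed_iInter fun _ => isClosed_eq (continuous_apply v) continuous_const

/-- Homogeneous homeomorphisms between cones. -/
structure HH {E F : Type} [TopologicalSpace E] [AddCommGroup E] [Module ℝ E]
    [TopologicalSpace F] [AddCommGroup F] [Module ℝ F] (S : Set E) (T : Set F)
    (φ : E → F) (ψ : F → E) : Prop where
  map : ∀ x ∈ S, φ x ∈ T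
  map' : ∀ y ∈ T, ψ y ∈ S
  left : ∀ x ∈ S, ψ (φ x) = x
  right : ∀ y ∈ T, φ (ψ y) = y
  cont : ContinuousOn φ S
  cont' : ContinuousOn ψ T
  hom : ∀ r : ℝ, 0 < r → ∀ x ∈ S, φ (r • x) = r • φ x

section
variable {E F G : Type} [TopologicalSpace E] [AddCommGroup E] [Module ℝ E]
    [TopologicalSpace F] [AddCommGroup F] [Module ℝ F]
    [TopologicalSpace G] [AddCommGroup G] [Module ℝ G]

theorem HH.hom' {S : Set E} {T : Set F} {φ : E → F} {ψ : F → E} (h : HH S T φ ψ)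
    (hS : ∀ r : ℝ, 0 < r → ∀ x ∈ S, r • x ∈ S) :
    ∀ r : ℝ, 0 < r → ∀ y ∈ T, ψ (r • y) = r • ψ y := by
  intro r hr y hy
  rw [← h.left _ (hS r hr _ (h.map' y hy)), h.hom r hr _ (h.map' y hy), h.right y hy]

theorem HH.symm {S : Set E} {T : Set F} {φ : E → F} {ψ : F → E} (h : HH S T φ ψ)
    (hS : ∀ r : ℝ, 0 < r → ∀ x ∈ S, r • x ∈ S) : HH T S ψ φ :=
  ⟨h.map', h.map, h.right, h.left, h.cont', h.cont, h.hom' hS⟩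

theorem HH.trans {S : Set E} {T : Set F} {R : Set G} {φ : E → F} {ψ : F → E} (h : HH S T φ ψ)
    {φ' : F → G} {ψ' : G → F} (h' : HH T R φ' ψ') : HH S R (fun x => φ' (φ x)) (fun y => ψ (ψ' y)) where
  map x hx := h'.map _ (h.map x hx)
  map' x hx := h.map' _ (h'.map' x hx)
  left x hx := by rw [h'.left _ (h.map x hx), h.left x hx]
  right x hx := by rw [h.right _ (h'.map' x hx), h'.right x hx]
  cont := h'.cont.comp h.cont h.map
  cont' := h.cont'.comp h'.cont' h'.map'
  hom r hr x hx := by rw [h.hom r hr x hx, h'.hom r hr _ (h.map x hx)]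

theorem HH.zero {S : Set E} {T : Set F} {φ : E → F} {ψ : F → E} (h : HH S T φ ψ)
    (h0 : (0 : E) ∈ S) : φ 0 = 0 := by
  have := h.hom 2 (by norm_num) 0 h0
  rw [smul_zero, two_smul] at this
  exact left_eq_add.1 this

theorem HH.congr {S : Set E} {T : Set F} {φ φ' : E → F} {ψ : F → E} (h : HH S T φ ψ)
    (he : ∀ x ∈ S, φ' x = φ x) (hS : ∀ r : ℝ, 0 < r → ∀ x ∈ S, r • x ∈ S) : HH S T φ' ψ where
  map x hx := by rw [he x hx]; exact h.map x hx
  map' := h.map'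
  left x hx := by rw [he x hx]; exact h.left x hx
  right y hy := by rw [he _ (h.map' y hy)]; exact h.right y hy
  cont := h.cont.congr he
  cont' := h.cont'
  hom r hr x hx := by rw [he x hx, he _ (hS r hr x hx), h.hom r hr x hx]
end

/-- restriction to the complement of `σ` -/
noncomputable def cut {α : Type} (σ : Finset α) (x : α → ℝ) : α → ℝ := fun v => if v ∈ σ then 0 else x v
/-- restriction to `σ` -/
noncomputable def res {α : Type} (σ : Finset α) (x : α → ℝ) : α → ℝ := fun v => if v ∈ σ then x v else 0
/-- indicator -/
noncomputable def ind {α : Type} (σ : Finset α) : α → ℝ := fun v => if v ∈ σ then 1 else 0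

theorem cut_cont {α : Type} (σ : Finset α) : Continuous (cut σ) := by
  refine continuous_pi fun v => ?_
  unfold cut; split_ifs
  · exact continuous_const
  · exact continuous_apply v

theorem res_cont {α : Type} (σ : Finset α) : Continuous (res σ) := by
  refine continuous_pi fun v => ?_
  unfold res; split_ifs
  · exact continuous_apply v
  · exact continuous_const

theorem res_add_cut {α : Type} (σ : Finset α) (x : α → ℝ) : res σ x + cut σ x = x := by
  funext v; simp only [res, cut, Pi.add_apply]; split_ifs <;> simp

theorem cut_smul {α : Type} (σ : Finset α) (x : α → ℝ) (r : ℝ) : cut σ (r • x) = r • cut σ x := by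
  funext v; simp [cut]

theorem res_smul {α : Type} (σ : Finset α) (x : α → ℝ) (r : ℝ) : res σ (r • x) = r • res σ x := by
  funext v; simp [res]

/-- the isotopy from the identity to the replacement homeomorphism -/
noncomputable def chiT {α E : Type} (σ : Finset α) (A : Set (Finset α)) (φ : (α → ℝ) → E × ℝ) (ψ : E × ℝ → (α → ℝ))
    (t : ℝ) (x : α → ℝ) : α → ℝ :=
  open Classical in
  if cut σ x ∈ cn A then
    res σ x + ψ ((φ (cut σ x)).1, (1 - t) * (φ (cut σ x)).2) + (t * (φ (cut σ x)).2) • ind σ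
  else x

noncomputable def omeg {α E : Type} (σ : Finset α) (hσ : σ.Nonempty) (B : Set (Finset α))
    (φ : (α → ℝ) → E × ℝ) (ψ : E × ℝ → (α → ℝ)) (y : α → ℝ) : α → ℝ :=
  open Classical in
  if cut σ y ∈ cn B then
    res σ y - (σ.inf' hσ y) • ind σ + ψ ((φ (cut σ y)).1, σ.inf' hσ y)
  else y

structure RepHyp {α E : Type} [TopologicalSpace E] [AddCommGroup E] [Module ℝ E]
    (L : Set (Finset α)) (σ : Finset α) (A : Set (Finset α))
    (φ : (α → ℝ) → E × ℝ) (ψ : E × ℝ → (α → ℝ)) : Prop where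
  dcL : DC L
  dcA : DC A
  finL : L.Finite
  finA : A.Finite
  hσ : σ.Nonempty
  dis : ∀ β ∈ A, Disjoint σ β
  sub : lk L σ ⊆ A
  int : ∀ β ∈ A, β ∈ L → β ∈ lk L σ
  hh : HH (cn A) (univ ×ˢ Ici 0 : Set (E × ℝ)) φ ψ
  bd : ∀ x ∈ cn A, (φ x).2 = 0 ↔ x ∈ cn (lk L σ)

section
variable {α E : Type} [TopologicalSpace E] [AddCommGroup E] [Module ℝ E]
    {L : Set (Finset α)} {σ : Finset α} {A : Set (Finset α)}
    {φ : (α → ℝ) → E × ℝ} {ψ : E × ℝ → (α → ℝ)}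

theorem RepHyp.zeroσ (h : RepHyp L σ A φ ψ) {x : α → ℝ} (hx : x ∈ cn A) {v : α} (hv : v ∈ σ) : x v = 0 := by
  obtain ⟨_, τ, hτ, h2⟩ := hx
  exact h2 v fun h3 => Finset.disjoint_left.1 (h.dis τ hτ) hv h3

theorem RepHyp.cutA (h : RepHyp L σ A φ ψ) {x : α → ℝ} (hx : x ∈ cn A) : cut σ x = x := by
  funext v; unfold cut; split_ifs with h1
  · exact (h.zeroσ hx h1).symm
  · rfl

theorem RepHyp.resA (h : RepHyp L σ A φ ψ) {x : α → ℝ} (hx : x ∈ cn A) : res σ x = 0 := by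
  funext v; unfold res; split_ifs with h1
  · exact (h.zeroσ hx h1)
  · rfl

theorem RepHyp.psi_mem (h : RepHyp L σ A φ ψ) (e : E) {s : ℝ} (hs : 0 ≤ s) : ψ (e, s) ∈ cn A :=
  h.hh.map' _ ⟨trivial, hs⟩

theorem RepHyp.phi_psi (h : RepHyp L σ A φ ψ) (e : E) {s : ℝ} (hs : 0 ≤ s) : φ (ψ (e, s)) = (e, s) :=
  h.hh.right _ ⟨trivial, hs⟩

theorem RepHyp.psi_zero_mem (h : RepHyp L σ A φ ψ) (e : E) : ψ (e, 0) ∈ cn (lk L σ) := by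
  rw [← h.bd _ (h.psi_mem e le_rfl), h.phi_psi e le_rfl]

theorem RepHyp.phi_nonneg (h : RepHyp L σ A φ ψ) {x : α → ℝ} (hx : x ∈ cn A) : 0 ≤ (φ x).2 :=
  (h.hh.map x hx).2

theorem RepHyp.cutlk (h : RepHyp L σ A φ ψ) {x : α → ℝ} (hx : x ∈ cn L) (hc : cut σ x ∈ cn A) :
    cut σ x ∈ cn (lk L σ) := by
  obtain ⟨τ, hτ, h2⟩ := cn_supp h.dcA hc
  refine ⟨hc.1, τ, h.int τ hτ ?_, fun v hv => by_contra fun h3 => hv ((h2 v).1 h3)⟩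
  obtain ⟨_, ρ, hρ, h3⟩ := hx
  refine h.dcL _ hρ _ fun v hv => by_contra fun h4 => (h2 v).2 hv ?_
  unfold cut; split_ifs
  · rfl
  · exact h3 v h4

/-- `chiT` is the identity on the old part. -/
theorem RepHyp.chi_id (h : RepHyp L σ A φ ψ) (t : ℝ) {x : α → ℝ} (hx : x ∈ cn L)
    : chiT σ A φ ψ t x = x ∨ ¬ (cut σ x ∈ cn A) := by
  by_cases hc : cut σ x ∈ cn A
  · left
    have h1 := (h.bd _ hc).2 (h.cutlk hx hc)
    unfold chiT
    rw [if_pos hc, h1, mul_zero, mul_zero, zero_smul, add_zero]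
    have : ((φ (cut σ x)).1, (0:ℝ)) = φ (cut σ x) := by rw [← h1]
    rw [this, h.hh.left _ hc, res_add_cut]
  · exact Or.inr hc

theorem RepHyp.chi_id' (h : RepHyp L σ A φ ψ) (t : ℝ) {x : α → ℝ} (hx : x ∈ cn L) :
    chiT σ A φ ψ t x = x := by
  rcases h.chi_id t hx with h1 | h1
  · exact h1
  · unfold chiT; rw [if_neg h1]

theorem RepHyp.caseR (h : RepHyp L σ A φ ψ) {x : α → ℝ} (hx : x ∈ cn (Repl L σ A)) :
    cut σ x ∈ cn A ∨ (x ∈ cn {τ | τ ∈ L ∧ ¬ σ ⊆ τ}) := by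
  obtain ⟨τ, hτ, h2⟩ := cn_supp (h.dcL.rep h.dcA σ) hx
  rcases hτ.2 with h3 | h3
  · right
    exact ⟨hx.1, τ, ⟨h3, hτ.1⟩, fun v hv => by_contra fun h4 => hv ((h2 v).1 h4)⟩
  · left
    refine ⟨fun v => ?_, τ \ σ, h3, fun v hv => ?_⟩
    · unfold cut; split_ifs
      · exact le_rfl
      · exact hx.1 v
    · unfold cut; split_ifs with h5
      · rfl
      · by_contra h6
        exact hv (Finset.mem_sdiff.2 ⟨(h2 v).1 h6, h5⟩)

theorem RepHyp.exists_zero (h : RepHyp L σ A φ ψ) {x : α → ℝ} (hx : x ∈ cn (Repl L σ A)) :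
    ∃ v ∈ σ, x v = 0 := by
  obtain ⟨_, τ, hτ, h2⟩ := hx
  obtain ⟨v, hv, h3⟩ := Finset.not_subset.1 hτ.1
  exact ⟨v, hv, h2 v h3⟩

theorem oldR_sub : cn {τ | τ ∈ L ∧ ¬ σ ⊆ τ} ⊆ cn L := cn_mono fun _ h => h.1

theorem oldR_sub' : cn {τ | τ ∈ L ∧ ¬ σ ⊆ τ} ⊆ cn (Repl L σ A) := cn_mono fun _ h => ⟨h.2, Or.inl h.1⟩

theorem RepHyp.chi_contT (h : RepHyp L σ A φ ψ) :
    ContinuousOn (fun p : ℝ × (α → ℝ) => chiT σ A φ ψ p.1 p.2) (Icc 0 1 ×ˢ cn (Repl L σ A)) := by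
  have hsub : (Icc (0:ℝ) 1 ×ˢ cn (Repl L σ A)) ⊆ (Icc 0 1 ×ˢ {x | cut σ x ∈ cn A}) ∪
      (Icc 0 1 ×ˢ cn {τ | τ ∈ L ∧ ¬ σ ⊆ τ}) := by
    rintro ⟨t, x⟩ ⟨h1, h2⟩
    rcases h.caseR h2 with h3 | h3
    · exact Or.inl ⟨h1, h3⟩
    · exact Or.inr ⟨h1, h3⟩
  refine ContinuousOn.mono ?_ hsub
  refine ContinuousOn.union_of_isClosed ?_ ?_ ?_ ?_
  · have hc : ContinuousOn (fun p : ℝ × (α → ℝ) => φ (cut σ p.2)) (Icc 0 1 ×ˢ {x | cut σ x ∈ cn A}) :=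
      h.hh.cont.comp ((cut_cont σ).comp continuous_snd).continuousOn (fun p hp => hp.2)
    have hs : ContinuousOn (fun p : ℝ × (α → ℝ) => (φ (cut σ p.2)).2) (Icc 0 1 ×ˢ {x | cut σ x ∈ cn A}) :=
      continuous_snd.comp_continuousOn hc
    have h1 : ContinuousOn (fun p : ℝ × (α → ℝ) => res σ p.2 +
        ψ ((φ (cut σ p.2)).1, (1 - p.1) * (φ (cut σ p.2)).2) + (p.1 * (φ (cut σ p.2)).2) • ind σ)
        (Icc 0 1 ×ˢ {x | cut σ x ∈ cn A}) := by
      refine ContinuousOn.add (ContinuousOn.add ((res_cont σ).comp continuous_snd).continuousOn ?_) ?_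
      · refine h.hh.cont'.comp (ContinuousOn.prodMk (continuous_fst.comp_continuousOn hc) ?_) ?_
        · exact (continuous_const.sub continuous_fst).continuousOn.mul hs
        · rintro ⟨t, x⟩ ⟨h1, h2⟩
          refine ⟨trivial, mul_nonneg (by linarith [h1.2]) (h.phi_nonneg h2)⟩
      · exact (continuous_fst.continuousOn.mul hs).smul continuousOn_const
    refine h1.congr ?_
    rintro ⟨t, x⟩ ⟨_, h2⟩
    exact if_pos h2
  · refine continuous_snd.continuousOn.congr ?_
    rintro ⟨t, x⟩ ⟨_, h2⟩
    exact h.chi_id' t (oldR_sub h2)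
  · exact isClosed_Icc.prod ((cn_closed h.finA).preimage (cut_cont σ))
  · exact isClosed_Icc.prod (cn_closed (h.finL.subset fun _ h => h.1))

theorem inf'_cont (hσ : σ.Nonempty) : Continuous fun y : α → ℝ => σ.inf' hσ y :=
  Continuous.finset_inf'_apply hσ fun i _ => continuous_apply i

theorem inf'_smul (hσ : σ.Nonempty) {r : ℝ} (hr : 0 < r) (y : α → ℝ) :
    σ.inf' hσ (r • y) = r * σ.inf' hσ y := by
  apply le_antisymm
  · obtain ⟨v, hv, h⟩ := σ.exists_mem_eq_inf' hσ y
    rw [h]; exact Finset.inf'_le _ hv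
  · refine Finset.le_inf' _ _ fun v hv => ?_
    exact mul_le_mul_of_nonneg_left (Finset.inf'_le _ hv) hr.le

theorem RepHyp.hhχ (h : RepHyp L σ A φ ψ) :
    HH (cn (Repl L σ A)) (cn L) (chiT σ A φ ψ 1) (omeg σ h.hσ (lk L σ) φ ψ) := by
  have hAne : ∀ x, x ∈ cn A → A.Nonempty := fun x hx => ⟨_, hx.2.choose_spec.1⟩
  have hχ : ∀ x, cut σ x ∈ cn A → chiT σ A φ ψ 1 x =
      res σ x + ψ ((φ (cut σ x)).1, 0) + (φ (cut σ x)).2 • ind σ := by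
    intro x hx; unfold chiT; rw [if_pos hx]; simp
  have hω : ∀ y, cut σ y ∈ cn (lk L σ) → omeg σ h.hσ (lk L σ) φ ψ y =
      res σ y - (σ.inf' h.hσ y) • ind σ + ψ ((φ (cut σ y)).1, σ.inf' h.hσ y) := by
    intro y hy; unfold omeg; rw [if_pos hy]
  have hω' : ∀ y, cut σ y ∉ cn (lk L σ) → omeg σ h.hσ (lk L σ) φ ψ y = y := by
    intro y hy; unfold omeg; rw [if_neg hy]
  have hlkA : cn (lk L σ) ⊆ cn A := cn_mono h.sub
  have hinf : ∀ y ∈ cn L, 0 ≤ σ.inf' h.hσ y := fun y hy => Finset.le_inf' _ _ fun v _ => hy.1 v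
  have hcn : ∀ x ∈ cn (Repl L σ A), cut σ x ∉ cn A → x ∈ cn L := by
    intro x hx hc
    exact oldR_sub ((h.caseR hx).resolve_left hc)
  have hold : ∀ y ∈ cn L, cut σ y ∉ cn (lk L σ) → y ∈ cn {τ | τ ∈ L ∧ ¬ σ ⊆ τ} := by
    intro y hy hc
    obtain ⟨τ, hτ, h2⟩ := cn_supp h.dcL hy
    refine ⟨hy.1, τ, ⟨hτ, fun h3 => hc ⟨fun v => ?_, τ \ σ, ⟨Finset.disjoint_sdiff, ?_⟩, fun v hv => ?_⟩⟩,
      fun v hv => by_contra fun h4 => hv ((h2 v).1 h4)⟩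
    · unfold cut; split_ifs
      · exact le_rfl
      · exact hy.1 v
    · rwa [Finset.union_sdiff_of_subset h3]
    · unfold cut; split_ifs with h5
      · rfl
      · by_contra h6
        exact hv (Finset.mem_sdiff.2 ⟨(h2 v).1 h6, h5⟩)
  have hcutadd : ∀ (x z : α → ℝ) (s : ℝ), z ∈ cn A → cut σ (res σ x + z + s • ind σ) = z := by
    intro x z s hz
    funext v
    have := h.zeroσ hz (v := v)
    simp only [cut, res, ind, Pi.add_apply, Pi.smul_apply, smul_eq_mul]
    split_ifs with h1 <;> simp_all
  have hresadd : ∀ (x z : α → ℝ) (s : ℝ), z ∈ cn A → res σ (res σ x + z + s • ind σ) = res σ x + s • ind σ := by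
    intro x z s hz
    funext v
    have := h.zeroσ hz (v := v)
    simp only [res, ind, Pi.add_apply, Pi.smul_apply, smul_eq_mul]
    split_ifs with h1 <;> simp_all
  have mapχ : ∀ x ∈ cn (Repl L σ A), chiT σ A φ ψ 1 x ∈ cn L := by
    intro x hx
    by_cases hc : cut σ x ∈ cn A
    · rw [hχ x hc]
      obtain ⟨h0, ρ, hρ, h2⟩ := h.psi_zero_mem (φ (cut σ x)).1
      refine ⟨fun v => ?_, σ ∪ ρ, hρ.2, fun v hv => ?_⟩
      · have h3 := hx.1 v
        have h4 := h0 v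
        have h5 := h.phi_nonneg hc
        simp only [Pi.add_apply, Pi.smul_apply, smul_eq_mul, res, ind]
        split_ifs <;> simp <;> linarith
      · rw [Finset.mem_union, not_or] at hv
        simp [res, ind, hv.1, h2 v hv.2]
    · have h3 := hcn x hx hc
      rw [h.chi_id' 1 h3]; exact h3
  have mapω : ∀ y ∈ cn L, omeg σ h.hσ (lk L σ) φ ψ y ∈ cn (Repl L σ A) := by
    intro y hy
    by_cases hc : cut σ y ∈ cn (lk L σ)
    · rw [hω y hc]
      obtain ⟨h0, ρ, hρ, h2⟩ := h.psi_mem (φ (cut σ y)).1 (hinf y hy)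
      obtain ⟨v0, hv0, h3⟩ := σ.exists_mem_eq_inf' h.hσ y
      refine ⟨fun v => ?_, σ.erase v0 ∪ ρ, ⟨fun h4 => ?_, Or.inr ?_⟩, fun v hv => ?_⟩
      · have h4 := h0 v
        simp only [Pi.add_apply, Pi.sub_apply, Pi.smul_apply, smul_eq_mul, res, ind]
        split_ifs with h5
        · have := Finset.inf'_le y h5
          linarith
        · simpa using h4
      · have := h4 hv0
        simp only [Finset.mem_union, Finset.mem_erase, ne_eq, not_true_eq_false, false_and, false_or] at this
        exact Finset.disjoint_left.1 (h.dis ρ hρ) hv0 this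
      · refine h.dcA _ hρ _ fun v hv => ?_
        simp only [Finset.mem_sdiff, Finset.mem_union, Finset.mem_erase] at hv
        tauto
      · simp only [Finset.mem_union, Finset.mem_erase, not_or, not_and] at hv
        simp only [Pi.add_apply, Pi.sub_apply, Pi.smul_apply, smul_eq_mul, res, ind, h2 v hv.2]
        split_ifs with h5
        · have : v = v0 := by_contra fun h6 => hv.1 h6 h5
          subst this; rw [h3]; simp
        · simp
    · rw [hω' y hc]; exact oldR_sub' (hold y hy hc)
  refine ⟨mapχ, mapω, ?_, ?_, ?_, ?_, ?_⟩
  · intro x hx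
    by_cases hc : cut σ x ∈ cn A
    · have hp := h.psi_zero_mem (φ (cut σ x)).1
      have hs := h.phi_nonneg hc
      have h1 : cut σ (chiT σ A φ ψ 1 x) = ψ ((φ (cut σ x)).1, 0) := by
        rw [hχ x hc]; exact hcutadd _ _ _ (hlkA hp)
      have h2 : σ.inf' h.hσ (chiT σ A φ ψ 1 x) = (φ (cut σ x)).2 := by
        rw [hχ x hc]
        apply le_antisymm
        · obtain ⟨v, hv, h3⟩ := h.exists_zero hx
          refine (Finset.inf'_le _ hv).trans ?_
          simp [res, ind, hv, h3, h.zeroσ (hlkA hp) hv]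
        · refine Finset.le_inf' _ _ fun v hv => ?_
          simp [res, ind, hv, h.zeroσ (hlkA hp) hv, hx.1 v]
      rw [hω _ (by rw [h1]; exact hp), h1, h2, h.phi_psi _ le_rfl]
      have h3 : res σ (chiT σ A φ ψ 1 x) = res σ x + (φ (cut σ x)).2 • ind σ := by
        rw [hχ x hc]; exact hresadd _ _ _ (hlkA hp)
      rw [h3]
      simp only [Prod.mk.eta, h.hh.left _ hc, add_sub_cancel_right, res_add_cut]
    · have h3 := hcn x hx hc
      rw [h.chi_id' 1 h3, hω' x fun h4 => hc (hlkA h4)]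
  · intro y hy
    by_cases hc : cut σ y ∈ cn (lk L σ)
    · have hs := hinf y hy
      have hp := h.psi_mem (φ (cut σ y)).1 hs
      have h0 := (h.bd _ (hlkA hc)).2 hc
      have h1 : cut σ (omeg σ h.hσ (lk L σ) φ ψ y) = ψ ((φ (cut σ y)).1, σ.inf' h.hσ y) := by
        rw [hω y hc]
        have e : ∀ p : α → ℝ, res σ y - σ.inf' h.hσ y • ind σ + p = res σ y + p + (-(σ.inf' h.hσ y)) • ind σ := by
          intro p; rw [neg_smul]; abel
        rw [e]; exact hcutadd y _ _ hp
      have h3 : res σ (omeg σ h.hσ (lk L σ) φ ψ y) = res σ y - (σ.inf' h.hσ y) • ind σ := by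
        rw [hω y hc]
        have e : ∀ p : α → ℝ, res σ y - σ.inf' h.hσ y • ind σ + p = res σ y + p + (-(σ.inf' h.hσ y)) • ind σ := by
          intro p; rw [neg_smul]; abel
        rw [e, hresadd y _ _ hp, neg_smul, ← sub_eq_add_neg]
      rw [hχ _ (by rw [h1]; exact hp), h1, h3, h.phi_psi _ hs]
      have h4 : ((φ (cut σ y)).1, (0:ℝ)) = φ (cut σ y) := by rw [← h0]
      simp only [h4, h.hh.left _ (hlkA hc)]
      have e : res σ y - σ.inf' h.hσ y • ind σ + cut σ y + σ.inf' h.hσ y • ind σ = res σ y + cut σ y := by abel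
      rw [e, res_add_cut]
    · have h3 := hold y hy hc
      rw [hω' y hc, h.chi_id' 1 (oldR_sub h3)]
  · exact h.chi_contT.comp (f := fun x => ((1:ℝ), x)) (by fun_prop) (fun x hx => ⟨by simp, hx⟩)
  · have hsub : cn L ⊆ (cn L ∩ {y | cut σ y ∈ cn (lk L σ)}) ∪ cn {τ | τ ∈ L ∧ ¬ σ ⊆ τ} := by
      intro y hy
      by_cases hc : cut σ y ∈ cn (lk L σ)
      · exact Or.inl ⟨hy, hc⟩
      · exact Or.inr (hold y hy hc)
    refine ContinuousOn.mono ?_ hsub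
    refine ContinuousOn.union_of_isClosed ?_ ?_ ?_ ?_
    · have h1 : ContinuousOn (fun y => res σ y - (σ.inf' h.hσ y) • ind σ + ψ ((φ (cut σ y)).1, σ.inf' h.hσ y))
          (cn L ∩ {y | cut σ y ∈ cn (lk L σ)}) := by
        refine ContinuousOn.add ?_ ?_
        · exact ((res_cont σ).sub ((inf'_cont h.hσ).smul continuous_const)).continuousOn
        · refine h.hh.cont'.comp (ContinuousOn.prodMk (continuous_fst.comp_continuousOn
            (h.hh.cont.comp (cut_cont σ).continuousOn fun y hy => hlkA hy.2)) (inf'_cont h.hσ).continuousOn) ?_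
          intro y hy
          exact ⟨trivial, hinf y hy.1⟩
      exact h1.congr fun y hy => hω y hy.2
    · refine continuousOn_id.congr fun y hy => ?_
      by_cases hc : cut σ y ∈ cn (lk L σ)
      · rw [hω y hc]
        have h0 := (h.bd _ (hlkA hc)).2 hc
        have h1 : σ.inf' h.hσ y = 0 := by
          apply le_antisymm
          · obtain ⟨v, hv, h3⟩ := h.exists_zero (oldR_sub' hy)
            rw [← h3]; exact Finset.inf'_le _ hv
          · exact hinf y (oldR_sub hy)
        have h4 : ((φ (cut σ y)).1, (0:ℝ)) = φ (cut σ y) := by rw [← h0]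
        rw [h1, h4, h.hh.left _ (hlkA hc), zero_smul, sub_zero, res_add_cut]; rfl
      · exact hω' y hc
    · exact (cn_closed h.finL).inter ((cn_closed (h.finA.subset h.sub)).preimage (cut_cont σ))
    · exact cn_closed (h.finL.subset fun _ h => h.1)
  · intro r hr x hx
    by_cases hc : cut σ x ∈ cn A
    · have hc' : cut σ (r • x) ∈ cn A := by rw [cut_smul]; exact cn_smul hc hr.le
      rw [hχ x hc, hχ _ hc', cut_smul, h.hh.hom r hr _ hc, res_smul]
      have := h.hh.hom' (fun r hr x hx => cn_smul hx hr.le) r hr ((φ (cut σ x)).1, 0) ⟨trivial, by simp⟩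
      simp only [Prod.smul_mk, smul_zero] at this
      simp only [Prod.smul_fst, Prod.smul_snd, this, smul_add, smul_smul, smul_eq_mul]
    · have h3 := hcn x hx hc
      rw [h.chi_id' 1 h3, h.chi_id' 1 (cn_smul h3 hr.le)]

theorem RepHyp.omeg_id (h : RepHyp L σ A φ ψ) {x : α → ℝ} (hx : x ∈ cn {τ | τ ∈ L ∧ ¬ σ ⊆ τ}) :
    omeg σ h.hσ (lk L σ) φ ψ x = x := by
  have h1 := h.hhχ.left x (oldR_sub' hx)
  rwa [h.chi_id' 1 (oldR_sub hx)] at h1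
end

abbrev EE (n : ℕ) : Type := EuclideanSpace ℝ (Fin n)

def Sph {α : Type} (N : ℕ) (A : Set (Finset α)) : Prop :=
  ∃ (φ : (α → ℝ) → EE N) (ψ : EE N → (α → ℝ)), HH (cn A) univ φ ψ

def Dsk {α : Type} (n : ℕ) (A B : Set (Finset α)) : Prop :=
  ∃ (φ : (α → ℝ) → EE n × ℝ) (ψ : EE n × ℝ → (α → ℝ)), HH (cn A) (univ ×ˢ Ici 0) φ ψ ∧
    ∀ x ∈ cn A, (φ x).2 = 0 ↔ x ∈ cn B

theorem cn_hsmul {α : Type} {A : Set (Finset α)} : ∀ r : ℝ, 0 < r → ∀ x ∈ cn A, r • x ∈ cn A :=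
  fun _ hr _ hx => cn_smul hx hr.le

section
variable {α : Type} {F : Type} [NormedAddCommGroup F] [NormedSpace ℝ F] [FiniteDimensional ℝ F]

theorem hh_equiv {G : Type} [NormedAddCommGroup G] [NormedSpace ℝ G] (e : F ≃L[ℝ] G) :
    HH (univ : Set F) (univ : Set G) e e.symm where
  map _ _ := trivial
  map' _ _ := trivial
  left x _ := e.symm_apply_apply x
  right x _ := e.apply_symm_apply x
  cont := e.continuous.continuousOn
  cont' := e.symm.continuous.continuousOn
  hom r _ x _ := e.map_smul r x

theorem Sph.of {N : ℕ} {A : Set (Finset α)} {φ : (α → ℝ) → F} {ψ : F → (α → ℝ)}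
    (h : HH (cn A) univ φ ψ) (hN : Module.finrank ℝ F = N) : Sph N A := by
  have e : F ≃L[ℝ] EE N := ContinuousLinearEquiv.ofFinrankEq (by simp [hN])
  exact ⟨_, _, h.trans (hh_equiv e)⟩

theorem Sph.nonempty {N : ℕ} {A : Set (Finset α)} (h : Sph N A) : A.Nonempty := by
  obtain ⟨φ, ψ, h⟩ := h
  obtain ⟨_, σ, hσ, _⟩ := h.map' 0 trivial
  exact ⟨σ, hσ⟩
end

section
variable {α : Type}

structure Mfd (N : ℕ) (L B : Set (Finset α)) : Prop where
  dcL : DC L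
  dcB : DC B
  sub : B ⊆ L
  fin : ∃ S, FinC L S
  sph : ∀ σ ∈ L, σ ∉ B → ∃ n, n + σ.card = N ∧ Sph n (lk L σ)
  dsk : ∀ σ ∈ B, ∃ n, n + σ.card + 1 = N ∧ Dsk n (lk L σ) (lk B σ)

def Full (L B : Set (Finset α)) : Prop := ∀ τ ∈ L, τ.Nonempty → (∀ v ∈ τ, {v} ∈ B) → τ ∈ B

theorem lk_empty (L : Set (Finset α)) : lk L ∅ = L := by
  ext τ; simp [mem_lk]

theorem lk_lk (L : Set (Finset α)) {σ τ : Finset α} (h : Disjoint σ τ) : lk (lk L σ) τ = lk L (σ ∪ τ) := by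
  ext ρ
  simp only [mem_lk, Finset.disjoint_union_right, Finset.disjoint_union_left, Finset.union_assoc]
  tauto

theorem lk_void (σ : Finset α) : lk (∅ : Set (Finset α)) σ = ∅ := by
  ext ρ; simp [mem_lk]

theorem lk_mono {L B : Set (Finset α)} (h : B ⊆ L) (σ : Finset α) : lk B σ ⊆ lk L σ :=
  fun _ hτ => ⟨hτ.1, h hτ.2⟩

theorem empty_mem_lk {L : Set (Finset α)} {σ : Finset α} (h : σ ∈ L) : ∅ ∈ lk L σ :=
  ⟨Finset.disjoint_empty_right _, by simpa using h⟩

theorem Mfd.finite {N : ℕ} {L B : Set (Finset α)} (h : Mfd N L B) : L.Finite :=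
  h.fin.choose_spec.finite

theorem Mfd.card_le {N : ℕ} {L B : Set (Finset α)} (h : Mfd N L B) {σ : Finset α} (hσ : σ ∈ L) :
    σ.card ≤ N := by
  by_cases hb : σ ∈ B
  · obtain ⟨n, hn, _⟩ := h.dsk σ hb; omega
  · obtain ⟨n, hn, _⟩ := h.sph σ hσ hb; omega

theorem Mfd.lk {N n : ℕ} {L B : Set (Finset α)} (h : Mfd N L B) {σ : Finset α}
    (hn : n + σ.card = N) : Mfd n (lk L σ) (lk B σ) where
  dcL := h.dcL.lk σ
  dcB := h.dcB.lk σ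
  sub := lk_mono h.sub σ
  fin := ⟨_, h.fin.choose_spec.lk σ⟩
  sph := by
    rintro τ ⟨h1, h2⟩ h3
    obtain ⟨k, hk, hs⟩ := h.sph _ h2 fun h4 => h3 ⟨h1, h4⟩
    rw [Finset.card_union_of_disjoint h1] at hk
    exact ⟨k, by omega, by rwa [lk_lk _ h1]⟩
  dsk := by
    rintro τ ⟨h1, h2⟩
    obtain ⟨k, hk, hs⟩ := h.dsk _ h2
    rw [Finset.card_union_of_disjoint h1] at hk
    exact ⟨k, by omega, by rwa [lk_lk _ h1, lk_lk _ h1]⟩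

theorem Dsk_cone' {n : ℕ} {K : Set (Finset α)} {c : α} (h : Sph n K) (hc : ∀ τ ∈ K, c ∉ τ) :
    ∃ (φ : (α → ℝ) → EE n × ℝ) (ψ : EE n × ℝ → (α → ℝ)), HH (cn (coneC c K)) (univ ×ˢ Ici 0) φ ψ ∧
    (∀ x ∈ cn (coneC c K), (φ x).2 = 0 ↔ x ∈ cn K) ∧
    ∀ x ∈ cn (coneC c K), (φ x).2 = x c / 2 ∧ ψ ((φ x).1, 0) = cut {c} x := by
  obtain ⟨φ, ψ, h⟩ := h
  have hcut : ∀ x ∈ cn (coneC c K), cut {c} x ∈ cn K := by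
    rintro x ⟨h1, σ, hσ, h2⟩
    refine ⟨fun v => ?_, σ.erase c, hσ, fun v hv => ?_⟩
    · unfold cut; split_ifs
      · exact le_rfl
      · exact h1 v
    · unfold cut; split_ifs with h3
      · rfl
      · exact h2 v fun h4 => hv (Finset.mem_erase.2 ⟨by simpa using h3, h4⟩)
  have hc0 : ∀ x ∈ cn K, x c = 0 := by
    rintro x ⟨h1, σ, hσ, h2⟩
    exact h2 c (hc σ hσ)
  have hKc : ∀ x ∈ cn K, cut {c} x = x := by
    intro x hx; funext v; unfold cut; split_ifs with h1
    · rw [Finset.mem_singleton.1 h1, hc0 x hx]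
    · rfl
  have hadd : ∀ x ∈ cn K, ∀ s : ℝ, cut {c} (x + s • ind {c}) = x := by
    intro x hx s
    funext v; simp only [cut, ind, Pi.add_apply, Pi.smul_apply, smul_eq_mul]
    split_ifs with h1
    · rw [Finset.mem_singleton.1 h1, hc0 x hx]
    · simp
  have hadd' : ∀ x ∈ cn K, ∀ s : ℝ, (x + s • ind {c}) c = s := by
    intro x hx s; simp [ind, hc0 x hx]
  have hsum : ∀ x : α → ℝ, cut {c} x + x c • ind {c} = x := by
    intro x; funext v; simp only [cut, ind, Pi.add_apply, Pi.smul_apply, smul_eq_mul]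
    split_ifs with h1
    · rw [Finset.mem_singleton.1 h1]; simp
    · simp
  refine ⟨fun x => (φ (cut {c} x), x c / 2), fun p => ψ p.1 + (2 * p.2) • ind {c}, ⟨?_, ?_, ?_, ?_, ?_, ?_, ?_⟩, ?_, ?_⟩
  · intro x hx; exact ⟨trivial, div_nonneg (hx.1 c) (by norm_num)⟩
  · rintro ⟨e, s⟩ ⟨_, hs⟩
    obtain ⟨h1, σ, hσ, h2⟩ := h.map' e trivial
    refine ⟨fun v => ?_, insert c σ, ?_, fun v hv => ?_⟩
    · have := h1 v
      have h0 : 0 ≤ s := hs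
      simp only [ind, Pi.add_apply, Pi.smul_apply, smul_eq_mul]
      split_ifs <;> simp <;> linarith
    · rw [mem_coneC, Finset.erase_insert (hc σ hσ)]; exact hσ
    · simp only [Finset.mem_insert, not_or] at hv
      simp [ind, hv.1, h2 v hv.2]
  · intro x hx
    simp only [h.left _ (hcut x hx), mul_div_cancel₀ _ (two_ne_zero (α := ℝ)), hsum]
  · rintro ⟨e, s⟩ ⟨_, hs⟩
    have := h.map' e trivial
    simp only [hadd _ this, hadd' _ this, h.right e trivial]
    rw [mul_div_cancel_left₀ _ (two_ne_zero (α := ℝ))]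
  · exact (h.cont.comp (cut_cont _).continuousOn hcut).prodMk ((continuous_apply c).div_const 2).continuousOn
  · refine ContinuousOn.add ?_ ?_
    · exact h.cont'.comp continuous_fst.continuousOn (fun _ _ => trivial)
    · exact ((continuous_const.mul continuous_snd).smul continuous_const).continuousOn
  · intro r hr x hx
    simp only [cut_smul, h.hom r hr _ (hcut x hx), Prod.smul_mk, Pi.smul_apply, smul_eq_mul, mul_div_assoc]
  · intro x hx
    constructor
    · intro h1
      have h2 := hsum x
      have h3 : x c = 0 := by
        have : x c / 2 = 0 := h1
        linarith
      rw [h3, zero_smul, add_zero] at h2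
      rw [← h2]; exact hcut x hx
    · intro h1
      have : x c / 2 = 0 := by rw [hc0 x h1]; simp
      exact this
  · intro x hx
    refine ⟨rfl, ?_⟩
    simp only [h.left _ (hcut x hx), mul_zero, zero_smul, add_zero]

theorem Dsk_cone {n : ℕ} {K : Set (Finset α)} {c : α} (h : Sph n K) (hc : ∀ τ ∈ K, c ∉ τ) :
    Dsk n (coneC c K) K := by
  obtain ⟨φ, ψ, h1, h2, _⟩ := Dsk_cone' h hc
  exact ⟨φ, ψ, h1, h2⟩

theorem lk_coneC_mem {K : Set (Finset α)} {c : α} (hc : ∀ τ ∈ K, c ∉ τ) {τ : Finset α} (h : c ∈ τ) :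
    lk (coneC c K) τ = lk K (τ.erase c) := by
  ext ρ
  simp only [mem_lk, mem_coneC]
  constructor
  · rintro ⟨h1, h2⟩
    have h3 : c ∉ ρ := Finset.disjoint_left.1 h1 h
    rw [Finset.erase_union_distrib, Finset.erase_eq_of_notMem h3] at h2
    exact ⟨h1.mono_left (Finset.erase_subset _ _), h2⟩
  · rintro ⟨h1, h2⟩
    have h3 : c ∉ ρ := fun h3 => hc _ h2 (Finset.mem_union_right _ h3)
    rw [Finset.erase_union_distrib, Finset.erase_eq_of_notMem h3]
    refine ⟨?_, h2⟩
    rw [← Finset.insert_erase h, Finset.disjoint_insert_left]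
    exact ⟨h3, h1⟩

theorem lk_coneC_notMem {K : Set (Finset α)} {c : α} {τ : Finset α} (h : c ∉ τ) :
    lk (coneC c K) τ = coneC c (lk K τ) := by
  ext ρ
  simp only [mem_lk, mem_coneC, Finset.erase_union_distrib, Finset.erase_eq_of_notMem h]
  refine and_congr_left fun _ => ?_
  refine ⟨fun h1 => h1.mono_right (Finset.erase_subset _ _), fun h1 => ?_⟩
  by_cases h2 : c ∈ ρ
  · rw [← Finset.insert_erase h2, Finset.disjoint_insert_right]
    exact ⟨h, h1⟩
  · rwa [Finset.erase_eq_of_notMem h2] at h1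

theorem coneC_sub {K : Set (Finset α)} {c : α} (hc : ∀ τ ∈ K, c ∉ τ) : K ⊆ coneC c K := by
  intro τ h; rw [mem_coneC, Finset.erase_eq_of_notMem (hc τ h)]; exact h

theorem coneC_of_notMem {K : Set (Finset α)} {c : α} {τ : Finset α} (h : τ ∈ coneC c K) (hc : c ∉ τ) : τ ∈ K := by
  rwa [mem_coneC, Finset.erase_eq_of_notMem hc] at h

theorem Mfd.cone {N : ℕ} {K : Set (Finset α)} (h : Mfd N K ∅) {c : α}
    (hc : ∀ τ ∈ K, c ∉ τ) : Mfd (N + 1) (coneC c K) K where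
  dcL := h.dcL.cone c
  dcB := h.dcL
  sub := coneC_sub hc
  fin := by
    obtain ⟨S, hS⟩ := h.fin
    refine ⟨insert c S, fun σ hσ v hv => ?_⟩
    by_cases h1 : v = c
    · simp [h1]
    · exact Finset.mem_insert_of_mem (hS _ hσ (Finset.mem_erase.2 ⟨h1, hv⟩))
  sph := by
    intro σ hσ h2
    have h3 : c ∈ σ := by_contra fun h3 => h2 (coneC_of_notMem hσ h3)
    obtain ⟨n, hn, hs⟩ := h.sph _ (mem_coneC.1 hσ) (by simp)
    have := Finset.card_erase_add_one h3
    exact ⟨n, by omega, by rwa [lk_coneC_mem hc h3]⟩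
  dsk := by
    intro σ hσ
    obtain ⟨n, hn, hs⟩ := h.sph _ hσ (by simp)
    refine ⟨n, by omega, ?_⟩
    rw [lk_coneC_notMem (hc σ hσ)]
    exact Dsk_cone hs fun τ hτ h4 => hc _ hτ.2 (Finset.mem_union_right _ h4)

theorem Full.cone {K : Set (Finset α)} {c : α} (hc : ∀ τ ∈ K, c ∉ τ) : Full (coneC c K) K := by
  intro τ h1 _ h2
  exact coneC_of_notMem h1 fun h3 => hc _ (h2 c h3) (by simp)
end

section
variable {α : Type}

theorem fsdiff {s t u : Finset α} : s \ t ⊆ u ↔ s ⊆ t ∪ u := by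
  constructor
  · intro h v hv
    have := @h v
    simp only [Finset.mem_sdiff, Finset.mem_union] at this ⊢; tauto
  · intro h v hv
    simp only [Finset.mem_sdiff] at hv
    have := h hv.1
    simp only [Finset.mem_union] at this; tauto

theorem fdisj {s t : Finset α} (h : Disjoint s t) (v : α) : v ∈ s → v ∉ t := fun h1 => Finset.disjoint_left.1 h h1

noncomputable def extJ (T : Finset α) (a : {v // v ∈ T} → ℝ) : α → ℝ :=
  fun v => if h : v ∈ T then a ⟨v, h⟩ else 0

theorem extJ_cont (T : Finset α) : Continuous (extJ T) := by
  refine continuous_pi fun v => ?_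
  unfold extJ; split_ifs with h
  · exact continuous_apply _
  · exact continuous_const

theorem Sph.join {n m : ℕ} {A : Set (Finset α)} (h : Sph n A) (hA : DC A) {σ : Finset α}
    (hσ : σ.Nonempty) (dis : ∀ β ∈ A, Disjoint σ β) (hm : m + 1 = n + σ.card) :
    Sph m (Repl ∅ σ A) := by
  obtain ⟨φ, ψ, h⟩ := h
  obtain ⟨v0, hv0⟩ := id hσ
  have hz : ∀ x ∈ cn A, ∀ v ∈ σ, x v = 0 := by
    rintro x ⟨_, ρ, hρ, h2⟩ v hv
    exact h2 v fun h3 => Finset.disjoint_left.1 (dis ρ hρ) hv h3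
  have hcut : ∀ x ∈ cn (Repl ∅ σ A), cut σ x ∈ cn A := by
    rintro x ⟨h1, τ, ⟨_, hτ⟩, h2⟩
    have hτ : τ \ σ ∈ A := by simpa using hτ
    refine ⟨fun v => ?_, τ \ σ, hτ, fun v hv => ?_⟩
    · unfold cut; split_ifs
      · exact le_rfl
      · exact h1 v
    · unfold cut; split_ifs with h3
      · rfl
      · exact h2 v fun h4 => hv (Finset.mem_sdiff.2 ⟨h4, h3⟩)
  have hex : ∀ x ∈ cn (Repl ∅ σ A), ∃ v ∈ σ, x v = 0 := by
    rintro x ⟨h1, τ, ⟨hτ, _⟩, h2⟩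
    obtain ⟨v, hv, h3⟩ := Finset.not_subset.1 hτ
    exact ⟨v, hv, h2 v h3⟩
  set T := σ.erase v0 with hT
  let m0 : ({v // v ∈ T} → ℝ) → ℝ := fun a => σ.inf' hσ (extJ T a)
  have hmem : ∀ p : ({v // v ∈ T} → ℝ) × EE n, ψ p.2 + (extJ T p.1 - m0 p.1 • ind σ) ∈ cn (Repl ∅ σ A) := by
    rintro ⟨a, e⟩
    obtain ⟨h1, ρ, hρ, h2⟩ := h.map' e trivial
    obtain ⟨w, hw, h3⟩ := σ.exists_mem_eq_inf' hσ (extJ T a)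
    refine ⟨fun v => ?_, σ.erase w ∪ ρ, ⟨fun h4 => ?_, Or.inr ?_⟩, fun v hv => ?_⟩
    · have h4 := h1 v
      simp only [Pi.add_apply, Pi.sub_apply, Pi.smul_apply, smul_eq_mul, ind]
      split_ifs with h5
      · have : m0 a ≤ extJ T a v := Finset.inf'_le _ h5
        linarith
      · have : extJ T a v = 0 := by
          unfold extJ; rw [dif_neg]; intro h6; exact h5 (Finset.mem_of_mem_erase h6)
        rw [this]; simpa using h4
    · have := h4 hw
      simp only [Finset.mem_union, Finset.mem_erase, ne_eq, not_true_eq_false, false_and, false_or] at this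
      exact Finset.disjoint_left.1 (dis ρ hρ) hw this
    · refine hA _ hρ _ fun v hv => ?_
      simp only [Finset.mem_sdiff, Finset.mem_union, Finset.mem_erase] at hv
      tauto
    · simp only [Finset.mem_union, Finset.mem_erase, not_or, not_and] at hv
      simp only [Pi.add_apply, Pi.sub_apply, Pi.smul_apply, smul_eq_mul, ind, h2 v hv.2]
      split_ifs with h5
      · have : v = w := by_contra fun h6 => hv.1 h6 h5
        subst this
        have : m0 a = extJ T a v := h3
        rw [this]; simp
      · have : extJ T a v = 0 := by
          unfold extJ; rw [dif_neg]; intro h6; exact h5 (Finset.mem_of_mem_erase h6)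
        rw [this]; simp
  have key : HH (cn (Repl ∅ σ A)) (univ : Set (({v // v ∈ T} → ℝ) × EE n))
      (fun x => (fun v => x v.1 - x v0, φ (cut σ x)))
      (fun p => ψ p.2 + (extJ T p.1 - m0 p.1 • ind σ)) := by
    refine ⟨fun _ _ => trivial, fun p _ => hmem p, ?_, ?_, ?_, ?_, ?_⟩
    · intro x hx
      have h1 : ∀ v ∈ σ, extJ T (fun v => x v.1 - x v0) v = x v - x v0 := by
        intro v hv
        unfold extJ; split_ifs with h2
        · rfl
        · have : v = v0 := by_contra fun h6 => h2 (Finset.mem_erase.2 ⟨h6, hv⟩)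
          rw [this]; simp
      have h2 : m0 (fun v => x v.1 - x v0) = - x v0 := by
        apply le_antisymm
        · obtain ⟨w, hw, h3⟩ := hex x hx
          refine (Finset.inf'_le _ hw).trans ?_
          rw [h1 w hw, h3]; simp
        · refine Finset.le_inf' _ _ fun v hv => ?_
          rw [h1 v hv]; linarith [hx.1 v]
      simp only [h.left _ (hcut x hx), h2]
      funext v
      simp only [Pi.add_apply, Pi.sub_apply, Pi.smul_apply, smul_eq_mul, ind, cut]
      split_ifs with h3
      · rw [h1 v h3]; ring
      · have : extJ T (fun v => x v.1 - x v0) v = 0 := by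
          unfold extJ; rw [dif_neg]; intro h6; exact h3 (Finset.mem_of_mem_erase h6)
        rw [this]; simp
    · rintro ⟨a, e⟩ _
      have hp := h.map' e trivial
      have h1 : cut σ (ψ e + (extJ T a - m0 a • ind σ)) = ψ e := by
        funext v
        simp only [Pi.add_apply, Pi.sub_apply, Pi.smul_apply, smul_eq_mul, ind, cut]
        split_ifs with h3
        · exact (hz _ hp v h3).symm
        · have : extJ T a v = 0 := by
            unfold extJ; rw [dif_neg]; intro h6; exact h3 (Finset.mem_of_mem_erase h6)
          rw [this]; simp
      simp only [h1, h.right e trivial, Prod.mk.injEq, and_true]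
      funext ⟨v, hv⟩
      have hvσ := Finset.mem_of_mem_erase hv
      have e1 : extJ T a v = a ⟨v, hv⟩ := by unfold extJ; rw [dif_pos hv]
      have e2 : extJ T a v0 = 0 := by unfold extJ; rw [dif_neg]; simp [hT]
      simp [ind, hvσ, hv0, hz _ hp v hvσ, hz _ hp v0 hv0, e1, e2]
    · refine ContinuousOn.prodMk ?_ ?_
      · exact Continuous.continuousOn (by fun_prop)
      · exact h.cont.comp (cut_cont _).continuousOn hcut
    · have hψ : Continuous ψ := continuousOn_univ.1 h.cont'
      have hm0 : Continuous m0 := (inf'_cont hσ).comp (extJ_cont T)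
      exact ((hψ.comp continuous_snd).add (((extJ_cont T).comp continuous_fst).sub
        ((hm0.comp continuous_fst).smul continuous_const))).continuousOn
    · intro r hr x hx
      simp only [cut_smul, h.hom r hr _ (hcut x hx), Prod.smul_mk, Prod.mk.injEq, and_true]
      funext v; simp [mul_sub]
  refine Sph.of key ?_
  have : T.card + 1 = σ.card := Finset.card_erase_add_one hv0
  simp only [Module.finrank_prod, Module.finrank_pi, Fintype.card_coe, finrank_euclideanSpace, Fintype.card_fin]
  omega

theorem lk_Repl {L A : Set (Finset α)} {σ τ : Finset α} (dis : ∀ β ∈ A, Disjoint σ β) :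
    lk (Repl L σ A) τ = Repl (lk L τ) (σ \ τ) (lk A (τ \ σ)) := by
  ext ρ
  have e1 : σ ⊆ τ ∪ ρ ↔ σ \ τ ⊆ ρ := by
    rw [fsdiff]
  simp only [mem_lk, mem_Repl, e1]
  constructor
  · rintro ⟨h1, h2, h3⟩
    refine ⟨h2, ?_⟩
    rcases h3 with h3 | h3
    · exact Or.inl ⟨h1, h3⟩
    · right
      have e2 : ρ \ (σ \ τ) = ρ \ σ := by
        ext v
        have := fdisj h1 v
        simp only [Finset.mem_sdiff]; tauto
      rw [e2, ← Finset.union_sdiff_distrib]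
      exact ⟨h1.mono Finset.sdiff_subset Finset.sdiff_subset, h3⟩
  · rintro ⟨h2, h3⟩
    rcases h3 with h3 | ⟨h3, h4⟩
    · exact ⟨h3.1, h2, Or.inl h3.2⟩
    · have h5 := dis _ h4
      have e2 : ρ \ (σ \ τ) = ρ \ σ := by
        ext v
        have := fdisj h5 v
        simp only [Finset.mem_sdiff, Finset.mem_union] at this ⊢; tauto
      refine ⟨?_, h2, Or.inr ?_⟩
      · rw [Finset.disjoint_left]
        intro v hv hv'
        have h6 := fdisj h5 v
        have h7 := fdisj h3 v
        simp only [Finset.mem_sdiff, Finset.mem_union] at h6 h7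
        tauto
      · rwa [Finset.union_sdiff_distrib, ← e2]

structure RH (N M : ℕ) (L B : Set (Finset α)) (σ : Finset α) (A : Set (Finset α)) : Prop where
  mL : Mfd N L B
  mA : Mfd M A (lk L σ)
  hσ : σ.Nonempty
  hL : σ ∈ L
  hB : σ ∉ B
  hM : M + σ.card = N + 1
  dis : ∀ β ∈ A, Disjoint σ β
  int : ∀ β ∈ A, β ∈ L → β ∈ lk L σ

variable {N M : ℕ} {L B A : Set (Finset α)} {σ : Finset α}

theorem RH.lkA (h : RH N M L B σ A) {τ : Finset α} (hτ : ¬ σ ⊆ τ) (hL : τ ∈ L) (hA : τ \ σ ∈ A) :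
    ∃ (n : ℕ) (φ : (α → ℝ) → EE n × ℝ) (ψ : EE n × ℝ → (α → ℝ)),
      RepHyp (lk L τ) (σ \ τ) (lk A (τ \ σ)) φ ψ := by
  have hβ : τ \ σ ∈ lk L σ := h.int _ hA (h.mL.dcL _ hL _ Finset.sdiff_subset)
  obtain ⟨n, hn, φ, ψ, hh, hbd⟩ := h.mA.dsk _ hβ
  have e : lk (lk L τ) (σ \ τ) = lk (lk L σ) (τ \ σ) := by
    rw [lk_lk _ Finset.disjoint_sdiff, lk_lk _ Finset.disjoint_sdiff]
    congr 1; ext v; simp only [Finset.mem_union, Finset.mem_sdiff]; tauto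
  refine ⟨n, φ, ψ, h.mL.dcL.lk τ, h.mA.dcL.lk _, (h.mL.fin.choose_spec.lk _).finite,
    (h.mA.fin.choose_spec.lk _).finite, ?_, ?_, ?_, ?_, hh, ?_⟩
  · rwa [Finset.sdiff_nonempty]
  · intro β hβ
    exact ((h.dis _ hβ.2).mono_left Finset.sdiff_subset).mono_right Finset.subset_union_right
  · rw [e]; exact lk_mono h.mA.sub _
  · rintro β ⟨h1, h2⟩ ⟨h3, h4⟩
    rw [e]
    refine ⟨h1, h.int _ h2 (h.mL.dcL _ h4 _ ?_)⟩
    exact Finset.union_subset_union Finset.sdiff_subset le_rfl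
  · rw [e]; exact hbd

theorem Sph.transfer {n : ℕ} {L L' : Set (Finset α)} {χ ω : (α → ℝ) → (α → ℝ)} (h : Sph n L)
    (hh : HH (cn L') (cn L) χ ω) : Sph n L' := by
  obtain ⟨φ, ψ, h⟩ := h
  exact ⟨_, _, hh.trans h⟩

theorem Dsk.transfer {n : ℕ} {L L' B : Set (Finset α)} {χ ω : (α → ℝ) → (α → ℝ)} (h : Dsk n L B)
    (hh : HH (cn L') (cn L) χ ω) (hB : cn B ⊆ cn L) (hid : ∀ x ∈ cn B, x ∈ cn L' ∧ χ x = x) : Dsk n L' B := by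
  obtain ⟨φ, ψ, h, h2⟩ := h
  refine ⟨_, _, hh.trans h, fun x hx => ?_⟩
  rw [h2 _ (hh.map x hx)]
  constructor
  · intro h3
    have h4 := hid _ h3
    have h5 : ω (χ (χ x)) = χ x := hh.left _ h4.1
    rw [h4.2, hh.left _ hx] at h5
    rwa [h5]
  · intro h3
    rwa [(hid x h3).2]

theorem RH.lk_out (h : RH N M L B σ A) {τ : Finset α} (hA : τ \ σ ∉ A) :
    lk (Repl L σ A) τ = lk L τ := by
  rw [lk_Repl h.dis]
  ext ρ
  rw [mem_Repl]
  constructor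
  · rintro ⟨_, h2 | h2⟩
    · exact h2
    · exact absurd (h.mA.dcL _ h2.2 _ Finset.subset_union_left) hA
  · intro h1
    refine ⟨fun h2 => hA (h.mA.sub ⟨Finset.disjoint_sdiff, h.mL.dcL _ h1.2 _ ?_⟩), Or.inl h1⟩
    rw [fsdiff] at h2
    exact Finset.union_subset h2 (Finset.sdiff_subset.trans Finset.subset_union_left)

theorem RH.mem_L (h : RH N M L B σ A) {τ : Finset α} (hA : τ \ σ ∈ A) (hL : τ \ σ ∈ L) : τ ∈ L := by
  refine h.mL.dcL _ (h.int _ hA hL).2 _ fun v hv => ?_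
  simp only [Finset.mem_union, Finset.mem_sdiff]; tauto

theorem RH.B_sub (h : RH N M L B σ A) : ∀ τ ∈ B, ¬ σ ⊆ τ := fun τ hτ h2 => h.hB (h.mL.dcB _ hτ _ h2)

theorem RH.mfd (h : RH N M L B σ A) : Mfd N (Repl L σ A) B where
  dcL := h.mL.dcL.rep h.mA.dcL σ
  dcB := h.mL.dcB
  sub τ hτ := ⟨h.B_sub τ hτ, Or.inl (h.mL.sub hτ)⟩
  fin := by
    obtain ⟨S, hS⟩ := h.mL.fin
    obtain ⟨T, hT⟩ := h.mA.fin
    refine ⟨S ∪ (T ∪ σ), ?_⟩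
    rintro τ ⟨_, h2 | h2⟩
    · exact (hS _ h2).trans Finset.subset_union_left
    · intro v hv
      by_cases h3 : v ∈ σ
      · simp [h3]
      · simp [hT _ h2 (Finset.mem_sdiff.2 ⟨hv, h3⟩)]
  sph := by
    rintro τ hτ hB
    by_cases hA : τ \ σ ∈ A
    · by_cases hL : τ \ σ ∈ L
      · have hτL := h.mem_L hA hL
        obtain ⟨n, hn, hs⟩ := h.mL.sph τ hτL hB
        obtain ⟨k, φ, ψ, hR⟩ := h.lkA hτ.1 hτL hA
        refine ⟨n, hn, ?_⟩
        rw [lk_Repl h.dis]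
        exact hs.transfer hR.hhχ
      · obtain ⟨n, hn, hs⟩ := h.mA.sph _ hA fun h2 => hL (h.mL.dcL.lk_sub h2)
        have e : lk L τ = ∅ := by
          ext ρ; simp only [mem_empty_iff_false, iff_false]
          rintro ⟨_, h2⟩
          exact hL (h.mL.dcL _ h2 _ (Finset.sdiff_subset.trans Finset.subset_union_left))
        have c1 := Finset.card_sdiff_add_card σ τ
        have c2 := Finset.card_sdiff_add_card τ σ
        rw [Finset.union_comm] at c2
        have c3 : 0 < (σ \ τ).card := Finset.card_pos.2 (Finset.sdiff_nonempty.2 hτ.1)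
        have hM := h.hM
        refine ⟨n + (σ \ τ).card - 1, by omega, ?_⟩
        rw [lk_Repl h.dis, e]
        refine hs.join (h.mA.dcL.lk _) (Finset.sdiff_nonempty.2 hτ.1) ?_ (by omega)
        intro β hβ
        exact ((h.dis _ hβ.2).mono_left Finset.sdiff_subset).mono_right Finset.subset_union_right
    · rw [h.lk_out hA]
      exact h.mL.sph τ (hτ.2.resolve_right hA) hB
  dsk := by
    intro τ hB
    have hτL := h.mL.sub hB
    by_cases hA : τ \ σ ∈ A
    · obtain ⟨n, hn, hs⟩ := h.mL.dsk τ hB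
      obtain ⟨k, φ, ψ, hR⟩ := h.lkA (h.B_sub τ hB) hτL hA
      refine ⟨n, hn, ?_⟩
      rw [lk_Repl h.dis]
      refine hs.transfer hR.hhχ (cn_mono (lk_mono h.mL.sub _)) fun x hx => ?_
      have h1 : x ∈ cn {ρ | ρ ∈ lk L τ ∧ ¬ σ \ τ ⊆ ρ} := by
        refine cn_mono ?_ hx
        rintro ρ hρ
        refine ⟨lk_mono h.mL.sub _ hρ, fun h2 => h.B_sub _ hρ.2 ?_⟩
        rwa [fsdiff] at h2
      exact ⟨oldR_sub' h1, hR.chi_id' 1 (oldR_sub h1)⟩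
    · rw [h.lk_out hA]
      exact h.mL.dsk τ hB

theorem RH.full (h : RH N M L B σ A) (hF : Full L B) (hA : Full A (lk L σ)) : Full (Repl L σ A) B := by
  rintro τ ⟨h1, h2⟩ hne hv
  refine hF τ ?_ hne hv
  rcases h2 with h2 | h2
  · exact h2
  · refine h.mem_L h2 ?_
    rcases (τ \ σ).eq_empty_or_nonempty with h3 | h3
    · rw [h3]; exact h.mL.dcL _ h.hL _ (Finset.empty_subset _)
    · refine h.mL.dcL.lk_sub (hA _ h2 h3 fun v hv' => h.int _ ?_ ?_)
      · exact h.mA.dcL _ h2 _ (by simpa using hv')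
      · exact h.mL.sub (hv v (Finset.mem_sdiff.1 hv').1)

/-- the global homeomorphism data for a replacement -/
theorem RH.rep (h : RH N M L B σ A) : ∃ (n : ℕ) (φ : (α → ℝ) → EE n × ℝ) (ψ : EE n × ℝ → (α → ℝ)),
      RepHyp L σ A φ ψ := by
  have := h.lkA (τ := ∅) (fun h1 => h.hσ.ne_empty (Finset.subset_empty.1 h1))
    (h.mL.dcL _ h.hL _ (Finset.empty_subset _)) (by
      rw [Finset.empty_sdiff]; exact h.mA.sub (empty_mem_lk h.hL))
  simpa [lk_empty] using this
end

section
variable {α β : Type}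

/-- boundary of a simplex -/
def bdS (S : Finset α) : Set (Finset α) := Repl ∅ S {∅}

theorem mem_bdS {S τ : Finset α} : τ ∈ bdS S ↔ τ ⊆ S ∧ τ ≠ S := by
  simp only [bdS, mem_Repl, mem_empty_iff_false, false_or, mem_singleton_iff, Finset.sdiff_eq_empty_iff_subset]
  constructor
  · rintro ⟨h1, h2⟩
    exact ⟨h2, fun h => h1 (h ▸ le_rfl)⟩
  · rintro ⟨h1, h2⟩
    exact ⟨fun h => h2 (Finset.Subset.antisymm h1 h), h1⟩

theorem Sph_pt : Sph 0 ({∅} : Set (Finset α)) := by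
  refine ⟨fun _ => 0, fun _ => 0, ⟨fun _ _ => trivial, fun _ _ => ⟨fun _ => le_rfl, ∅, rfl, fun _ _ => rfl⟩, ?_, ?_, ?_, ?_, ?_⟩⟩
  · rintro x ⟨_, σ, hσ, h⟩
    rw [mem_singleton_iff] at hσ
    subst hσ
    funext v; exact (h v (by simp)).symm
  · intro y _; exact Subsingleton.elim _ _
  · exact continuousOn_const
  · exact continuousOn_const
  · intros; exact Subsingleton.elim _ _

theorem mfd_bdS {S : Finset α} {N : ℕ} (hS : S.card = N + 1) : Mfd N (bdS S) ∅ where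
  dcL := by
    intro σ hσ τ hτ
    rw [mem_bdS] at *
    exact ⟨hτ.trans hσ.1, fun h => hσ.2 (Finset.Subset.antisymm hσ.1 (h ▸ hτ))⟩
  dcB := by intro σ hσ; simp at hσ
  sub := empty_subset _
  fin := ⟨S, fun σ hσ => (mem_bdS.1 hσ).1⟩
  sph := by
    intro τ hτ _
    have h1 := (mem_bdS.1 hτ).1
    have hne : (S \ τ).Nonempty := Finset.sdiff_nonempty.2 hτ.1
    have c1 := Finset.card_sdiff_add_card_eq_card h1
    have c3 := Finset.card_pos.2 hne
    refine ⟨(S \ τ).card - 1, by omega, ?_⟩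
    unfold bdS
    rw [lk_Repl (by simp), lk_void, Finset.sdiff_eq_empty_iff_subset.2 h1, lk_empty]
    refine Sph_pt.join ?_ hne (by simp) (by omega)
    intro σ hσ τ hτ
    simp only [mem_singleton_iff] at *
    rw [hσ] at hτ; exact Finset.subset_empty.1 hτ
  dsk := by intro σ hσ; simp at hσ

/-- relabelling -/
def imC (j : α → β) (L : Set (Finset α)) : Set (Finset β) := (fun σ : Finset α => σ.image j) '' L

theorem mem_imC {j : α → β} (hj : Function.Injective j) {L : Set (Finset α)} {τ : Finset α} :
    τ.image j ∈ imC j L ↔ τ ∈ L := by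
  constructor
  · rintro ⟨σ, hσ, h⟩
    rwa [← Finset.image_injective hj h]
  · exact fun h => ⟨τ, h, rfl⟩

theorem imC_sub {j : α → β} (hj : Function.Injective j) {κ : Finset α} {ρ : Finset β} (h : ρ ⊆ κ.image j) :
    ∃ τ ⊆ κ, τ.image j = ρ := by
  refine ⟨κ.filter (fun v => j v ∈ ρ), Finset.filter_subset _ _, ?_⟩
  ext v
  simp only [Finset.mem_image, Finset.mem_filter]
  constructor
  · rintro ⟨a, ⟨_, h1⟩, rfl⟩; exact h1
  · intro hv
    obtain ⟨a, ha, rfl⟩ := Finset.mem_image.1 (h hv)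
    exact ⟨a, ⟨ha, hv⟩, rfl⟩

theorem DC.imC {j : α → β} (hj : Function.Injective j) {L : Set (Finset α)} (h : DC L) : DC (imC j L) := by
  rintro _ ⟨σ, hσ, rfl⟩ ρ hρ
  obtain ⟨τ, hτ, rfl⟩ := imC_sub hj hρ
  exact ⟨τ, h _ hσ _ hτ, rfl⟩

theorem lk_imC {j : α → β} (hj : Function.Injective j) {L : Set (Finset α)} {σ : Finset α} :
    lk (imC j L) (σ.image j) = imC j (lk L σ) := by
  ext ρ
  constructor
  · rintro ⟨h1, κ, hκ, h2⟩
    have h2 : κ.image j = σ.image j ∪ ρ := h2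
    have h3 : ρ ⊆ κ.image j := by rw [h2]; exact Finset.subset_union_right
    obtain ⟨τ, hτ, rfl⟩ := imC_sub hj h3
    rw [Finset.disjoint_image hj] at h1
    rw [← Finset.image_union] at h2
    rw [Finset.image_injective hj h2] at hκ
    exact ⟨τ, ⟨h1, hκ⟩, rfl⟩
  · rintro ⟨τ, ⟨h1, h2⟩, rfl⟩
    exact ⟨(Finset.disjoint_image hj).2 h1, σ ∪ τ, h2, Finset.image_union ..⟩

theorem hh_imC {j : α → β} (hj : Function.Injective j) (L : Set (Finset α)) :
    HH (cn (imC j L)) (cn L) (fun y => y ∘ j) (fun x => Function.extend j x 0) where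
  map := by
    rintro y ⟨h1, _, ⟨σ, hσ, rfl⟩, h2⟩
    exact ⟨fun v => h1 _, σ, hσ, fun v hv => h2 _ (by simpa [hj.eq_iff] using hv)⟩
  map' := by
    rintro x ⟨h1, σ, hσ, h2⟩
    refine ⟨fun v => ?_, _, ⟨σ, hσ, rfl⟩, fun v hv => ?_⟩
    · by_cases h : ∃ a, j a = v
      · obtain ⟨a, rfl⟩ := h; rw [hj.extend_apply]; exact h1 a
      · rw [Function.extend_apply' _ _ _ h]; exact le_rfl
    · by_cases h : ∃ a, j a = v
      · obtain ⟨a, rfl⟩ := h; rw [hj.extend_apply]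
        exact h2 a fun h3 => hv (Finset.mem_image_of_mem j h3)
      · rw [Function.extend_apply' _ _ _ h]; rfl
  left := by
    rintro y ⟨h1, _, ⟨σ, hσ, rfl⟩, h2⟩
    funext v
    by_cases h : ∃ a, j a = v
    · obtain ⟨a, rfl⟩ := h; rw [hj.extend_apply]; rfl
    · rw [Function.extend_apply' _ _ _ h]
      refine (h2 v fun h3 => h ?_).symm
      obtain ⟨a, _, ha⟩ := Finset.mem_image.1 h3
      exact ⟨a, ha⟩
  right := by
    intro x _; funext v; exact hj.extend_apply _ _ _
  cont := (continuous_pi fun v => continuous_apply (j v)).continuousOn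
  cont' := by
    refine (continuous_pi fun v => ?_).continuousOn
    by_cases h : ∃ a, j a = v
    · obtain ⟨a, rfl⟩ := h; simp only [hj.extend_apply]; exact continuous_apply a
    · simp only [Function.extend_apply' _ _ _ h]; exact continuous_const
  hom := by intros; rfl

theorem Sph.imC {j : α → β} (hj : Function.Injective j) {L : Set (Finset α)} {n : ℕ} (h : Sph n L) :
    Sph n (imC j L) := by
  obtain ⟨φ, ψ, h⟩ := h
  exact ⟨_, _, (hh_imC hj L).trans h⟩

theorem Mfd.imC {j : α → β} (hj : Function.Injective j) {L : Set (Finset α)} {N : ℕ} (h : Mfd N L ∅) :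
    Mfd N (imC j L) ∅ where
  dcL := h.dcL.imC hj
  dcB := by intro σ hσ; simp at hσ
  sub := empty_subset _
  fin := by
    obtain ⟨S, hS⟩ := h.fin
    refine ⟨S.image j, ?_⟩
    rintro _ ⟨σ, hσ, rfl⟩
    exact Finset.image_subset_image (hS σ hσ)
  sph := by
    rintro _ ⟨σ, hσ, rfl⟩ _
    obtain ⟨n, hn, hs⟩ := h.sph σ hσ (by simp)
    refine ⟨n, ?_, ?_⟩
    · simp only [Finset.card_image_of_injective _ hj]; exact hn
    · simp only [lk_imC hj]; exact hs.imC hj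
  dsk := by intro σ hσ; simp at hσ

/-- total mass -/
def mass (S : Finset α) (x : α → ℝ) : ℝ := ∑ v ∈ S, x v

theorem mass_cont (S : Finset α) : Continuous (mass S) :=
  continuous_finsetSum _ fun v _ => continuous_apply v

theorem mass_smul (S : Finset α) (r : ℝ) (x : α → ℝ) : mass S (r • x) = r * mass S x := by
  simp [mass, Finset.mul_sum]

theorem mass_nonneg {K : Set (Finset α)} {S : Finset α} {x : α → ℝ} (hx : x ∈ cn K) : 0 ≤ mass S x :=
  Finset.sum_nonneg fun v _ => hx.1 v

theorem le_mass {K : Set (Finset α)} {S : Finset α} (hS : FinC K S) {x : α → ℝ} (hx : x ∈ cn K) (v : α) :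
    x v ≤ mass S x := by
  by_cases hv : v ∈ S
  · exact Finset.single_le_sum (f := x) (fun v _ => hx.1 v) hv
  · rw [hS.cn_zero hx hv]; exact mass_nonneg hx

theorem mass_zero_iff {K : Set (Finset α)} {S : Finset α} (hS : FinC K S) {x : α → ℝ} (hx : x ∈ cn K) :
    mass S x = 0 ↔ x = 0 := by
  constructor
  · intro h; funext v
    exact le_antisymm ((le_mass hS hx v).trans h.le) (hx.1 v)
  · rintro rfl; simp [mass]

theorem mass_pos {K : Set (Finset α)} {S : Finset α} (hS : FinC K S) {x : α → ℝ} (hx : x ∈ cn K) (h : x ≠ 0) :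
    0 < mass S x := lt_of_le_of_ne (mass_nonneg hx) fun h1 => h ((mass_zero_iff hS hx).1 h1.symm)

theorem Sph.normal {K : Set (Finset α)} {S : Finset α} (hS : FinC K S) {n : ℕ} (h : Sph n K) :
    ∃ (φ : (α → ℝ) → EE n) (ψ : EE n → (α → ℝ)), HH (cn K) univ φ ψ ∧ ∀ x ∈ cn K, ‖φ x‖ = mass S x := by
  have hne := h.nonempty
  obtain ⟨φ, ψ, h⟩ := h
  have h0 : φ 0 = 0 := h.zero (zero_mem_cn hne)
  have hψ0 : ψ 0 = 0 := by rw [← h0]; exact h.left _ (zero_mem_cn hne)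
  have hφne : ∀ x ∈ cn K, x ≠ 0 → φ x ≠ 0 := by
    intro x hx h1 h2; apply h1; rw [← h.left x hx, h2, hψ0]
  have hψne : ∀ e, e ≠ 0 → ψ e ≠ 0 := by
    intro e h1 h2; apply h1; rw [← h.right e trivial, h2, h0]
  have hψhom := h.hom' cn_hsmul
  have hnorm : ∀ x ∈ cn K, ‖(mass S x / ‖φ x‖) • φ x‖ = mass S x := by
    intro x hx
    by_cases h1 : x = 0
    · simp [h1, h0, mass]
    · rw [norm_smul, Real.norm_of_nonneg (div_nonneg (mass_nonneg hx) (norm_nonneg _)), div_mul_cancel₀]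
      exact norm_ne_zero_iff.2 (hφne x hx h1)
  have hmem : ∀ e, (‖e‖ / mass S (ψ e)) • ψ e ∈ cn K := fun e =>
    cn_smul (h.map' e trivial) (div_nonneg (norm_nonneg _) (mass_nonneg (h.map' e trivial)))
  have hmass : ∀ e, mass S ((‖e‖ / mass S (ψ e)) • ψ e) = ‖e‖ := by
    intro e
    rw [mass_smul]
    by_cases h1 : e = 0
    · simp [h1]
    · rw [div_mul_cancel₀]
      exact (mass_pos hS (h.map' e trivial) (hψne e h1)).ne'
  refine ⟨fun x => (mass S x / ‖φ x‖) • φ x, fun e => (‖e‖ / mass S (ψ e)) • ψ e,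
    ⟨fun _ _ => trivial, fun e _ => hmem e, ?_, ?_, ?_, ?_, ?_⟩, hnorm⟩
  · intro x hx
    by_cases h1 : x = 0
    · simp [h1, h0, hψ0]
    · have hp : 0 < mass S x / ‖φ x‖ := div_pos (mass_pos hS hx h1) (norm_pos_iff.2 (hφne x hx h1))
      have e1 : ψ ((mass S x / ‖φ x‖) • φ x) = (mass S x / ‖φ x‖) • x := by
        rw [hψhom _ hp _ trivial, h.left x hx]
      simp only [hnorm x hx, e1, mass_smul, smul_smul]
      have a1 := (mass_pos hS hx h1).ne'
      have a2 := norm_ne_zero_iff.2 (hφne x hx h1)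
      rw [show mass S x / (mass S x / ‖φ x‖ * mass S x) * (mass S x / ‖φ x‖) = 1 by field_simp, one_smul]
  · intro e _
    by_cases h1 : e = 0
    · simp [h1, hψ0, h0]
    · have hp : 0 < ‖e‖ / mass S (ψ e) := div_pos (norm_pos_iff.2 h1) (mass_pos hS (h.map' e trivial) (hψne e h1))
      have e1 : φ ((‖e‖ / mass S (ψ e)) • ψ e) = (‖e‖ / mass S (ψ e)) • e := by
        rw [h.hom _ hp _ (h.map' e trivial), h.right e trivial]
      simp only [hmass e, e1, smul_smul]
      rw [norm_smul, Real.norm_of_nonneg hp.le]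
      have a1 := (mass_pos hS (h.map' e trivial) (hψne e h1)).ne'
      have a2 := norm_ne_zero_iff.2 h1
      rw [show ‖e‖ / (‖e‖ / mass S (ψ e) * ‖e‖) * (‖e‖ / mass S (ψ e)) = 1 by field_simp, one_smul]
  · intro x hx
    by_cases h1 : x = 0
    · subst h1
      have : Filter.Tendsto (fun x => (mass S x / ‖φ x‖) • φ x) (𝓝[cn K] 0) (𝓝 0) := by
        rw [tendsto_zero_iff_norm_tendsto_zero]
        have h2 : Filter.Tendsto (mass S) (𝓝[cn K] 0) (𝓝 0) := by
          have := ((mass_cont S).tendsto 0).mono_left (nhdsWithin_le_nhds (s := cn K))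
          simpa [mass] using this
        refine h2.congr' ?_
        filter_upwards [self_mem_nhdsWithin] with x hx
        exact (hnorm x hx).symm
      simpa [ContinuousWithinAt, h0] using this
    · exact ((mass_cont S).continuousWithinAt.div (h.cont x hx).norm
        (norm_ne_zero_iff.2 (hφne x hx h1))).smul (h.cont x hx)
  · rw [continuousOn_univ, continuous_iff_continuousAt]
    have hψ : Continuous ψ := continuousOn_univ.1 h.cont'
    intro e
    by_cases h1 : e = 0
    · subst h1
      refine tendsto_pi_nhds.2 fun v => ?_
      simp only [hψ0, smul_zero]
      refine squeeze_zero (g := fun e => ‖e‖) (fun e => (hmem e).1 v) (fun e => ?_) ?_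
      · exact (le_mass hS (hmem e) v).trans (hmass e).le
      · simpa using (continuous_norm (E := EE n)).tendsto 0
    · exact (continuous_norm.continuousAt.div ((mass_cont S).comp hψ).continuousAt
        (mass_pos hS (h.map' e trivial) (hψne e h1)).ne').smul hψ.continuousAt
  · intro r hr x hx
    simp only [mass_smul, h.hom r hr x hx, norm_smul, Real.norm_of_nonneg hr.le, smul_smul]
    rw [mul_div_mul_left _ _ hr.ne', mul_comm]
end

section
variable {α : Type}

noncomputable def PP (S : Finset α) (p : α → α → ℝ) (x : α → ℝ) : α → ℝ := ∑ v ∈ S, x v • p v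

theorem PP_apply (S : Finset α) (p : α → α → ℝ) (x : α → ℝ) (u : α) : PP S p x u = ∑ v ∈ S, x v * p v u := by
  simp [PP, Finset.sum_apply]

noncomputable def bisX (c : α) (σ : Finset α) (x : α → ℝ) : α → ℝ := cut {c} x + (x c / 2) • ind σ

theorem ind_mem_cn {L : Set (Finset α)} {v : α} (h : {v} ∈ L) : ind {v} ∈ cn L := by
  refine ⟨fun w => ?_, {v}, h, fun w hw => ?_⟩
  · unfold ind; split_ifs <;> norm_num
  · unfold ind; rw [if_neg hw]

theorem PP_ind {S : Finset α} (p : α → α → ℝ) {v : α} (hv : v ∈ S) : PP S p (ind {v}) = p v := by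
  unfold PP ind
  rw [Finset.sum_eq_single v]
  · simp
  · intro w _ hw; simp [hw]
  · exact fun h => absurd hv h

theorem mem_bis {L : Set (Finset α)} {c : α} {σ τ : Finset α} (hdc : DC L) (h : τ ∈ Repl L σ (coneC c (lk L σ))) (hc : c ∉ σ) :
    (τ ∈ L ∧ ¬ σ ⊆ τ) ∨ (c ∈ τ ∧ τ.erase c ∪ σ ∈ L) := by
  obtain ⟨h1, h2 | h2⟩ := h
  · exact Or.inl ⟨h2, h1⟩
  · by_cases h3 : c ∈ τ
    · right
      refine ⟨h3, hdc _ h2.2 _ fun v hv => ?_⟩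
      simp only [Finset.mem_union, Finset.mem_erase, Finset.mem_sdiff] at hv ⊢
      tauto
    · left
      have h4 := coneC_of_notMem h2 (by simp [h3])
      refine ⟨hdc _ h4.2 _ fun v hv => ?_, h1⟩
      simp only [Finset.mem_union, Finset.mem_sdiff]
      tauto

theorem bis_main {N : ℕ} {L B : Set (Finset α)} {S : Finset α} (hm : Mfd N L B) (hS : FinC L S) {σ : Finset α}
    (hσ : σ ∈ L) (hB : σ ∉ B) (hne : σ.Nonempty) {c : α} (hc : c ∉ S) :
    (∃ M, RH N M L B σ (coneC c (lk L σ))) ∧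
    ∃ ω, HH (cn (Repl L σ (coneC c (lk L σ)))) (cn L) (bisX c σ) ω := by
  obtain ⟨n, hn, hs⟩ := hm.sph σ hσ hB
  have hcL : ∀ τ ∈ L, c ∉ τ := fun τ hτ h => hc (hS τ hτ h)
  have hclk : ∀ τ ∈ lk L σ, c ∉ τ := fun τ hτ => hcL _ (hm.dcL.lk_sub hτ)
  have hlB : lk B σ = ∅ := by
    ext τ; simp only [mem_empty_iff_false, iff_false]
    exact fun h => hB (hm.dcB _ h.2 _ Finset.subset_union_left)
  have hml : Mfd n (lk L σ) ∅ := by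
    have := hm.lk hn; rwa [hlB] at this
  have hcσ := hcL σ hσ
  have hdis : ∀ β ∈ coneC c (lk L σ), Disjoint σ β := by
    intro β hβ
    rw [Finset.disjoint_left]
    intro v hv hv'
    exact Finset.disjoint_left.1 hβ.1 hv (Finset.mem_erase.2 ⟨fun h => hcσ (h ▸ hv), hv'⟩)
  have hcapL : ∀ β ∈ coneC c (lk L σ), β ∈ L → β ∈ lk L σ := fun β h1 h2 => coneC_of_notMem h1 (hcL β h2)
  refine ⟨⟨n + 1, hm, hml.cone hclk, hne, hσ, hB, by omega, hdis, hcapL⟩, ?_⟩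
  obtain ⟨φ, ψ, h1, h2, h3⟩ := Dsk_cone' hs hclk
  have hR : RepHyp L σ (coneC c (lk L σ)) φ ψ := by
    refine ⟨hm.dcL, (hm.dcL.lk σ).cone c, hm.finite, (hml.cone hclk).finite, hne, hdis, coneC_sub hclk, hcapL, h1, h2⟩
  refine ⟨_, hR.hhχ.congr (fun x hx => ?_) cn_hsmul⟩
  rcases hR.caseR hx with h4 | h4
  · unfold chiT
    rw [if_pos h4, sub_self, zero_mul, (h3 _ h4).2, one_mul, (h3 _ h4).1]
    have e1 : cut σ x c = x c := by simp [cut, hcσ]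
    rw [e1]
    unfold bisX
    congr 1
    funext v
    simp only [cut, res, Pi.add_apply, Finset.mem_singleton]
    by_cases hv : v = c
    · subst hv; simp [hcσ]
    · simp [hv]; split_ifs <;> simp
  · rw [hR.chi_id' 1 (oldR_sub h4)]
    have : x c = 0 := hS.cn_zero (oldR_sub h4) hc
    unfold bisX
    rw [this]
    simp only [zero_div, zero_smul, add_zero]
    funext v
    unfold cut; split_ifs with h5
    · rw [Finset.mem_singleton.1 h5, this]
    · rfl

structure St (R : Set α) (N : ℕ) (B L0 : Set (Finset α)) (S0 : Finset α) (L : Set (Finset α)) (S : Finset α)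
    (p : α → α → ℝ) : Prop where
  mfd : Mfd N L B
  full : Full L B
  fin : FinC L S
  avoid : ∀ τ ∈ L, ∀ v ∈ τ, v ∈ R → {v} ∈ B
  hh : ∃ ω, HH (cn L) (cn L0) (PP S p) ω
  mass1 : ∀ v, {v} ∈ L → mass S0 (p v) = 1
  bdy : ∀ v, {v} ∈ B → p v = ind {v}

variable {R : Set α} {N : ℕ} {B L0 : Set (Finset α)} {S0 : Finset α} {L : Set (Finset α)} {S : Finset α}
    {p : α → α → ℝ}

theorem mem_S (h : FinC L S) {τ : Finset α} (hτ : τ ∈ L) {v : α} (hv : v ∈ τ) : v ∈ S := h τ hτ hv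

theorem St.start (hm : Mfd N L0 B) (hf : Full L0 B) (hS : FinC L0 S0)
    (ha : ∀ τ ∈ L0, ∀ v ∈ τ, v ∈ R → {v} ∈ B) : St R N B L0 S0 L0 S0 (fun v => ind {v}) where
  mfd := hm
  full := hf
  fin := hS
  avoid := ha
  hh := by
    refine ⟨id, HH.congr (φ := id) ⟨fun _ h => h, fun _ h => h, fun _ _ => rfl, fun _ _ => rfl, continuousOn_id,
      continuousOn_id, fun _ _ _ _ => rfl⟩ (fun x hx => ?_) cn_hsmul⟩
    funext u
    rw [PP_apply]
    by_cases hu : u ∈ S0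
    · rw [Finset.sum_eq_single u]
      · simp [ind]
      · intro w _ hw; simp [ind, hw.symm]
      · exact fun h => absurd hu h
    · rw [Finset.sum_eq_zero]
      · exact (hS.cn_zero hx hu).symm
      · intro w hw
        have : u ≠ w := fun h => hu (h ▸ hw)
        simp [ind, this]
  mass1 v hv := by
    have : v ∈ S0 := mem_S hS hv (by simp)
    simp [mass, ind, this]
  bdy v _ := rfl

theorem St.bisect (h : St R N B L0 S0 L S p) (hR : Rᶜ.Infinite) {a b : α} (hab : a ≠ b)
    (hL : {a, b} ∈ L) (hB : {a, b} ∉ B) :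
    ∃ (c : α) (L' : Set (Finset α)) (S' : Finset α) (p' : α → α → ℝ), St R N B L0 S0 L' S' p' ∧
      c ∉ S ∧ c ∉ R ∧ p' c = (1 / 2 : ℝ) • (p a + p b) ∧ (∀ v, v ≠ c → p' v = p v) ∧
      (∀ τ ∈ L', (τ ∈ L ∧ ¬ {a, b} ⊆ τ) ∨ (c ∈ τ ∧ τ.erase c ∪ {a, b} ∈ L)) := by
  obtain ⟨c, hc⟩ := (hR.diff S.finite_toSet).nonempty
  have hcR : c ∉ R := hc.1
  have hcS : c ∉ S := by simpa using hc.2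
  have hcL : ∀ τ ∈ L, c ∉ τ := fun τ hτ h1 => hcS (h.fin τ hτ h1)
  have hne : ({a, b} : Finset α).Nonempty := ⟨a, by simp⟩
  obtain ⟨⟨M, hM⟩, ω, hω⟩ := bis_main h.mfd h.fin hL hB hne hcS
  have hmem : ∀ τ ∈ Repl L {a, b} (coneC c (lk L {a, b})), (τ ∈ L ∧ ¬ {a, b} ⊆ τ) ∨ (c ∈ τ ∧ τ.erase c ∪ {a, b} ∈ L) :=
    fun τ hτ => mem_bis h.mfd.dcL hτ (hcL _ hL)
  have haS : a ∈ S := mem_S h.fin hL (by simp)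
  have hbS : b ∈ S := mem_S h.fin hL (by simp)
  have hpc : ∀ v, v ≠ c → Function.update p c ((1 / 2 : ℝ) • (p a + p b)) v = p v :=
    fun v hv => Function.update_of_ne hv _ _
  refine ⟨c, Repl L {a, b} (coneC c (lk L {a, b})), insert c S, Function.update p c ((1 / 2 : ℝ) • (p a + p b)),
    ⟨hM.mfd, hM.full h.full (Full.cone fun τ hτ => hcL _ (h.mfd.dcL.lk_sub hτ)), ?_, ?_, ?_, ?_, ?_⟩,
    hcS, hcR, Function.update_self .., hpc, hmem⟩
  · intro τ hτ v hv
    rcases hmem τ hτ with h1 | h1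
    · exact Finset.mem_insert_of_mem (h.fin _ h1.1 hv)
    · by_cases h2 : v = c
      · simp [h2]
      · exact Finset.mem_insert_of_mem (h.fin _ h1.2 (by simp [h2, hv]))
  · intro τ hτ v hv hvR
    rcases hmem τ hτ with h1 | h1
    · exact h.avoid τ h1.1 v hv hvR
    · have h2 : v ≠ c := fun h2 => hcR (h2 ▸ hvR)
      exact h.avoid _ h1.2 v (by simp [h2, hv]) hvR
  · obtain ⟨ω0, h0⟩ := h.hh
    refine ⟨_, (hω.trans h0).congr (fun x _ => ?_) cn_hsmul⟩
    unfold PP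
    rw [Finset.sum_insert hcS, Function.update_self]
    have e1 : ∀ v ∈ S, bisX c {a, b} x v = x v + (x c / 2) * ind {a, b} v := by
      intro v hv
      have : v ≠ c := fun h => hcS (h ▸ hv)
      simp [bisX, cut, this]
    have e3 : ∑ v ∈ S, bisX c {a, b} x v • p v = ∑ v ∈ S, x v • p v + ∑ v ∈ S, (x c / 2 * ind {a, b} v) • p v := by
      rw [← Finset.sum_add_distrib]
      exact Finset.sum_congr rfl (fun v hv => by rw [e1 v hv, add_smul])
    rw [e3, add_comm]
    congr 1
    · refine Finset.sum_congr rfl fun v hv => ?_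
      rw [hpc v fun h => hcS (h ▸ hv)]
    · have e2 : ∀ v ∈ S, (x c / 2 * ind {a, b} v) • p v = (if v = a then (x c / 2) • p a else 0) +
          (if v = b then (x c / 2) • p b else 0) := by
        intro v _
        by_cases h1 : v = a
        · subst h1; simp [ind, hab]
        · by_cases h2 : v = b
          · subst h2; simp [ind, h1]
          · simp [ind, h1, h2]
      rw [Finset.sum_congr rfl e2, Finset.sum_add_distrib]
      simp only [Finset.sum_ite_eq', haS, hbS, if_true]
      rw [smul_smul, smul_add]; congr 2 <;> ring
  · intro v hv
    by_cases h2 : v = c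
    · subst h2
      rw [Function.update_self, mass_smul]
      have ha := h.mass1 a (h.mfd.dcL _ hL _ (by simp))
      have hb := h.mass1 b (h.mfd.dcL _ hL _ (by simp))
      have : mass S0 (p a + p b) = mass S0 (p a) + mass S0 (p b) := by simp [mass, Finset.sum_add_distrib]
      rw [this, ha, hb]; norm_num
    · rw [hpc v h2]
      refine h.mass1 v ?_
      rcases hmem _ hv with h1 | h1
      · exact h1.1
      · exact absurd (Finset.mem_singleton.1 h1.1).symm h2
  · intro v hv
    have h2 : v ≠ c := fun h2 => hcL _ (h.mfd.sub hv) (by simp [h2])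
    rw [hpc v h2]; exact h.bdy v hv

theorem St.pmem (h : St R N B L0 S0 L S p) {v : α} (hv : {v} ∈ L) : p v ∈ cn L0 := by
  obtain ⟨ω, hω⟩ := h.hh
  have := hω.map _ (ind_mem_cn hv)
  rwa [PP_ind p (mem_S h.fin hv (by simp))] at this

theorem St.massPP (h : St R N B L0 S0 L S p) {x : α → ℝ} (hx : x ∈ cn L) : mass S0 (PP S p x) = mass S x := by
  unfold mass
  simp only [PP_apply]
  rw [Finset.sum_comm]
  refine Finset.sum_congr rfl fun v _ => ?_
  rw [← Finset.mul_sum]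
  by_cases h0 : x v = 0
  · simp [h0]
  · obtain ⟨τ, hτ, h2⟩ := cn_supp h.mfd.dcL hx
    have : {v} ∈ L := h.mfd.dcL _ hτ _ (by simpa using (h2 v).1 h0)
    have := h.mass1 v this
    unfold mass at this
    rw [this, mul_one]
end

section
variable {α : Type}

def D2 (S : Finset α) (x y : α → ℝ) : ℝ := ∑ u ∈ S, (x u - y u) ^ 2

theorem D2_self (S : Finset α) (x : α → ℝ) : D2 S x x = 0 := by simp [D2]

theorem D2_nonneg (S : Finset α) (x y : α → ℝ) : 0 ≤ D2 S x y := Finset.sum_nonneg fun _ _ => sq_nonneg _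

theorem D2_comm (S : Finset α) (x y : α → ℝ) : D2 S x y = D2 S y x :=
  Finset.sum_congr rfl fun _ _ => by ring

theorem D2_med (S : Finset α) (a b y : α → ℝ) :
    D2 S ((1 / 2 : ℝ) • (a + b)) y = (2 * D2 S a y + 2 * D2 S b y - D2 S a b) / 4 := by
  unfold D2
  rw [Finset.mul_sum, Finset.mul_sum, ← Finset.sum_add_distrib, ← Finset.sum_sub_distrib, Finset.sum_div]
  refine Finset.sum_congr rfl fun u _ => ?_
  simp only [Pi.smul_apply, Pi.add_apply, smul_eq_mul]; ring

theorem D2_coord {S : Finset α} {x y : α → ℝ} {u : α} (hu : u ∈ S) : (x u - y u) ^ 2 ≤ D2 S x y :=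
  Finset.single_le_sum (f := fun u => (x u - y u) ^ 2) (fun _ _ => sq_nonneg _) hu

def Jinv (B L : Set (Finset α)) (p : α → α → ℝ) (c0 : α) : Prop :=
  ∀ v w, {v} ∈ B → {w} ∉ B → {v, w} ∈ L → p w c0 ≤ 1 / 2

def Fine (B L : Set (Finset α)) (S0 : Finset α) (p : α → α → ℝ) (ε : ℝ) : Prop :=
  ∀ u v, {u} ∉ B → {v} ∉ B → {u, v} ∈ L → D2 S0 (p u) (p v) ≤ ε

variable {R : Set α} {N : ℕ} {B L0 : Set (Finset α)} {S0 : Finset α}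

open Classical in
theorem mesh_step (hR : Rᶜ.Infinite) (c0 : α) {D : ℝ} (hD : 0 ≤ D) (k : ℕ) :
    ∀ (L : Set (Finset α)) (S : Finset α) (p : α → α → ℝ), St R N B L0 S0 L S p → Jinv B L p c0 →
    Fine B L S0 p D →
    ((S ×ˢ S).filter (fun q => {q.1} ∉ B ∧ {q.2} ∉ B ∧ {q.1, q.2} ∈ L ∧ 3 / 4 * D < D2 S0 (p q.1) (p q.2))).card ≤ k →
    ∃ L' S' p', St R N B L0 S0 L' S' p' ∧ Jinv B L' p' c0 ∧ Fine B L' S0 p' (3 / 4 * D) := by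
  induction k with
  | zero =>
    intro L S p h hJ hF hk
    refine ⟨L, S, p, h, hJ, fun u v hu hv huv => ?_⟩
    by_contra hlt
    have : (u, v) ∈ (S ×ˢ S).filter (fun q => {q.1} ∉ B ∧ {q.2} ∉ B ∧ {q.1, q.2} ∈ L ∧ 3 / 4 * D < D2 S0 (p q.1) (p q.2)) := by
      simp only [Finset.mem_filter, Finset.mem_product]
      exact ⟨⟨mem_S h.fin huv (by simp), mem_S h.fin huv (by simp)⟩, hu, hv, huv, not_le.1 hlt⟩
    rw [Finset.card_eq_zero.1 (Nat.le_zero.1 hk)] at this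
    simp at this
  | succ k ih =>
    intro L S p h hJ hF hk
    rcases ((S ×ˢ S).filter (fun q => {q.1} ∉ B ∧ {q.2} ∉ B ∧ {q.1, q.2} ∈ L ∧ 3 / 4 * D < D2 S0 (p q.1) (p q.2))).eq_empty_or_nonempty with he | hne
    · refine ⟨L, S, p, h, hJ, fun u v hu hv huv => ?_⟩
      by_contra hlt
      have : (u, v) ∈ (S ×ˢ S).filter (fun q => {q.1} ∉ B ∧ {q.2} ∉ B ∧ {q.1, q.2} ∈ L ∧ 3 / 4 * D < D2 S0 (p q.1) (p q.2)) := by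
        simp only [Finset.mem_filter, Finset.mem_product]
        exact ⟨⟨mem_S h.fin huv (by simp), mem_S h.fin huv (by simp)⟩, hu, hv, huv, not_le.1 hlt⟩
      rw [he] at this
      simp at this
    · obtain ⟨⟨a, b⟩, hab, hmax⟩ := Finset.exists_max_image _ (fun q : α × α => D2 S0 (p q.1) (p q.2)) hne
      simp only [Finset.mem_filter, Finset.mem_product] at hab hmax
      obtain ⟨⟨haS, hbS⟩, haB, hbB, habL, hlong⟩ := hab
      have hmax' : ∀ u v, {u} ∉ B → {v} ∉ B → {u, v} ∈ L → D2 S0 (p u) (p v) ≤ D2 S0 (p a) (p b) := by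
        intro u v hu hv huv
        by_cases hl : 3 / 4 * D < D2 S0 (p u) (p v)
        · exact hmax (u, v) ⟨⟨mem_S h.fin huv (by simp), mem_S h.fin huv (by simp)⟩, hu, hv, huv, hl⟩
        · linarith [not_lt.1 hl]
      have hne' : a ≠ b := by
        rintro rfl
        rw [D2_self] at hlong
        linarith
      have habB : {a, b} ∉ B := fun h1 => haB (h.mfd.dcB _ h1 _ (by simp))
      have habD := hF a b haB hbB habL
      obtain ⟨c, L', S', p', h', hcS, hcR, hpc, hp, hmem⟩ := h.bisect hR hne' habL habB
      have hcL : ∀ τ ∈ L, c ∉ τ := fun τ hτ h1 => hcS (h.fin τ hτ h1)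
      have hold : ∀ u v, u ≠ c → v ≠ c → {u, v} ∈ L' → {u, v} ∈ L ∧ ¬ ({a, b} : Finset α) ⊆ {u, v} := by
        intro u v hu hv huv
        rcases hmem _ huv with h1 | h1
        · exact h1
        · have := h1.1
          simp only [Finset.mem_insert, Finset.mem_singleton] at this
          rcases this with h2 | h2
          · exact absurd h2.symm hu
          · exact absurd h2.symm hv
      have hnew : ∀ v, v ≠ c → {c, v} ∈ L' → {v, a, b} ∈ L := by
        intro v hv h1
        rcases hmem _ h1 with h2 | h2
        · exact absurd (by simp) (hcL _ h2.1)
        · refine h.mfd.dcL _ h2.2 _ fun w hw => ?_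
          simp only [Finset.mem_insert, Finset.mem_singleton, Finset.mem_union, Finset.mem_erase] at hw ⊢
          rcases hw with rfl | rfl | rfl
          · exact Or.inl ⟨hv, Or.inr rfl⟩
          · exact Or.inr (Or.inl rfl)
          · exact Or.inr (Or.inr rfl)
      have hshort : ∀ v, v ≠ c → {v} ∉ B → {c, v} ∈ L' → D2 S0 (p' c) (p' v) ≤ 3 / 4 * D := by
        intro v hv hvB h1
        have h2 := hnew v hv h1
        rw [hpc, hp v hv, D2_med]
        have e1 := hmax' a v haB hvB (h.mfd.dcL _ h2 _ (by intro w; simp; tauto))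
        have e2 := hmax' b v hbB hvB (h.mfd.dcL _ h2 _ (by intro w; simp; tauto))
        linarith
      refine ih L' S' p' h' ?_ ?_ ?_
      · intro v w hv hw hvw
        have hvc : v ≠ c := by
          rintro rfl
          exact hcL _ (h.mfd.sub hv) (by simp)
        by_cases hwc : w = c
        · subst hwc
          have h2 := hnew v hvc (by rwa [Finset.pair_comm])
          have e1 := hJ v a hv haB (h.mfd.dcL _ h2 _ (by intro w; simp; tauto))
          have e2 := hJ v b hv hbB (h.mfd.dcL _ h2 _ (by intro w; simp; tauto))
          rw [hpc]
          simp only [Pi.smul_apply, Pi.add_apply, smul_eq_mul]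
          linarith
        · rw [hp w hwc]
          exact hJ v w hv hw (hold v w hvc hwc hvw).1
      · intro u v hu hv huv
        by_cases huc : u = c
        · subst huc
          by_cases hvc : v = u
          · subst hvc; rw [D2_self]; exact hD
          · have := hshort v hvc hv huv
            linarith
        · by_cases hvc : v = c
          · subst hvc
            rw [D2_comm]
            have := hshort u huc hu (by rwa [Finset.pair_comm])
            linarith
          · rw [hp u huc, hp v hvc]
            exact hF u v hu hv (hold u v huc hvc huv).1
      · refine Nat.lt_succ_iff.1 (lt_of_lt_of_le (Finset.card_lt_card ?_) hk)
        refine Finset.ssubset_iff_subset_ne.2 ⟨?_, fun heq => ?_⟩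
        · rintro ⟨u, v⟩ huv
          simp only [Finset.mem_filter, Finset.mem_product] at huv ⊢
          obtain ⟨_, hu, hv, huv, hlt⟩ := huv
          have huc : u ≠ c := by
            rintro rfl
            by_cases hvc : v = u
            · subst hvc; rw [D2_self] at hlt; linarith
            · linarith [hshort v hvc hv huv]
          have hvc : v ≠ c := by
            rintro rfl
            rw [D2_comm] at hlt
            linarith [hshort u huc hu (by rwa [Finset.pair_comm])]
          rw [hp u huc, hp v hvc] at hlt
          have := (hold u v huc hvc huv).1
          exact ⟨⟨mem_S h.fin this (by simp), mem_S h.fin this (by simp)⟩, hu, hv, this, hlt⟩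
        · have : (a, b) ∈ (S ×ˢ S).filter (fun q => {q.1} ∉ B ∧ {q.2} ∉ B ∧ {q.1, q.2} ∈ L ∧ 3 / 4 * D < D2 S0 (p q.1) (p q.2)) := by
            simp only [Finset.mem_filter, Finset.mem_product]
            exact ⟨⟨haS, hbS⟩, haB, hbB, habL, hlong⟩
          rw [← heq] at this
          simp only [Finset.mem_filter, Finset.mem_product] at this
          have hac : a ≠ c := fun h => hcS (h ▸ haS)
          have hbc : b ≠ c := fun h => hcS (h ▸ hbS)
          exact (hold a b hac hbc this.2.2.2.1).2 le_rfl

theorem mesh (hR : Rᶜ.Infinite) (c0 : α) {L : Set (Finset α)} {S : Finset α} {p : α → α → ℝ}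
    (h : St R N B L0 S0 L S p) (hJ : Jinv B L p c0) {ε : ℝ} (hε : 0 < ε) :
    ∃ L' S' p', St R N B L0 S0 L' S' p' ∧ Jinv B L' p' c0 ∧ Fine B L' S0 p' ε := by
  let D : ℝ := ∑ q ∈ S ×ˢ S, D2 S0 (p q.1) (p q.2)
  have hD : 0 ≤ D := Finset.sum_nonneg fun _ _ => D2_nonneg _ _ _
  have hF : Fine B L S0 p D := by
    intro u v _ _ huv
    exact Finset.single_le_sum (f := fun q : α × α => D2 S0 (p q.1) (p q.2)) (fun _ _ => D2_nonneg _ _ _)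
      (Finset.mem_product.2 (⟨mem_S h.fin huv (by simp), mem_S h.fin huv (by simp)⟩ : (u, v).1 ∈ S ∧ (u, v).2 ∈ S))
  have key : ∀ k : ℕ, ∃ L' S' p', St R N B L0 S0 L' S' p' ∧ Jinv B L' p' c0 ∧ Fine B L' S0 p' ((3 / 4) ^ k * D) := by
    intro k
    induction k with
    | zero => exact ⟨L, S, p, h, hJ, by simpa using hF⟩
    | succ k ih =>
      obtain ⟨L', S', p', h', hJ', hF'⟩ := ih
      obtain ⟨L'', S'', p'', h2, hJ2, hF2⟩ := mesh_step hR c0 (by positivity) _ L' S' p' h' hJ' hF' le_rfl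
      exact ⟨L'', S'', p'', h2, hJ2, by rw [pow_succ, mul_comm ((3 / 4 : ℝ) ^ k), mul_assoc]; exact hF2⟩
  have ht : Filter.Tendsto (fun k : ℕ => (3 / 4 : ℝ) ^ k * D) Filter.atTop (𝓝 (0 * D)) :=
    (tendsto_pow_atTop_nhds_zero_of_lt_one (by norm_num) (by norm_num)).mul_const D
  rw [zero_mul] at ht
  obtain ⟨k, hk⟩ := (ht.eventually (gt_mem_nhds hε)).exists
  obtain ⟨L', S', p', h', hJ', hF'⟩ := key k
  exact ⟨L', S', p', h', hJ', fun u v hu hv huv => (hF' u v hu hv huv).trans hk.le⟩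

open Classical in
theorem stage1 (hR : Rᶜ.Infinite) {c0 : α} (hc0 : {c0} ∉ B) (k : ℕ) :
    ∀ (L : Set (Finset α)) (S : Finset α) (p : α → α → ℝ), St R N B L0 S0 L S p → p c0 = ind {c0} →
    (∀ v w, {v} ∈ B → {w} ∉ B → w ≠ c0 → {v, w} ∈ L → p w c0 ≤ 1 / 2) →
    (S.filter (fun v => {v} ∈ B ∧ {v, c0} ∈ L)).card ≤ k →
    ∃ L' S' p', St R N B L0 S0 L' S' p' ∧ Jinv B L' p' c0 := by
  induction k with
  | zero =>
    intro L S p h hp hJ hk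
    refine ⟨L, S, p, h, fun v w hv hw hvw => ?_⟩
    by_cases hwc : w = c0
    · subst hwc
      have : v ∈ S.filter (fun v => {v} ∈ B ∧ {v, w} ∈ L) := by
        simp only [Finset.mem_filter]
        exact ⟨mem_S h.fin hvw (by simp), hv, hvw⟩
      rw [Finset.card_eq_zero.1 (Nat.le_zero.1 hk)] at this
      simp at this
    · exact hJ v w hv hw hwc hvw
  | succ k ih =>
    intro L S p h hp0 hJ hk
    rcases (S.filter (fun v => {v} ∈ B ∧ {v, c0} ∈ L)).eq_empty_or_nonempty with he | ⟨a, ha⟩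
    · refine ⟨L, S, p, h, fun v w hv hw hvw => ?_⟩
      by_cases hwc : w = c0
      · subst hwc
        have : v ∈ S.filter (fun v => {v} ∈ B ∧ {v, w} ∈ L) := by
          simp only [Finset.mem_filter]
          exact ⟨mem_S h.fin hvw (by simp), hv, hvw⟩
        rw [he] at this
        simp at this
      · exact hJ v w hv hw hwc hvw
    · have ha' := ha
      simp only [Finset.mem_filter] at ha
      obtain ⟨haS, haB, haL⟩ := ha
      have hac : a ≠ c0 := fun h => hc0 (h ▸ haB)
      have hB : {a, c0} ∉ B := fun h1 => hc0 (h.mfd.dcB _ h1 _ (by simp))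
      obtain ⟨c, L', S', p', h', hcS, hcR, hpc, hp, hmem⟩ := h.bisect hR hac haL hB
      have hcL : ∀ τ ∈ L, c ∉ τ := fun τ hτ h1 => hcS (h.fin τ hτ h1)
      have hc0c : c0 ≠ c := fun h1 => hcL _ haL (by simp [h1])
      have hold : ∀ u v, u ≠ c → v ≠ c → {u, v} ∈ L' → {u, v} ∈ L ∧ ¬ ({a, c0} : Finset α) ⊆ {u, v} := by
        intro u v hu hv huv
        rcases hmem _ huv with h1 | h1
        · exact h1
        · have := h1.1
          simp only [Finset.mem_insert, Finset.mem_singleton] at this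
          rcases this with h2 | h2
          · exact absurd h2.symm hu
          · exact absurd h2.symm hv
      have hBc : ∀ v, {v} ∈ B → v ≠ c := by
        rintro v hv rfl
        exact hcL _ (h.mfd.sub hv) (by simp)
      refine ih L' S' p' h' (by rw [hp _ hc0c, hp0]) ?_ ?_
      · intro v w hv hw hwc0 hvw
        by_cases hwc : w = c
        · subst hwc
          rw [hpc, h.bdy a haB, hp0]
          simp [ind, hac.symm]
        · rw [hp w hwc]
          exact hJ v w hv hw hwc0 (hold v w (hBc v hv) hwc hvw).1
      · refine Nat.lt_succ_iff.1 (lt_of_lt_of_le (Finset.card_lt_card ?_) hk)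
        refine Finset.ssubset_iff_subset_ne.2 ⟨?_, fun heq => ?_⟩
        · intro v hv
          simp only [Finset.mem_filter] at hv ⊢
          have := (hold v c0 (hBc v hv.2.1) hc0c hv.2.2).1
          exact ⟨mem_S h.fin this (by simp), hv.2.1, this⟩
        · rw [← heq] at ha'
          simp only [Finset.mem_filter] at ha'
          exact (hold a c0 (hBc a haB) hc0c ha'.2.2).2 le_rfl
end

section
variable {α U : Type}

/-- simplicial map from an augmented complex -/
def Smp (K : Set (Finset α)) (X : Set (Finset U)) (f : α → U) : Prop :=
  ∀ σ ∈ K, σ.Nonempty → σ.image f ∈ X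

/-- push forward of coordinates -/
noncomputable def mkP (S : Finset α) (f : α → U) (y : α → ℝ) : U →₀ ℝ := ∑ v ∈ S, Finsupp.single (f v) (y v)

theorem mkP_apply (S : Finset α) (f : α → U) (y : α → ℝ) (u : U) :
    mkP S f y u = ∑ v ∈ S, if f v = u then y v else 0 := by
  unfold mkP
  rw [Finsupp.finset_sum_apply]
  refine Finset.sum_congr rfl fun v _ => ?_
  rw [Finsupp.single_apply]

theorem mkP_cont (S : Finset α) (f : α → U) (u : U) : Continuous fun y => mkP S f y u := by
  simp only [mkP_apply]
  refine continuous_finsetSum _ fun v _ => ?_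
  split_ifs
  · exact continuous_apply v
  · exact continuous_const

theorem mkP_smul (S : Finset α) (f : α → U) (r : ℝ) (y : α → ℝ) : mkP S f (r • y) = r • mkP S f y := by
  ext u
  simp only [mkP_apply, Finsupp.smul_apply, Pi.smul_apply, smul_eq_mul, Finset.mul_sum]
  refine Finset.sum_congr rfl fun v _ => ?_
  split_ifs <;> simp

theorem mkP_total (S : Finset α) (f : α → U) (y : α → ℝ) : ((mkP S f y).sum fun _ c => c) = mass S y := by
  unfold mkP mass
  rw [← Finsupp.sum_finset_sum_index (by simp) (by simp)]
  exact Finset.sum_congr rfl fun v _ => Finsupp.sum_single_index rfl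

theorem mkP_nonneg {S : Finset α} {f : α → U} {y : α → ℝ} (hy : ∀ v, 0 ≤ y v) (u : U) : 0 ≤ mkP S f y u := by
  rw [mkP_apply]
  refine Finset.sum_nonneg fun v _ => ?_
  split_ifs
  · exact hy v
  · exact le_rfl

theorem le_mkP {S : Finset α} {f : α → U} {y : α → ℝ} (hy : ∀ v, 0 ≤ y v) {v : α} (hv : v ∈ S) : y v ≤ mkP S f y (f v) := by
  rw [mkP_apply]
  have := Finset.single_le_sum (f := fun w => if f w = f v then y w else 0) (s := S) (fun w _ => by
    split_ifs
    · exact hy w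
    · exact le_rfl) hv
  simpa using this

theorem mkP_supp {S : Finset α} {f : α → U} {y : α → ℝ} (hy : ∀ v, 0 ≤ y v) {σ : Finset α} (hσ : ∀ v, y v ≠ 0 ↔ v ∈ σ)
    (hS : σ ⊆ S) : (mkP S f y).support = σ.image f := by
  ext u
  rw [Finsupp.mem_support_iff, Finset.mem_image]
  constructor
  · intro h
    rw [mkP_apply] at h
    obtain ⟨v, hv, h2⟩ := Finset.exists_ne_zero_of_sum_ne_zero h
    split_ifs at h2 with h3
    · exact ⟨v, (hσ v).1 h2, h3⟩
    · exact absurd rfl h2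
  · rintro ⟨v, hv, rfl⟩
    have h1 := le_mkP (f := f) hy (hS hv)
    have h2 : 0 < y v := lt_of_le_of_ne (hy v) ((hσ v).2 hv).symm
    exact (h2.trans_le h1).ne'

theorem mkP_mem {K : Set (Finset α)} {X : Set (Finset U)} {S : Finset α} {f : α → U} {y : α → ℝ} (hdc : DC K)
    (hS : FinC K S) (hf : Smp K X f) (hy : y ∈ cn K) (hm : mass S y = 1) :
    (mkP S f y).support ∈ X ∧ (∀ v, 0 ≤ mkP S f y v) ∧ ((mkP S f y).sum fun _ c => c) = 1 := by
  obtain ⟨σ, hσ, h2⟩ := cn_supp hdc hy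
  refine ⟨?_, mkP_nonneg hy.1, by rw [mkP_total, hm]⟩
  rw [mkP_supp hy.1 h2 (hS σ hσ)]
  refine hf σ hσ (Finset.nonempty_iff_ne_empty.2 ?_)
  rintro rfl
  have : y = 0 := funext fun v => by simpa using h2 v
  rw [this] at hm
  simp [mass] at hm

theorem spc_cont {T : Type} [TopologicalSpace T] {X : Set (Finset U)} {G : T → spc X}
    (h : ∀ u, Continuous fun t => (G t).1 u) : Continuous G :=
  continuous_induced_rng.2 (continuous_pi h)

theorem spc_coord {X : Set (Finset U)} (u : U) : Continuous fun z : spc X => z.1 u :=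
  (continuous_apply u).comp continuous_induced_dom

/-- extension of maps from the sphere, with total maps -/
def ExtN (N : ℕ) (Y : Type) [TopologicalSpace Y] : Prop :=
  ∀ f : Metric.sphere (0 : EE N) 1 → Y, Continuous f → ∃ F : EE N → Y, Continuous F ∧ ∀ x, F x.1 = f x

theorem ExtN_of' {Y : Type} [TopologicalSpace Y] {d m : ℤ} (h : DConnected Y d) (hm : m ≤ d) (hm1 : -1 ≤ m) :
    ExtN (m + 1).toNat Y := by
  intro f hf
  let f' : C(sphereSpace m, Y) := ⟨fun x => f ⟨x.1, by simpa using x.2.1⟩, hf.comp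
    (Continuous.subtype_mk continuous_subtype_val fun x => by simpa using x.2.1)⟩
  obtain ⟨F, hF⟩ := h m hm f'
  have hr : ∀ x : EE (m + 1).toNat, ‖(max 1 ‖x‖)⁻¹ • x‖ ≤ 1 := by
    intro x
    have : 0 < max 1 ‖x‖ := by positivity
    rw [norm_smul, norm_inv, Real.norm_of_nonneg this.le, inv_mul_le_iff₀ this, mul_one]
    exact le_max_right _ _
  refine ⟨fun x => F ⟨(max 1 ‖x‖)⁻¹ • x, hr x, by omega⟩, ?_, ?_⟩
  · refine F.continuous.comp (Continuous.subtype_mk ?_ _)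
    have h1 : Continuous fun x : EE (m + 1).toNat => max 1 ‖x‖ := by fun_prop
    refine Continuous.smul (h1.inv₀ fun x => ?_) continuous_id
    positivity
  · rintro ⟨x, hx⟩
    have hx1 : ‖x‖ = 1 := by simpa using hx
    have hm0 : 0 ≤ m := by
      by_contra h0
      have : (m + 1).toNat = 0 := by omega
      have : Subsingleton (EE (m + 1).toNat) := by rw [this]; infer_instance
      rw [Subsingleton.elim x 0] at hx1
      simp at hx1
    have := hF ⟨x, hx1, hm0⟩
    rw [show f ⟨x, hx⟩ = f' ⟨x, hx1, hm0⟩ from rfl, ← this]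
    refine congrArg F (Subtype.ext ?_)
    simp [sphereToDisc, hx1]

theorem ExtN_of {Y : Type} [TopologicalSpace Y] {d : ℤ} (h : DConnected Y (d - 1)) {N : ℕ} (hN : (N : ℤ) ≤ d) : ExtN N Y := by
  have := ExtN_of' (m := (N : ℤ) - 1) h (by omega) (by omega)
  have e : ((N : ℤ) - 1 + 1).toNat = N := by omega
  rwa [e] at this

theorem lebesgue {Y : Set (α → ℝ)} {S0 : Finset α} (hY : IsCompact Y) (hS : ∀ z ∈ Y, ∀ v, v ∉ S0 → z v = 0)
    {X : Set (Finset U)} {Φ : (α → ℝ) → spc X} (hΦ : ContinuousOn Φ Y) :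
    ∃ ε > 0, ∀ z ∈ Y, ∃ u, ∀ z' ∈ Y, D2 S0 z z' ≤ ε → 0 < (Φ z').1 u := by
  have hD : Continuous fun q : (α → ℝ) × (α → ℝ) => D2 S0 q.1 q.2 := by
    unfold D2; fun_prop
  by_contra hcon
  push Not at hcon
  have h1 : ∀ n : ℕ, ∃ z ∈ Y, ∀ u, ∃ z' ∈ Y, D2 S0 z z' ≤ 1 / ((n : ℝ) + 1) ∧ (Φ z').1 u ≤ 0 :=
    fun n => hcon _ (by positivity)
  choose z hz hz2 using h1
  let 𝓤 : Ultrafilter ℕ := Ultrafilter.of Filter.atTop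
  have hU : (𝓤 : Filter ℕ) ≤ Filter.atTop := Ultrafilter.of_le _
  obtain ⟨a, ha, hcl⟩ := hY.ultrafilter_le_nhds (𝓤.map z) (Filter.le_principal_iff.2
    (Filter.mem_map.2 (Filter.Eventually.of_forall hz)))
  have hza : Filter.Tendsto z 𝓤 (𝓝 a) := hcl
  obtain ⟨u, hu⟩ : ∃ u, 0 < (Φ a).1 u := by
    by_contra h0
    push Not at h0
    have h3 : (Φ a).1 = 0 := by
      ext u
      exact le_antisymm (h0 u) ((Φ a).2.2.1 u)
    have h2 := (Φ a).2.2.2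
    rw [h3] at h2
    simp at h2
  choose z' hz' hz'2 hz'3 using fun n => hz2 n u
  have hD0 : Filter.Tendsto (fun n => D2 S0 (z n) (z' n)) 𝓤 (𝓝 0) :=
    squeeze_zero (fun n => D2_nonneg _ _ _) hz'2 (tendsto_one_div_add_atTop_nhds_zero_nat.mono_left hU)
  have hz'a : Filter.Tendsto z' 𝓤 (𝓝 a) := by
    rw [tendsto_pi_nhds] at hza ⊢
    intro v
    by_cases hv : v ∈ S0
    · have h2 : Filter.Tendsto (fun n => (z n v - z' n v) ^ 2) 𝓤 (𝓝 0) :=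
        squeeze_zero (fun n => sq_nonneg _) (fun n => D2_coord hv) hD0
      have h3 : Filter.Tendsto (fun n => |z n v - z' n v|) 𝓤 (𝓝 0) := by
        have := (Real.continuous_sqrt.tendsto 0).comp h2
        rw [Real.sqrt_zero] at this
        exact this.congr fun n => Real.sqrt_sq_eq_abs _
      have h4 := (tendsto_zero_iff_abs_tendsto_zero _).2 h3
      have h5 := (hza v).sub h4
      rw [sub_zero] at h5
      exact h5.congr fun n => by simp
    · rw [hS a ha v hv]
      exact tendsto_const_nhds.congr fun n => (hS _ (hz' n) v hv).symm
  have h6 : Filter.Tendsto (fun n => (Φ (z' n)).1 u) 𝓤 (𝓝 ((Φ a).1 u)) :=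
    ((spc_coord u).tendsto _).comp ((hΦ a ha).tendsto.comp (tendsto_nhdsWithin_iff.2
      ⟨hz'a, Filter.Eventually.of_forall hz'⟩))
  exact absurd (le_of_tendsto' h6 hz'3) (not_le.2 hu)

theorem Z_compact {L0 : Set (Finset α)} {S0 : Finset α} (hdc : DC L0) (hS : FinC L0 S0) :
    IsCompact {z | z ∈ cn L0 ∧ mass S0 z = 1} := by
  have h1 : IsCompact (Set.pi univ fun _ : α => Icc (0 : ℝ) 1) := isCompact_univ_pi fun _ => isCompact_Icc
  refine h1.of_isClosed_subset ((cn_closed hS.finite).inter (isClosed_eq (mass_cont S0) continuous_const)) ?_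
  rintro z ⟨hz, hm⟩ v _
  exact ⟨hz.1 v, hm ▸ le_mass hS hz v⟩

theorem D2_jensen {S0 S : Finset α} {p : α → α → ℝ} {x q : α → ℝ} {ε : ℝ} (hx : ∀ v, 0 ≤ x v) (hm : mass S x = 1)
    (h : ∀ v ∈ S, x v ≠ 0 → D2 S0 q (p v) ≤ ε) : D2 S0 q (PP S p x) ≤ ε := by
  have h1 : ∀ u, (q u - PP S p x u) ^ 2 ≤ ∑ v ∈ S, x v * (q u - p v u) ^ 2 := by
    intro u
    have h2 : q u - PP S p x u = ∑ v ∈ S, x v • (q u - p v u) := by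
      simp only [PP_apply, smul_eq_mul, mul_sub, Finset.sum_sub_distrib, ← Finset.sum_mul]
      rw [show ∑ i ∈ S, x i = 1 from hm, one_mul]
    rw [h2]
    have := (even_two.convexOn_pow (𝕜 := ℝ)).map_sum_le (t := S) (w := x) (p := fun v => q u - p v u) (fun v _ => hx v) hm
      (fun _ _ => trivial)
    simpa using this
  calc D2 S0 q (PP S p x) ≤ ∑ u ∈ S0, ∑ v ∈ S, x v * (q u - p v u) ^ 2 := Finset.sum_le_sum fun u _ => h1 u
    _ = ∑ v ∈ S, x v * D2 S0 q (p v) := by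
      rw [Finset.sum_comm]
      refine Finset.sum_congr rfl fun v _ => ?_
      rw [D2, Finset.mul_sum]
    _ ≤ ∑ v ∈ S, x v * ε := by
      refine Finset.sum_le_sum fun v hv => ?_
      by_cases h0 : x v = 0
      · simp [h0]
      · exact mul_le_mul_of_nonneg_left (h v hv h0) (hx v)
    _ = ε := by rw [← Finset.sum_mul, show ∑ i ∈ S, x i = 1 from hm, one_mul]

theorem smp_of {L : Set (Finset α)} {S : Finset α} (hS : FinC L S) {X : Set (Finset U)} (hX : IsComplex X) {g : α → U}
    {Ψ : (α → ℝ) → spc X}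
    (h : ∀ x ∈ cn L, mass S x = 1 → ∀ w, 0 < x w → 0 < (Ψ x).1 (g w)) : Smp L X g := by
  intro τ hτ hne
  have hc : (0 : ℝ) < τ.card := by exact_mod_cast hne.card_pos
  let x : α → ℝ := (τ.card : ℝ)⁻¹ • ind τ
  have hx : x ∈ cn L := cn_smul ⟨fun v => by unfold ind; split_ifs <;> norm_num, τ, hτ, fun v hv => by simp [ind, hv]⟩
    (by positivity)
  have hm : mass S x = 1 := by
    rw [mass_smul]
    have : mass S (ind τ) = τ.card := by
      simp [mass, ind, Finset.inter_eq_right.2 (hS τ hτ)]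
    rw [this]; field_simp
  have h1 : τ.image g ⊆ (Ψ x).1.support := by
    intro u hu
    obtain ⟨w, hw, rfl⟩ := Finset.mem_image.1 hu
    refine Finsupp.mem_support_iff.2 (h x hx hm w ?_).ne'
    simp only [x, ind, Pi.smul_apply, hw, if_true, smul_eq_mul, mul_one]
    positivity
  exact (hX _ (Ψ x).2.1).2 _ h1 (by simpa using hne.ne_empty)

theorem St.PP_mem {R : Set α} {N : ℕ} {B L0 : Set (Finset α)} {S0 : Finset α} {L : Set (Finset α)} {S : Finset α}
    {p : α → α → ℝ} (h : St R N B L0 S0 L S p) {x : α → ℝ} (hx : x ∈ cn L) (hm : mass S x = 1) :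
    PP S p x ∈ {z | z ∈ cn L0 ∧ mass S0 z = 1} := by
  refine ⟨?_, by rw [h.massPP hx, hm]⟩
  obtain ⟨ω, hω⟩ := h.hh
  exact hω.map x hx

theorem adj_of {L : Set (Finset α)} (hdc : DC L) {x : α → ℝ} (hx : x ∈ cn L) {v w : α} (hv : x v ≠ 0) (hw : x w ≠ 0) :
    {v, w} ∈ L := by
  obtain ⟨τ, hτ, h2⟩ := cn_supp hdc hx
  refine hdc _ hτ _ ?_
  intro u hu
  simp only [Finset.mem_insert, Finset.mem_singleton] at hu
  rcases hu with rfl | rfl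
  · exact (h2 _).1 hv
  · exact (h2 _).1 hw
end

section
variable {α U : Type}

/-- the map on the cone used for filling a sphere -/
theorem cone_map {N : ℕ} {K : Set (Finset α)} (hK : Mfd N K ∅) (hne : ∅ ∈ K) {S : Finset α} (hS : FinC K S) {c0 : α}
    (hc0 : c0 ∉ S) {X : Set (Finset U)} {f : α → U} (hf : Smp K X f) (hE : ExtN N (spc X)) :
    ∃ Φ : (α → ℝ) → spc X, ContinuousOn Φ (cn (coneC c0 K)) ∧
      ∀ z ∈ cn (coneC c0 K), mass (insert c0 S) z = 1 → z c0 ≤ 3 / 4 → ∀ v, {v} ∈ K → 0 < z v → 0 < (Φ z).1 (f v) := by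
  have hsph : Sph N K := by
    obtain ⟨n, h1, h2⟩ := hK.sph ∅ hne (by simp)
    rw [lk_empty] at h2
    simp at h1; subst h1; exact h2
  obtain ⟨φ, ψ, hh, hn⟩ := hsph.normal hS
  have hψm : ∀ y, mass S (ψ y) = ‖y‖ := fun y => by rw [← hn _ (hh.map' y trivial), hh.right y trivial]
  let b : Metric.sphere (0 : EE N) 1 → spc X := fun y =>
    ⟨mkP S f (ψ y.1), mkP_mem hK.dcL hS hf (hh.map' _ trivial) (by rw [hψm]; simpa using y.2)⟩
  have hb : Continuous b := by
    refine spc_cont fun u => ?_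
    exact (mkP_cont S f u).comp (hh.cont'.comp_continuous continuous_subtype_val fun _ => trivial)
  obtain ⟨F, hFc, hF⟩ := hE b hb
  have hcut : ∀ z ∈ cn (coneC c0 K), cut {c0} z ∈ cn K := by
    rintro z ⟨h1, τ, hτ, h2⟩
    refine ⟨fun v => ?_, _, hτ, fun v hv => ?_⟩
    · unfold cut; split_ifs
      · exact le_rfl
      · exact h1 v
    · unfold cut; split_ifs with h3
      · rfl
      · refine h2 v fun h4 => hv (Finset.mem_erase.2 ⟨by simpa using h3, h4⟩)
  refine ⟨fun z => F ((max ‖φ (cut {c0} z)‖ (1 / 4))⁻¹ • φ (cut {c0} z)), ?_, ?_⟩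
  · have h1 : ContinuousOn (fun z => φ (cut {c0} z)) (cn (coneC c0 K)) :=
      hh.cont.comp (cut_cont _).continuousOn hcut
    refine hFc.comp_continuousOn (ContinuousOn.smul (ContinuousOn.inv₀ (h1.norm.sup continuousOn_const) ?_) h1)
    intro z _
    positivity
  · intro z hz hm hz0 v hv hzv
    have hvS : v ∈ S := hS _ hv (by simp)
    have hvc : v ≠ c0 := fun h => hc0 (h ▸ hvS)
    have hmc : mass S (cut {c0} z) = 1 - z c0 := by
      unfold mass at hm ⊢
      rw [Finset.sum_insert hc0] at hm
      have : ∑ v ∈ S, cut {c0} z v = ∑ v ∈ S, z v := by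
        refine Finset.sum_congr rfl fun w hw => ?_
        have : w ≠ c0 := fun h => hc0 (h ▸ hw)
        simp [cut, this]
      rw [this]; linarith
    have hn1 := hn _ (hcut z hz)
    rw [hmc] at hn1
    dsimp only
    have hpos : 0 < 1 - z c0 := by linarith
    rw [hn1, max_eq_left (by linarith)]
    have hs : ((1 - z c0)⁻¹ • φ (cut {c0} z)) ∈ Metric.sphere (0 : EE N) 1 := by
      simp only [mem_sphere_iff_norm, sub_zero, norm_smul, norm_inv, hn1]
      rw [Real.norm_of_nonneg hpos.le]; field_simp
    rw [hF ⟨_, hs⟩]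
    show 0 < mkP S f (ψ ((1 - z c0)⁻¹ • φ (cut {c0} z))) (f v)
    rw [← hh.hom _ (by positivity) _ (hcut z hz), hh.left _ (cn_smul (hcut z hz) (by positivity))]
    have hc := cn_smul (hcut z hz) (r := (1 - z c0)⁻¹) (by positivity)
    refine lt_of_lt_of_le ?_ (le_mkP hc.1 hvS)
    simp only [Pi.smul_apply, smul_eq_mul, cut, Finset.mem_singleton, hvc, if_false]
    positivity

theorem fill0 {N : ℕ} {K : Set (Finset α)} (hK : Mfd N K ∅) (hne : ∅ ∈ K) {X : Set (Finset U)} (hX : IsComplex X)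
    {f : α → U} (hf : Smp K X f) (hE : ExtN N (spc X)) {R : Set α} (hR : Rᶜ.Infinite) :
    ∃ (L : Set (Finset α)) (g : α → U), Mfd (N + 1) L K ∧ Full L K ∧ (∀ τ ∈ L, ∀ v ∈ τ, v ∈ R → {v} ∈ K) ∧
      (∀ v, {v} ∈ K → g v = f v) ∧ Smp L X g := by
  obtain ⟨S, hS⟩ := hK.fin
  obtain ⟨c0, hc⟩ := (hR.diff S.finite_toSet).nonempty
  have hcR : c0 ∉ R := hc.1
  have hc0 : c0 ∉ S := by simpa using hc.2
  have hcK : ∀ τ ∈ K, c0 ∉ τ := fun τ hτ h => hc0 (hS τ hτ h)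
  obtain ⟨Φ, hΦ, hΦ2⟩ := cone_map hK hne hS hc0 hf hE
  have hS0 : FinC (coneC c0 K) (insert c0 S) := by
    intro τ hτ v hv
    by_cases h : v = c0
    · simp [h]
    · exact Finset.mem_insert_of_mem (hS _ hτ (Finset.mem_erase.2 ⟨h, hv⟩))
  have hc0K : {c0} ∉ K := fun h => hcK _ h (by simp)
  have hdc0 := hK.dcL.cone c0
  obtain ⟨ε, hε, hleb⟩ := lebesgue (S0 := insert c0 S) (Z_compact hdc0 hS0) (fun z hz v hv => hS0.cn_zero hz.1 hv)
    (hΦ.mono fun z hz => hz.1)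
  have hst := St.start (R := R) (hK.cone hcK) (Full.cone hcK) hS0 (by
    intro τ hτ v hv hvR
    refine hK.dcL _ hτ _ ?_
    have : v ≠ c0 := fun h => hcR (h ▸ hvR)
    simp [this, hv])
  obtain ⟨L1, S1, p1, h1, hJ1⟩ := stage1 hR hc0K _ _ _ _ hst rfl (by
    intro v w hv hw hwc hvw
    simp [ind, hwc.symm]) le_rfl
  obtain ⟨L, S', p, h, hJ, hFi⟩ := mesh hR c0 h1 hJ1 (ε := min ε (1 / 16)) (by positivity)
  have hp0 : ∀ v, {v} ∈ K → p v c0 = 0 := by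
    intro v hv
    have : c0 ≠ v := fun h => hc0K (h ▸ hv)
    rw [h.bdy v hv]; simp [ind, this]
  -- choice of the vertex map
  have hg : ∀ w, ∃ u, ({w} ∈ K → u = f w) ∧ ({w} ∉ K → {w} ∈ L → (∃ v, {v} ∈ K ∧ {v, w} ∈ L) →
      ∃ v, {v} ∈ K ∧ 0 < p w v ∧ u = f v) ∧ ({w} ∉ K → {w} ∈ L → (¬ ∃ v, {v} ∈ K ∧ {v, w} ∈ L) →
      ∀ z' ∈ {z | z ∈ cn (coneC c0 K) ∧ mass (insert c0 S) z = 1}, D2 (insert c0 S) (p w) z' ≤ ε → 0 < (Φ z').1 u) := by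
    intro w
    by_cases hw : {w} ∈ K
    · exact ⟨f w, fun _ => rfl, fun h => absurd hw h, fun h => absurd hw h⟩
    · by_cases hwL : {w} ∈ L
      · by_cases hadj : ∃ v, {v} ∈ K ∧ {v, w} ∈ L
        · obtain ⟨v, hv, hvw⟩ := hadj
          have hpw := hJ v w hv hw hvw
          have hm := h.mass1 w hwL
          have hpm := h.pmem hwL
          have : ∃ v ∈ S, p w v ≠ 0 := by
            by_contra hcon
            push Not at hcon
            unfold mass at hm
            rw [Finset.sum_insert hc0, Finset.sum_eq_zero hcon] at hm
            linarith
          obtain ⟨v', hv', hv'2⟩ := this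
          have hv'c : v' ≠ c0 := fun h => hc0 (h ▸ hv')
          refine ⟨f v', fun h => absurd h hw, fun _ _ _ => ⟨v', ?_, lt_of_le_of_ne (hpm.1 v') hv'2.symm, rfl⟩,
            fun _ _ h => absurd ⟨v, hv, hvw⟩ h⟩
          obtain ⟨τ, hτ, h2⟩ := cn_supp hdc0 hpm
          refine hK.dcL _ hτ _ ?_
          simp [hv'c, (h2 v').1 hv'2]
        · obtain ⟨u, hu⟩ := hleb (p w) ⟨h.pmem hwL, h.mass1 w hwL⟩
          exact ⟨u, fun h => absurd h hw, fun _ _ h => absurd h hadj, fun _ _ _ => hu⟩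
      · obtain ⟨u, -⟩ := hleb (ind {c0}) ⟨ind_mem_cn (by rw [mem_coneC]; simpa using hne), by simp [mass, ind]⟩
        exact ⟨u, fun h => absurd h hw, fun _ h => absurd h hwL, fun _ h => absurd h hwL⟩
  choose g hg1 hg2 hg3 using hg
  refine ⟨L, g, h.mfd, h.full, h.avoid, hg1, smp_of h.fin hX (Ψ := fun x => Φ (PP S' p x)) ?_⟩
  intro x hx hm w hw
  have hz := h.PP_mem hx hm
  have hvL : ∀ v, x v ≠ 0 → {v} ∈ L := fun v hv => by simpa using adj_of h.mfd.dcL hx hv hv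
  have hwL := hvL w hw.ne'
  have hwS : w ∈ S' := h.fin _ hwL (by simp)
  have hpn : ∀ v, x v ≠ 0 → ∀ u, 0 ≤ p v u := fun v hv u => (h.pmem (hvL v hv)).1 u
  -- lower bound for coordinates of `PP`
  have hlow : ∀ u, 0 < p w u → 0 < PP S' p x u := by
    intro u hu
    rw [PP_apply]
    refine lt_of_lt_of_le (mul_pos hw hu) (Finset.single_le_sum (f := fun v => x v * p v u) (fun v _ => ?_) hwS)
    by_cases h0 : x v = 0
    · simp [h0]
    · exact mul_nonneg (hx.1 v) (hpn v h0 u)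
  have hc0b : (∀ v, x v ≠ 0 → p v c0 ≤ 3 / 4) → PP S' p x c0 ≤ 3 / 4 := by
    intro hb
    rw [PP_apply]
    calc ∑ v ∈ S', x v * p v c0 ≤ ∑ v ∈ S', x v * (3 / 4) := by
          refine Finset.sum_le_sum fun v _ => ?_
          by_cases h0 : x v = 0
          · simp [h0]
          · exact mul_le_mul_of_nonneg_left (hb v h0) (hx.1 v)
      _ = 3 / 4 := by rw [← Finset.sum_mul, show ∑ i ∈ S', x i = 1 from hm, one_mul]
  by_cases hwK : {w} ∈ K
  · rw [hg1 w hwK]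
    refine hΦ2 _ hz.1 hz.2 (hc0b fun v hv => ?_) w hwK (hlow w ?_)
    · by_cases hvK : {v} ∈ K
      · rw [hp0 v hvK]; norm_num
      · exact (hJ w v hwK hvK (adj_of h.mfd.dcL hx hw.ne' hv)).trans (by norm_num)
    · rw [h.bdy w hwK]; simp [ind]
  · by_cases hadj : ∃ v, {v} ∈ K ∧ {v, w} ∈ L
    · obtain ⟨v', hv'K, hv'p, hgv⟩ := hg2 w hwK hwL hadj
      rw [hgv]
      refine hΦ2 _ hz.1 hz.2 (hc0b fun v hv => ?_) v' hv'K (hlow v' hv'p)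
      by_cases hvK : {v} ∈ K
      · rw [hp0 v hvK]; norm_num
      · obtain ⟨v1, hv1, hv1w⟩ := hadj
        have h3 := hJ v1 w hv1 hwK hv1w
        have h4 := (D2_coord (x := p v) (y := p w) (Finset.mem_insert_self c0 S)).trans
          ((hFi v w hvK hwK (adj_of h.mfd.dcL hx hv hw.ne')).trans (min_le_right _ _))
        have := abs_le_of_sq_le_sq (a := p v c0 - p w c0) (b := 1 / 4) (by linarith) (by norm_num)
        linarith [le_abs_self (p v c0 - p w c0), this]
    · refine hg3 w hwK hwL hadj _ hz (D2_jensen hx.1 hm fun v hv h0 => ?_)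
      have hvK : {v} ∉ K := fun h1 => hadj ⟨v, h1, adj_of h.mfd.dcL hx h0 hw.ne'⟩
      exact (hFi w v hwK hvK (adj_of h.mfd.dcL hx hw.ne' h0)).trans (min_le_left _ _)
end

section
variable {α U : Type}

/-- a simplex on which the map is nowhere injective -/
def Bad (g : α → U) (σ : Finset α) : Prop := σ.Nonempty ∧ ∀ v ∈ σ, ∃ w ∈ σ, w ≠ v ∧ g w = g v

theorem inj_of_not_bad {L : Set (Finset α)} (hdc : DC L) {g : α → U} (h : ∀ σ ∈ L, ¬ Bad g σ) : LocInj L g := by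
  intro τ hτ
  rw [Finset.card_image_iff]
  intro v hv w hw hvw
  by_contra hne
  refine h {v, w} (hdc _ hτ _ ?_) ⟨⟨v, by simp⟩, ?_⟩
  · intro u hu
    simp only [Finset.mem_insert, Finset.mem_singleton] at hu
    rcases hu with rfl | rfl
    · exact hv
    · exact hw
  · intro u hu
    simp only [Finset.mem_insert, Finset.mem_singleton] at hu
    rcases hu with rfl | rfl
    · exact ⟨w, by simp, fun h => hne h.symm, hvw.symm⟩
    · exact ⟨v, by simp, hne, hvw⟩

theorem not_bad_of_inj {L : Set (Finset α)} {g : α → U} (h : LocInj L g) {σ : Finset α} (hσ : σ ∈ L) : ¬ Bad g σ := by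
  rintro ⟨⟨v, hv⟩, h2⟩
  obtain ⟨w, hw, h3, h4⟩ := h2 v hv
  exact h3 (Finset.card_image_iff.1 (h σ hσ) hw hv h4)

theorem Bad.card_image {g : α → U} {σ : Finset α} (h : Bad g σ) : (σ.image g).card + 1 ≤ σ.card := by
  have h1 : (σ.image g).card ≤ σ.card := Finset.card_image_le
  rcases h1.lt_or_eq with h2 | h2
  · exact h2
  · exact absurd h (not_bad_of_inj (L := {σ}) (fun τ hτ => by rw [mem_singleton_iff.1 hτ]; exact h2) rfl)

theorem Bad.union {g : α → U} {σ τ : Finset α} (h : Bad g σ) (h2 : ∀ v ∈ τ, ∃ w ∈ σ ∪ τ, w ≠ v ∧ g w = g v) :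
    Bad g (σ ∪ τ) := by
  refine ⟨h.1.mono Finset.subset_union_left, fun v hv => ?_⟩
  rcases Finset.mem_union.1 hv with h3 | h3
  · obtain ⟨w, hw, h4⟩ := h.2 v h3
    exact ⟨w, Finset.mem_union_left _ hw, h4⟩
  · exact h2 v h3

/-- the data provided by filling a sphere -/
structure Fl (N : ℕ) (K : Set (Finset α)) (X : Set (Finset U)) (f : α → U) (R : Set α) (L : Set (Finset α)) (F : α → U) :
    Prop where
  mfd : Mfd (N + 1) L K
  full : Full L K
  avoid : ∀ τ ∈ L, ∀ v ∈ τ, v ∈ R → {v} ∈ K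
  ext : ∀ v, {v} ∈ K → F v = f v
  smp : Smp L X F
  inj : LocInj L F

/-- a maximal bad simplex -/
structure MaxBad (L : Set (Finset α)) (g : α → U) (σ : Finset α) : Prop where
  mem : σ ∈ L
  bad : Bad g σ
  max : ∀ τ ∈ L, Bad g τ → τ.card ≤ σ.card

theorem MaxBad.inj {L : Set (Finset α)} {g : α → U} {σ : Finset α} (hdc : DC L) (h : MaxBad L g σ) : LocInj (lk L σ) g := by
  refine inj_of_not_bad (hdc.lk σ) fun τ hτ hb => ?_
  have h1 : Bad g (σ ∪ τ) := h.bad.union fun v hv => by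
    obtain ⟨w, hw, h4⟩ := hb.2 v hv
    exact ⟨w, Finset.mem_union_right _ hw, h4⟩
  have h2 := h.max _ hτ.2 h1
  rw [Finset.card_union_of_disjoint hτ.1] at h2
  have := hb.1.card_pos
  omega

theorem MaxBad.disj {L : Set (Finset α)} {g : α → U} {σ : Finset α} (hdc : DC L) (h : MaxBad L g σ) {τ : Finset α}
    (hτ : τ ∈ lk L σ) : Disjoint (σ.image g) (τ.image g) := by
  rw [Finset.disjoint_left]
  intro u h1 h2
  obtain ⟨v, hv, rfl⟩ := Finset.mem_image.1 h1
  obtain ⟨w, hw, h3⟩ := Finset.mem_image.1 h2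
  have hwσ : w ∉ σ := fun h4 => Finset.disjoint_left.1 hτ.1 h4 hw
  have h4 : Bad g (σ ∪ {w}) := h.bad.union fun v' hv' => by
    rw [Finset.mem_singleton.1 hv']
    exact ⟨v, Finset.mem_union_left _ hv, fun h5 => hwσ (h5 ▸ hv), h3.symm⟩
  have h5 := h.max _ (hdc _ hτ.2 _ (Finset.union_subset_union_right (by simpa using hw))) h4
  rw [Finset.card_union_of_disjoint (by simpa using hwσ)] at h5
  simp at h5

theorem MaxBad.smp {L : Set (Finset α)} {g : α → U} {σ : Finset α} {X : Set (Finset U)} (hdc : DC L) (h : MaxBad L g σ)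
    (hs : Smp L X g) : Smp (lk L σ) (link X (σ.image g)) g := by
  intro τ hτ hne
  refine ⟨hs _ (hdc.lk_sub hτ) hne, h.disj hdc hτ, ?_⟩
  rw [← Finset.image_union]
  exact hs _ hτ.2 (hne.mono Finset.subset_union_right)

theorem IsComplex.link {X : Set (Finset U)} (hX : IsComplex X) (s : Finset U) : IsComplex (link X s) := by
  rintro τ ⟨h1, h2, h3⟩
  refine ⟨(hX τ h1).1, fun ρ hρ hne => ⟨(hX τ h1).2 ρ hρ hne, h2.mono_right hρ, ?_⟩⟩
  refine (hX _ h3).2 _ (Finset.union_subset_union_right hρ) ?_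
  intro h4
  exact hne (Finset.union_eq_empty.1 h4).2

theorem link_link {X : Set (Finset U)} (hX : IsComplex X) {s τ : Finset U} (hτ : τ ∈ link X s) :
    link (link X s) τ = link X (s ∪ τ) := by
  ext ρ
  obtain ⟨h1, h2, h3⟩ := hτ
  constructor
  · rintro ⟨⟨h4, h5, h6⟩, h7, h8, h9, h10⟩
    exact ⟨h4, Finset.disjoint_union_left.2 ⟨h5, h7⟩, by rwa [Finset.union_assoc]⟩
  · rintro ⟨h4, h5, h6⟩
    rw [Finset.disjoint_union_left] at h5
    rw [Finset.union_assoc] at h6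
    refine ⟨⟨h4, h5.1, (hX _ h6).2 _ ?_ ?_⟩, h5.2, (hX _ h6).2 _ ?_ ?_, ?_, h6⟩
    · exact Finset.union_subset_union_right Finset.subset_union_right
    · intro h7; exact (hX _ h4).1 (Finset.union_eq_empty.1 h7).2
    · exact Finset.subset_union_right
    · intro h7; exact (hX _ h4).1 (Finset.union_eq_empty.1 h7).2
    · exact Finset.disjoint_union_right.2 ⟨h2, h5.1⟩

theorem WCM.link {X : Set (Finset U)} (hX : IsComplex X) {d : ℤ} (h : WCM X d) {s : Finset U} (hs : s ∈ X) :
    WCM (link X s) (d - s.card) := by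
  refine ⟨h.2 s hs, fun τ hτ => ?_⟩
  rw [link_link hX hτ]
  have := h.2 _ hτ.2.2
  rw [Finset.card_union_of_disjoint hτ.2.1] at this
  convert this using 2
  push_cast; ring

/-- replacement complex with its ambient complex -/
structure Rp (P : ℕ) (L B : Set (Finset α)) (X : Set (Finset U)) (g : α → U) (σ : Finset α) (A : Set (Finset α))
    (g' : α → U) (M : ℕ) : Prop where
  rh : RH P M L B σ A
  fullA : Full A (lk L σ)
  old : ∀ v, {v} ∈ L → g' v = g v
  smp : Smp {τ | τ ∈ L ∨ τ \ σ ∈ A} X g'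
  bad : ∀ τ ∈ Repl L σ A, Bad g' τ → τ ∈ L ∧ Bad g τ ∧ τ ≠ σ

theorem img_congr {g g' : α → U} {τ : Finset α} (h : ∀ v ∈ τ, g' v = g v) : τ.image g' = τ.image g :=
  Finset.image_congr fun v hv => h v hv

theorem bad_congr {g g' : α → U} {τ : Finset α} (h : ∀ v ∈ τ, g' v = g v) (hb : Bad g' τ) : Bad g τ := by
  refine ⟨hb.1, fun v hv => ?_⟩
  obtain ⟨w, hw, h1, h2⟩ := hb.2 v hv
  exact ⟨w, hw, h1, by rw [← h w hw, ← h v hv, h2]⟩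

open Classical in
theorem mk_Rp {P N : ℕ} {L B : Set (Finset α)} {X : Set (Finset U)} (hX : IsComplex X) {g gA : α → U} {σ : Finset α}
    {A : Set (Finset α)} {R : Set α} {S : Finset α}
    (hm : Mfd P L B) (hS : FinC L S) (hs : Smp L X g) (hσ : MaxBad L g σ) (hσB : σ ∉ B) (hP : N + σ.card = P)
    (hA : Fl N (lk L σ) (link X (σ.image g)) g (R ∪ S) A gA) :
    ∃ g', Rp P L B X g σ A g' (N + 1) := by
  have hdc := hm.dcL
  have hvL : ∀ τ ∈ L, ∀ v ∈ τ, {v} ∈ L := fun τ hτ v hv => hdc _ hτ _ (by simpa using hv)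
  have hAL : ∀ β ∈ A, ∀ v ∈ β, {v} ∈ L → {v} ∈ lk L σ := fun β hβ v hv h1 =>
    hA.avoid β hβ v hv (Or.inr (hS _ h1 (by simp)))
  have hold : ∀ v, {v} ∈ L → (if {v} ∈ A then gA v else g v) = g v := by
    intro v hv
    split_ifs with h1
    · exact hA.ext v (hAL _ h1 v (by simp) hv)
    · rfl
  have hnew : ∀ β ∈ A, ∀ v ∈ β, (if {v} ∈ A then gA v else g v) = gA v := by
    intro β hβ v hv
    rw [if_pos (hA.mfd.dcL _ hβ _ (by simpa using hv))]
  have hdis : ∀ β ∈ A, Disjoint σ β := by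
    intro β hβ
    rw [Finset.disjoint_right]
    intro v hv hvσ
    have := (hAL β hβ v hv (hvL σ hσ.mem v hvσ)).1
    simp at this
    exact this hvσ
  have hrep : ∀ τ, τ \ σ ∈ A → (τ \ σ).Nonempty → (τ \ σ).image (fun v => if {v} ∈ A then gA v else g v) ∈ link X (σ.image g) := by
    intro τ h1 h2
    rw [img_congr (hnew _ h1)]
    exact hA.smp _ h1 h2
  refine ⟨fun v => if {v} ∈ A then gA v else g v, ⟨hm, hA.mfd, hσ.bad.1, hσ.mem, hσB, by omega, hdis, ?_⟩, hA.full, hold, ?_, ?_⟩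
  · intro β hβ hβL
    rcases β.eq_empty_or_nonempty with rfl | hne
    · exact empty_mem_lk hσ.mem
    · exact hA.full β hβ hne fun v hv => hAL β hβ v hv (hvL β hβL v hv)
  · have hL : ∀ τ ∈ L, τ.Nonempty → τ.image (fun v => if {v} ∈ A then gA v else g v) ∈ X := by
      intro τ hτ hne
      rw [img_congr (fun v hv => hold v (hvL τ hτ v hv))]
      exact hs τ hτ hne
    rintro τ (hτ | hτ) hne
    · exact hL τ hτ hne
    · rcases (τ \ σ).eq_empty_or_nonempty with h1 | h1
      · exact hL τ (hdc _ hσ.mem _ (Finset.sdiff_eq_empty_iff_subset.1 h1)) hne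
      · obtain ⟨h2, h3, h4⟩ := hrep τ hτ h1
        refine (hX _ h4).2 _ ?_ (by simpa using hne.ne_empty)
        rw [← img_congr (fun v hv => hold v (hvL σ hσ.mem v hv)), ← Finset.image_union]
        refine Finset.image_subset_image ?_
        intro v hv
        simp only [Finset.mem_union, Finset.mem_sdiff]; tauto
  · rintro τ ⟨h1, h2⟩ hb
    have hτL : τ ∈ L := by
      rcases h2 with h2 | h2
      · exact h2
      · rcases (τ \ σ).eq_empty_or_nonempty with h3 | ⟨v, hv⟩
        · exact hdc _ hσ.mem _ (Finset.sdiff_eq_empty_iff_subset.1 h3)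
        · exfalso
          obtain ⟨w, hw, hwv, hgw⟩ := hb.2 v (Finset.sdiff_subset hv)
          dsimp only at hgw
          obtain ⟨h4, h5, h6⟩ := hrep τ h2 ⟨v, hv⟩
          by_cases hwσ : w ∈ σ
          · refine Finset.disjoint_left.1 h5 (Finset.mem_image_of_mem g hwσ) ?_
            rw [← hold w (hvL σ hσ.mem w hwσ), hgw]
            exact Finset.mem_image_of_mem _ hv
          · have hw' : w ∈ τ \ σ := Finset.mem_sdiff.2 ⟨hw, hwσ⟩
            rw [hnew _ h2 w hw', hnew _ h2 v hv] at hgw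
            exact hwv (Finset.card_image_iff.1 (hA.inj _ h2) hw' hv hgw)
    refine ⟨hτL, bad_congr (fun v hv => hold v (hvL τ hτL v hv)) hb, ?_⟩
    rintro rfl
    exact h1 (Finset.Subset.refl _)

/-- removal of all bad simplices, keeping track of an invariant -/
theorem remove {P : ℕ} {B : Set (Finset α)} {X : Set (Finset U)} (hX : IsComplex X) {d : ℤ} (hW : WCM X d)
    (hPd : (P : ℤ) ≤ d + 1) {R : Set α} (hR : Rᶜ.Infinite)
    (hfill : ∀ (N : ℕ), N + 2 ≤ P → ∀ (X' : Set (Finset U)) (d' : ℤ), IsComplex X' → WCM X' d' → (N : ℤ) ≤ d' →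
      ∀ (K : Set (Finset α)) (f : α → U), Mfd N K ∅ → ∅ ∈ K → Smp K X' f → LocInj K f → ∀ R' : Set α, R'ᶜ.Infinite →
      ∃ L F, Fl N K X' f R' L F)
    (Q : Set (Finset α) → (α → U) → Prop)
    (hQ : ∀ L g σ A g' M, Rp P L B X g σ A g' M → Q L g → Q (Repl L σ A) g') (k : ℕ) :
    ∀ (L : Set (Finset α)) (g : α → U), Mfd P L B → Full L B → (∀ τ ∈ L, ∀ v ∈ τ, v ∈ R → {v} ∈ B) → Smp L X g →
      LocInj B g → Q L g → {σ | σ ∈ L ∧ Bad g σ}.ncard ≤ k →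
      ∃ L' g', Mfd P L' B ∧ Full L' B ∧ (∀ τ ∈ L', ∀ v ∈ τ, v ∈ R → {v} ∈ B) ∧ Smp L' X g' ∧ LocInj L' g' ∧
        (∀ v, {v} ∈ B → g' v = g v) ∧ Q L' g' := by
  induction k with
  | zero =>
    intro L g hm hF ha hs hB hq hk
    have hfin : {σ | σ ∈ L ∧ Bad g σ}.Finite := hm.finite.subset fun σ h => h.1
    rw [Nat.le_zero, Set.ncard_eq_zero hfin] at hk
    refine ⟨L, g, hm, hF, ha, hs, inj_of_not_bad hm.dcL fun σ h1 h2 => ?_, fun _ _ => rfl, hq⟩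
    have : σ ∈ {σ | σ ∈ L ∧ Bad g σ} := ⟨h1, h2⟩
    rw [hk] at this
    exact this
  | succ k ih =>
    intro L g hm hF ha hs hB hq hk
    have hfin : {σ | σ ∈ L ∧ Bad g σ}.Finite := hm.finite.subset fun σ h => h.1
    rcases {σ | σ ∈ L ∧ Bad g σ}.eq_empty_or_nonempty with he | hne
    · exact ih L g hm hF ha hs hB hq (by rw [he]; simp)
    obtain ⟨σ, hσ, hmax⟩ := hfin.exists_maximalFor Finset.card _ hne
    have hMB : MaxBad L g σ := ⟨hσ.1, hσ.2, fun τ h1 h2 => by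
      rcases le_total τ.card σ.card with h | h
      · exact h
      · exact hmax ⟨h1, h2⟩ h⟩
    have hσB : σ ∉ B := fun h1 => not_bad_of_inj hB h1 hσ.2
    obtain ⟨S, hS⟩ := hm.fin
    obtain ⟨N, hN, -⟩ := hm.sph σ hσ.1 hσB
    have hc := hσ.2.card_image
    have hc1 : 1 ≤ (σ.image g).card := (hσ.2.1.image g).card_pos
    have hlkB : lk B σ = ∅ := by
      ext τ
      simp only [mem_empty_iff_false, iff_false]
      rintro ⟨_, h2⟩
      exact hσB (hm.dcB _ h2 _ Finset.subset_union_left)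
    have hmk : Mfd N (lk L σ) ∅ := by rw [← hlkB]; exact hm.lk hN
    obtain ⟨A, gA, hA⟩ := hfill N (by omega) (link X (σ.image g)) (d - (σ.image g).card) (hX.link _)
      (hW.link hX (hs σ hσ.1 hσ.2.1)) (by push_cast; omega) (lk L σ) g hmk (empty_mem_lk hσ.1) (hMB.smp hm.dcL hs)
      (hMB.inj hm.dcL) (R ∪ S) (by
        rw [Set.compl_union]
        exact hR.diff S.finite_toSet)
    obtain ⟨g', hRp⟩ := mk_Rp hX hm hS hs hMB hσB hN hA
    have hBold : ∀ v, {v} ∈ B → g' v = g v := fun v hv => hRp.old v (hm.sub hv)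
    have k1 : ∀ τ ∈ Repl L σ A, ∀ v ∈ τ, v ∈ R → {v} ∈ B := by
      rintro τ ⟨h1, h2⟩ v hv hvR
      have hvL : {v} ∈ L → {v} ∈ B := fun h => ha _ h v (by simp) hvR
      rcases h2 with h2 | h2
      · exact ha τ h2 v hv hvR
      · by_cases hvσ : v ∈ σ
        · exact hvL (hm.dcL _ hσ.1 _ (by simpa using hvσ))
        · refine hvL (hm.dcL.lk_sub (hA.avoid _ h2 v (Finset.mem_sdiff.2 ⟨hv, hvσ⟩) (Or.inl hvR)))
    have k2 : LocInj B g' := by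
      intro τ hτ
      rw [img_congr (fun v hv => hBold v (hm.dcB _ hτ _ (by simpa using hv)))]
      exact hB τ hτ
    have k3 : {τ | τ ∈ Repl L σ A ∧ Bad g' τ}.ncard ≤ k := by
      have h1 : {τ | τ ∈ Repl L σ A ∧ Bad g' τ} ⊆ {σ | σ ∈ L ∧ Bad g σ} \ {σ} := by
        rintro τ ⟨h1, h2⟩
        obtain ⟨h3, h4, h5⟩ := hRp.bad τ h1 h2
        exact ⟨⟨h3, h4⟩, h5⟩
      have h2 := Set.ncard_le_ncard h1 (hfin.subset Set.diff_subset)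
      have h3 := Set.ncard_diff_singleton_lt_of_mem hσ hfin
      omega
    obtain ⟨L', g'', h1, h2, h3, h4, h5, h6, h7⟩ := ih (Repl L σ A) g' hRp.rh.mfd (hRp.rh.full hF hRp.fullA) k1
      (fun τ hτ => hRp.smp τ hτ.2) k2 (hQ _ _ _ _ _ _ hRp hq) k3
    exact ⟨L', g'', h1, h2, h3, h4, h5, fun v hv => by rw [h6 v hv, hBold v hv], h7⟩

theorem fill (N : ℕ) : ∀ (X : Set (Finset U)) (d : ℤ), IsComplex X → WCM X d → (N : ℤ) ≤ d →
      ∀ (K : Set (Finset α)) (f : α → U), Mfd N K ∅ → ∅ ∈ K → Smp K X f → LocInj K f → ∀ R : Set α, Rᶜ.Infinite →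
      ∃ L F, Fl N K X f R L F := by
  induction N using Nat.strong_induction_on with
  | _ N ih =>
    intro X d hX hW hN K f hK hne hf hi R hR
    obtain ⟨L, g, h1, h2, h3, h4, h5⟩ := fill0 hK hne hX hf (ExtN_of hW.1 hN) hR
    obtain ⟨L', g', h1', h2', h3', h5', h6', h7', -⟩ := remove hX hW (by push_cast; omega) hR (fun n hn => ih n (by omega))
      (fun _ _ => True) (fun _ _ _ _ _ _ _ _ => trivial) _ L g h1 h2 h3 h5 (by
        intro τ hτ
        rw [img_congr (fun v hv => h4 v (hK.dcL _ hτ _ (by simpa using hv)))]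
        exact hi τ hτ) trivial le_rfl
    exact ⟨L', g', h1', h2', h3', fun v hv => by rw [h7' v hv, h4 v hv], h5', h6'⟩
end

section
variable {α : Type}

theorem slice_homeo {E F : Type} [TopologicalSpace E] [AddCommGroup E] [Module ℝ E] [ContinuousSMul ℝ E]
    [TopologicalSpace F] [AddCommGroup F] [Module ℝ F] [ContinuousSMul ℝ F] {S : Set E} {T : Set F}
    {φ : E → F} {ψ : F → E} (h : HH S T φ ψ) (hS : ∀ r : ℝ, 0 < r → ∀ x ∈ S, r • x ∈ S)
    (hT : ∀ r : ℝ, 0 < r → ∀ x ∈ T, r • x ∈ T) {p : E → ℝ} {q : F → ℝ} (hp : Continuous p) (hq : Continuous q)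
    (hps : ∀ r : ℝ, 0 < r → ∀ x, p (r • x) = r * p x) (hqs : ∀ r : ℝ, 0 < r → ∀ x, q (r • x) = r * q x)
    (hp0 : ∀ y ∈ T, q y = 1 → 0 < p (ψ y)) (hq0 : ∀ x ∈ S, p x = 1 → 0 < q (φ x)) :
    ∃ e : {x // x ∈ S ∧ p x = 1} ≃ₜ {y // y ∈ T ∧ q y = 1}, ∀ x, (e x).1 = (q (φ x.1))⁻¹ • φ x.1 := by
  have h' : ∀ r : ℝ, 0 < r → ∀ y ∈ T, ψ (r • y) = r • ψ y := by
    intro r hr y hy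
    have : r • y = φ (r • ψ y) := by rw [h.hom r hr _ (h.map' y hy), h.right y hy]
    rw [this, h.left _ (hS r hr _ (h.map' y hy))]
  have hc1 : Continuous fun x : {x // x ∈ S ∧ p x = 1} => φ x.1 :=
    h.cont.comp_continuous continuous_subtype_val fun x => x.2.1
  have hc2 : Continuous fun y : {y // y ∈ T ∧ q y = 1} => ψ y.1 :=
    h.cont'.comp_continuous continuous_subtype_val fun x => x.2.1
  refine ⟨⟨⟨fun x => ⟨(q (φ x.1))⁻¹ • φ x.1, ?_⟩, fun y => ⟨(p (ψ y.1))⁻¹ • ψ y.1, ?_⟩, ?_, ?_⟩, ?_, ?_⟩, fun x => rfl⟩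
  · have := hq0 x.1 x.2.1 x.2.2
    exact ⟨hT _ (inv_pos.2 this) _ (h.map _ x.2.1), by rw [hqs _ (inv_pos.2 this), inv_mul_cancel₀ this.ne']⟩
  · have := hp0 y.1 y.2.1 y.2.2
    exact ⟨hS _ (inv_pos.2 this) _ (h.map' _ y.2.1), by rw [hps _ (inv_pos.2 this), inv_mul_cancel₀ this.ne']⟩
  · rintro ⟨x, hx, hpx⟩
    apply Subtype.ext
    have := hq0 x hx hpx
    dsimp only
    rw [h' _ (inv_pos.2 this) _ (h.map _ hx), h.left _ hx, hps _ (inv_pos.2 this), hpx, mul_one, inv_inv, smul_smul,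
      mul_inv_cancel₀ this.ne', one_smul]
  · rintro ⟨y, hy, hqy⟩
    apply Subtype.ext
    have := hp0 y hy hqy
    dsimp only
    rw [h.hom _ (inv_pos.2 this) _ (h.map' _ hy), h.right _ hy, hqs _ (inv_pos.2 this), hqy, mul_one, inv_inv, smul_smul,
      mul_inv_cancel₀ this.ne', one_smul]
  · exact Continuous.subtype_mk ((Continuous.inv₀ (hq.comp hc1) fun x => (hq0 x.1 x.2.1 x.2.2).ne').smul hc1) _
  · exact Continuous.subtype_mk ((Continuous.inv₀ (hp.comp hc2) fun x => (hp0 x.1 x.2.1 x.2.2).ne').smul hc2) _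

/-- the realization as a slice -/
theorem spc_slice {L : Set (Finset α)} (hdc : DC L) {S : Finset α} (hS : FinC L S) :
    ∃ e : spc (L \ {∅}) ≃ₜ {x // x ∈ cn L ∧ mass S x = 1}, ∀ z v, (e z).1 v = z.1 v := by
  have hsm : Smp L (L \ {∅}) id := fun σ hσ hne => ⟨by simpa using hσ, by simpa using hne.ne_empty⟩
  have hz : ∀ z : spc (L \ {∅}), (⇑z.1 : α → ℝ) ∈ cn L ∧ mass S (⇑z.1) = 1 := by
    intro z
    refine ⟨⟨z.2.2.1, _, z.2.1.1, fun v hv => by simpa using hv⟩, ?_⟩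
    refine Eq.trans ?_ z.2.2.2
    unfold mass Finsupp.sum
    symm
    exact Finset.sum_subset (hS _ z.2.1.1) fun v _ hv => by simpa using hv
  have hap : ∀ x ∈ cn L, ∀ u, mkP S id x u = x u := by
    intro x hx u
    rw [mkP_apply]
    by_cases hu : u ∈ S
    · rw [Finset.sum_eq_single u]
      · simp
      · intro w _ hw; simp [hw]
      · exact fun h => absurd hu h
    · rw [Finset.sum_eq_zero]
      · exact (hS.cn_zero hx hu).symm
      · intro w hw
        have : w ≠ u := fun h => hu (h ▸ hw)
        simp [this]
  refine ⟨⟨⟨fun z => ⟨⇑z.1, hz z⟩, fun x => ⟨mkP S id x.1, mkP_mem hdc hS hsm x.2.1 x.2.2⟩, ?_, ?_⟩, ?_, ?_⟩, fun z v => rfl⟩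
  · intro z
    apply Subtype.ext
    ext u
    exact hap _ (hz z).1 u
  · intro x
    apply Subtype.ext
    funext u
    exact hap _ x.2.1 u
  · exact Continuous.subtype_mk continuous_induced_dom _
  · exact spc_cont fun u => (mkP_cont S id u).comp continuous_subtype_val

theorem Sph.homeo {n : ℕ} {L : Set (Finset α)} (hdc : DC L) {S : Finset α} (hS : FinC L S) (h : Sph n L) :
    Nonempty (spc (L \ {∅}) ≃ₜ Metric.sphere (0 : EE n) 1) := by
  obtain ⟨φ, ψ, hh, hn⟩ := h.normal hS
  obtain ⟨e1, -⟩ := spc_slice hdc hS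
  obtain ⟨e2, -⟩ := slice_homeo hh cn_hsmul (fun _ _ _ _ => trivial) (mass_cont S) continuous_norm
    (fun r _ x => mass_smul S r x) (fun r hr x => by rw [norm_smul, Real.norm_of_nonneg hr.le])
    (fun y _ hy => by rw [← hn _ (hh.map' y trivial), hh.right y trivial, hy]; norm_num)
    (fun x hx hm => by rw [hn x hx, hm]; norm_num)
  exact ⟨(e1.trans e2).trans (Homeomorph.setCongr (by ext y; simp; rfl))⟩

theorem Dsk.homeo {n : ℕ} {L B : Set (Finset α)} (hdc : DC L) {S : Finset α} (hS : FinC L S) (h : Dsk n L B) :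
    Nonempty (spc (L \ {∅}) ≃ₜ Metric.closedBall (0 : EE n) 1) := by
  obtain ⟨φ, ψ, hh, -⟩ := h
  obtain ⟨e1, -⟩ := spc_slice hdc hS
  have hne : L.Nonempty := by
    obtain ⟨_, σ, hσ, _⟩ := hh.map' 0 ⟨trivial, by simp⟩
    exact ⟨σ, hσ⟩
  have h0 : φ 0 = 0 := hh.zero (zero_mem_cn hne)
  have hψ0 : ψ 0 = 0 := by rw [← h0]; exact hh.left _ (zero_mem_cn hne)
  obtain ⟨e2, -⟩ := slice_homeo (q := fun y : EE n × ℝ => ‖y.1‖ + y.2) hh cn_hsmul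
    (fun r hr x hx => ⟨trivial, mul_nonneg hr.le hx.2⟩) (mass_cont S) (by fun_prop)
    (fun r _ x => mass_smul S r x) (fun r hr x => by
      simp only [Prod.smul_fst, Prod.smul_snd, norm_smul, Real.norm_of_nonneg hr.le, smul_eq_mul]; ring)
    (fun y hy hq => mass_pos hS (hh.map' y hy) (fun h1 => by
      have := hh.right y hy
      rw [h1, h0] at this
      rw [← this] at hq
      simp at hq))
    (fun x hx hm => by
      have h1 := (hh.map x hx).2
      have h2 : 0 ≤ (φ x).2 := h1
      refine lt_of_le_of_ne (by positivity) fun h3 => ?_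
      have h4 : ‖(φ x).1‖ = 0 := by have := norm_nonneg (φ x).1; linarith
      have h5 : (φ x).2 = 0 := by have := norm_nonneg (φ x).1; linarith
      have h6 : φ x = 0 := Prod.ext (norm_eq_zero.1 h4) h5
      have h7 := hh.left x hx
      rw [h6, hψ0] at h7
      rw [← h7] at hm
      simp [mass] at hm)
  let e3 : {y : EE n × ℝ // y ∈ (univ ×ˢ Ici 0 : Set (EE n × ℝ)) ∧ ‖y.1‖ + y.2 = 1} ≃ₜ Metric.closedBall (0 : EE n) 1 :=
    { toFun := fun y => ⟨y.1.1, by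
        have h1 : 0 ≤ y.1.2 := y.2.1.2
        have h2 := y.2.2
        simp only [Metric.mem_closedBall, dist_zero_right]; linarith⟩
      invFun := fun y => ⟨(y.1, 1 - ‖y.1‖), ⟨trivial, by
        have := y.2
        simp only [Metric.mem_closedBall, dist_zero_right] at this
        simp only [mem_Ici]; linarith⟩, by simp⟩
      left_inv := fun y => by
        apply Subtype.ext
        refine Prod.ext rfl ?_
        have h2 := y.2.2
        dsimp only; linarith
      right_inv := fun y => rfl
      continuous_toFun := by
        refine Continuous.subtype_mk ?_ _
        exact continuous_fst.comp continuous_subtype_val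
      continuous_invFun := by
        refine Continuous.subtype_mk ?_ _
        fun_prop }
  exact ⟨(e1.trans e2).trans e3⟩

theorem Sph.of_homeo {n : ℕ} {L : Set (Finset α)} (hdc : DC L) (hne : L.Nonempty) {S : Finset α} (hS : FinC L S)
    (h : Nonempty (spc (L \ {∅}) ≃ₜ Metric.sphere (0 : EE n) 1)) : Sph n L := by
  obtain ⟨e0⟩ := h
  obtain ⟨e1, -⟩ := spc_slice hdc hS
  let e : {x // x ∈ cn L ∧ mass S x = 1} ≃ₜ Metric.sphere (0 : EE n) 1 := e1.symm.trans e0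
  have hm : ∀ x ∈ cn L, x ≠ 0 → (mass S x)⁻¹ • x ∈ cn L ∧ mass S ((mass S x)⁻¹ • x) = 1 := by
    intro x hx h0
    have := mass_pos hS hx h0
    exact ⟨cn_smul hx (by positivity), by rw [mass_smul, inv_mul_cancel₀ this.ne']⟩
  have hn : ∀ y : EE n, y ≠ 0 → ‖y‖⁻¹ • y ∈ Metric.sphere (0 : EE n) 1 := by
    intro y hy
    simp only [mem_sphere_iff_norm, sub_zero, norm_smul, norm_inv, norm_norm]
    exact inv_mul_cancel₀ (norm_ne_zero_iff.2 hy)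
  have he1 : ∀ x, ‖(e x).1‖ = 1 := fun x => by simpa using (e x).2
  classical
  let φ : (α → ℝ) → EE n := fun x => if h : x ∈ cn L ∧ x ≠ 0 then mass S x • (e ⟨_, hm x h.1 h.2⟩).1 else 0
  let ψ : EE n → (α → ℝ) := fun y => if h : y ≠ 0 then ‖y‖ • (e.symm ⟨_, hn y h⟩).1 else 0
  have hφ : ∀ x (h : x ∈ cn L ∧ x ≠ 0), φ x = mass S x • (e ⟨_, hm x h.1 h.2⟩).1 := fun x h => dif_pos h
  have hψ : ∀ y (h : y ≠ 0), ψ y = ‖y‖ • (e.symm ⟨_, hn y h⟩).1 := fun x h => dif_pos h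
  have hφ0 : φ 0 = 0 := dif_neg (by simp)
  have hψ0 : ψ 0 = 0 := dif_neg (by simp)
  have hφn : ∀ x ∈ cn L, ‖φ x‖ = mass S x := by
    intro x hx
    by_cases h0 : x = 0
    · rw [h0, hφ0]; simp [mass]
    · rw [hφ x ⟨hx, h0⟩, norm_smul, he1, mul_one, Real.norm_of_nonneg (mass_nonneg hx)]
  have hψn : ∀ y, ψ y ∈ cn L ∧ mass S (ψ y) = ‖y‖ := by
    intro y
    by_cases h0 : y = 0
    · rw [h0, hψ0]; exact ⟨zero_mem_cn hne, by simp [mass]⟩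
    · rw [hψ y h0]
      have := (e.symm ⟨_, hn y h0⟩).2
      exact ⟨cn_smul this.1 (norm_nonneg _), by rw [mass_smul, this.2, mul_one]⟩
  refine ⟨φ, ψ, ⟨fun _ _ => trivial, fun y _ => (hψn y).1, ?_, ?_, ?_, ?_, ?_⟩⟩
  · intro x hx
    by_cases h0 : x = 0
    · rw [h0, hφ0, hψ0]
    · have hp := mass_pos hS hx h0
      have h1 : φ x ≠ 0 := fun h2 => by
        have := hφn x hx
        rw [h2, norm_zero] at this
        exact hp.ne this
      rw [hψ _ h1]
      have h2 : (⟨_, hn _ h1⟩ : Metric.sphere (0 : EE n) 1) = e ⟨_, hm x hx h0⟩ := by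
        apply Subtype.ext
        dsimp only
        rw [hφn x hx, hφ x ⟨hx, h0⟩, smul_smul, inv_mul_cancel₀ hp.ne', one_smul]
      rw [h2, e.symm_apply_apply, hφn x hx]
      dsimp only
      rw [smul_smul, mul_inv_cancel₀ hp.ne', one_smul]
  · intro y _
    by_cases h0 : y = 0
    · rw [h0, hψ0, hφ0]
    · have hp : 0 < ‖y‖ := norm_pos_iff.2 h0
      have h1 : ψ y ≠ 0 := fun h2 => by
        have := (hψn y).2
        rw [h2] at this
        simp [mass] at this
        exact h0 (norm_eq_zero.1 this.symm)
      rw [hφ _ ⟨(hψn y).1, h1⟩]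
      have h2 : (⟨_, hm _ (hψn y).1 h1⟩ : {x // x ∈ cn L ∧ mass S x = 1}) = e.symm ⟨_, hn y h0⟩ := by
        apply Subtype.ext
        dsimp only
        rw [(hψn y).2, hψ y h0, smul_smul, inv_mul_cancel₀ hp.ne', one_smul]
      rw [h2, e.apply_symm_apply, (hψn y).2]
      dsimp only
      rw [smul_smul, mul_inv_cancel₀ hp.ne', one_smul]
  · intro x hx
    by_cases h0 : x = 0
    · subst h0
      unfold ContinuousWithinAt
      rw [hφ0, tendsto_zero_iff_norm_tendsto_zero]
      have h1 : Filter.Tendsto (mass S) (𝓝[cn L] 0) (𝓝 0) := by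
        have := ((mass_cont S).tendsto 0).mono_left (nhdsWithin_le_nhds (s := cn L))
        rwa [show mass S 0 = 0 by simp [mass]] at this
      refine h1.congr' ?_
      filter_upwards [self_mem_nhdsWithin] with x hx
      exact (hφn x hx).symm
    · have hopen : {x : α → ℝ | x ≠ 0} ∈ 𝓝 x := isOpen_ne.mem_nhds h0
      refine (continuousWithinAt_inter hopen).1 ?_
      have h1 : ContinuousOn φ (cn L ∩ {x | x ≠ 0}) := by
        rw [continuousOn_iff_continuous_domRestrict]
        have : (cn L ∩ {x | x ≠ 0}).domRestrict φ = fun x => mass S x.1 • (e ⟨_, hm x.1 x.2.1 x.2.2⟩).1 := by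
          funext x; exact hφ x.1 x.2
        rw [this]
        have hcm : Continuous fun x : (cn L ∩ {x | x ≠ 0} : Set (α → ℝ)) => mass S x.1 := (mass_cont S).comp continuous_subtype_val
        refine hcm.smul (continuous_subtype_val.comp (e.continuous.comp (Continuous.subtype_mk ?_ _)))
        exact (hcm.inv₀ fun x => (mass_pos hS x.2.1 x.2.2).ne').smul continuous_subtype_val
      exact h1 x ⟨hx, h0⟩
  · intro y _
    refine ContinuousAt.continuousWithinAt ?_
    by_cases h0 : y = 0
    · subst h0
      unfold ContinuousAt
      rw [hψ0, tendsto_pi_nhds]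
      intro v
      refine squeeze_zero (fun y => (hψn y).1.1 v) (fun y => (le_mass hS (hψn y).1 v).trans (hψn y).2.le) ?_
      simpa using (continuous_norm (E := EE n)).tendsto 0
    · have h1 : ContinuousOn ψ {x | x ≠ 0} := by
        rw [continuousOn_iff_continuous_domRestrict]
        have : ({x | x ≠ 0} : Set (EE n)).domRestrict ψ = fun x => ‖x.1‖ • (e.symm ⟨_, hn x.1 x.2⟩).1 := by
          funext x; exact hψ x.1 x.2
        rw [this]
        have hcm : Continuous fun x : ({x | x ≠ 0} : Set (EE n)) => ‖x.1‖ := continuous_norm.comp continuous_subtype_val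
        refine hcm.smul (continuous_subtype_val.comp (e.symm.continuous.comp (Continuous.subtype_mk ?_ _)))
        exact (hcm.inv₀ fun x => norm_ne_zero_iff.2 x.2).smul continuous_subtype_val
      exact h1.continuousAt (isOpen_ne.mem_nhds h0)
  · intro r hr x hx
    by_cases h0 : x = 0
    · rw [h0, smul_zero, hφ0, smul_zero]
    · have h1 : r • x ≠ 0 := smul_ne_zero hr.ne' h0
      have h2 : (⟨_, hm _ (cn_smul hx hr.le) h1⟩ : {x // x ∈ cn L ∧ mass S x = 1}) = ⟨_, hm x hx h0⟩ := by
        apply Subtype.ext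
        dsimp only
        rw [mass_smul, smul_smul, mul_inv, mul_right_comm, inv_mul_cancel₀ hr.ne', one_mul]
      rw [hφ _ ⟨cn_smul hx hr.le, h1⟩, hφ x ⟨hx, h0⟩, h2, mass_smul, smul_smul]
end

section
variable {α : Type}

theorem sph_model_aux (P : Prop) (k n : ℕ) (h : k = n) (hP : P ∨ n = 0) :
    Nonempty ({x : EuclideanSpace ℝ (Fin k) // ‖x‖ = 1 ∧ P} ≃ₜ Metric.sphere (0 : EE n) 1) := by
  subst h
  refine ⟨Homeomorph.setCongr (s := {x : EE k | ‖x‖ = 1 ∧ P}) ?_⟩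
  ext x
  simp only [mem_setOf_eq, mem_sphere_iff_norm, sub_zero]
  refine ⟨fun h => h.1, fun h => ⟨h, ?_⟩⟩
  rcases hP with hP | hP
  · exact hP
  · exfalso
    subst hP
    rw [Subsingleton.elim x 0] at h
    simp at h

theorem sph_model (m : ℤ) (n : ℕ) (h : (n : ℤ) = m + 1) :
    Nonempty (sphereSpace m ≃ₜ Metric.sphere (0 : EE n) 1) := by
  obtain ⟨e⟩ := sph_model_aux (0 ≤ m) (m+1).toNat n (by omega) (by omega)
  exact ⟨e⟩

theorem dsk_model_aux (P : Prop) (k n : ℕ) (h : k = n) (hP : P) :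
    Nonempty ({x : EuclideanSpace ℝ (Fin k) // ‖x‖ ≤ 1 ∧ P} ≃ₜ Metric.closedBall (0 : EE n) 1) := by
  subst h
  refine ⟨Homeomorph.setCongr (s := {x : EE k | ‖x‖ ≤ 1 ∧ P}) ?_⟩
  ext x
  simp only [mem_setOf_eq, mem_closedBall_iff_norm, sub_zero]
  exact ⟨fun h => h.1, fun h => ⟨h, hP⟩⟩

theorem dsk_model (m : ℤ) (n : ℕ) (h : (n : ℤ) = m) :
    Nonempty (discSpace m ≃ₜ Metric.closedBall (0 : EE n) 1) := by
  obtain ⟨e⟩ := dsk_model_aux (0 ≤ m) m.toNat n (by omega) (by omega)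
  exact ⟨e⟩

/-- the vertex point of a realization -/
theorem exists_vertex_pt {K : Set (Finset α)} {v : α} (hv : {v} ∈ K) : ∃ z : spc K, z.1 = Finsupp.single v 1 := by
  refine ⟨⟨Finsupp.single v 1, ?_, ?_, ?_⟩, rfl⟩
  · rw [Finsupp.support_single_ne_zero _ one_ne_zero]; exact hv
  · intro w
    rw [Finsupp.single_apply]
    split_ifs <;> norm_num
  · rw [Finsupp.sum_single_index rfl]

theorem vert_of {K : Set (Finset α)} (hK : IsComplex K) {σ : Finset α} (hσ : σ ∈ K) {v : α} (hv : v ∈ σ) : {v} ∈ K :=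
  (hK σ hσ).2 _ (by simpa using hv) (by simp)

theorem empty_of_spc {K : Set (Finset α)} (hK : IsComplex K) (h : IsEmpty (spc K)) : K = ∅ := by
  rw [Set.eq_empty_iff_forall_notMem]
  intro σ hσ
  obtain ⟨v, hv⟩ := Finset.nonempty_iff_ne_empty.2 (hK σ hσ).1
  obtain ⟨z, -⟩ := exists_vertex_pt (vert_of hK hσ hv)
  exact h.elim z

theorem finC_of_compact {K : Set (Finset α)} (hK : IsComplex K) [CompactSpace (spc K)] : ∃ S, FinC K S := by
  have ho : ∀ v : α, IsOpen {z : spc K | 0 < z.1 v} := fun v => isOpen_lt continuous_const (spc_coord v)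
  have hc : (univ : Set (spc K)) ⊆ ⋃ v, {z : spc K | 0 < z.1 v} := by
    intro z _
    obtain ⟨v, hv⟩ := Finset.nonempty_iff_ne_empty.2 (hK _ z.2.1).1
    refine mem_iUnion.2 ⟨v, lt_of_le_of_ne (z.2.2.1 v) ?_⟩
    exact (Finsupp.mem_support_iff.1 hv).symm
  obtain ⟨t, ht⟩ := isCompact_univ.elim_finite_subcover _ ho hc
  refine ⟨t, fun σ hσ v hv => ?_⟩
  obtain ⟨z, hz⟩ := exists_vertex_pt (vert_of hK hσ hv)
  obtain ⟨w, hw, hw'⟩ := mem_iUnion₂.1 (ht (mem_univ z))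
  simp only [mem_setOf_eq, hz, Finsupp.single_apply] at hw'
  by_cases h : v = w
  · rw [h]; exact hw
  · simp [h] at hw'

theorem IsComplex.dc {K : Set (Finset α)} (hK : IsComplex K) : DC (insert ∅ K) := by
  intro σ hσ τ hτ
  by_cases h : τ = ∅
  · exact Or.inl h
  · rcases hσ with rfl | hσ
    · exact absurd (Finset.subset_empty.1 hτ) h
    · exact Or.inr ((hK σ hσ).2 τ hτ h)

theorem IsComplex.notMem_empty {K : Set (Finset α)} (hK : IsComplex K) : ∅ ∉ K := fun h => (hK _ h).1 rfl

theorem insert_diff_K {K : Set (Finset α)} (hK : IsComplex K) : (insert ∅ K) \ {∅} = K := by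
  ext σ
  simp only [mem_diff, mem_insert_iff, mem_singleton_iff]
  constructor
  · rintro ⟨h | h, h'⟩
    · exact absurd h h'
    · exact h
  · intro h
    exact ⟨Or.inr h, (hK σ h).1⟩

theorem link_eq {L : Set (Finset α)} (hdc : DC L) {σ : Finset α} (hσ : σ ≠ ∅) :
    link (L \ {∅}) σ = lk L σ \ {∅} := by
  ext τ
  simp only [link, mem_setOf_eq, mem_diff, mem_singleton_iff, mem_lk]
  constructor
  · rintro ⟨⟨h1, h2⟩, h3, h4, h5⟩
    exact ⟨⟨h3, h4⟩, h2⟩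
  · rintro ⟨⟨h1, h2⟩, h3⟩
    refine ⟨⟨hdc _ h2 _ Finset.subset_union_right, h3⟩, h1, h2, fun h => hσ ?_⟩
    exact (Finset.union_eq_empty.1 h).1

theorem DC.complex {L : Set (Finset α)} (hdc : DC L) : IsComplex (L \ {∅}) := fun σ hσ =>
  ⟨hσ.2, fun τ hτ hne => ⟨hdc σ hσ.1 τ hτ, hne⟩⟩

theorem combSphere_card {K : Set (Finset α)} {m : ℤ} (hm : -1 ≤ m) (h : IsCombTriSphere m K) {σ : Finset α} (hσ : σ ∈ K) :
    (σ.card : ℤ) ≤ m + 1 := by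
  by_contra hlt
  push Not at hlt
  have hem : ∀ k : ℤ, k < 0 → IsEmpty (sphereSpace k) := fun k hk => ⟨fun x => absurd x.2.2 (by omega)⟩
  by_cases h1 : m = -1
  · subst h1
    obtain ⟨e⟩ := h.2.1
    have := hem (-1) (by norm_num)
    have := empty_of_spc h.1 e.toEquiv.isEmpty
    rw [this] at hσ
    exact hσ
  · obtain ⟨τ, hτ, hc⟩ := Finset.exists_subset_card_eq (s := σ) (n := (m+1).toNat) (by omega)
    have hτ0 : τ ≠ ∅ := by
      intro h0
      rw [h0, Finset.card_empty] at hc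
      omega
    have hτK := (h.1 σ hσ).2 τ hτ hτ0
    obtain ⟨e⟩ := h.2.2 τ hτK
    have := hem (m - τ.card) (by omega)
    have h2 := empty_of_spc (h.1.link _) e.toEquiv.isEmpty
    have h3 : (σ \ τ) ≠ ∅ := by
      intro h0
      have := Finset.card_sdiff_of_subset hτ
      rw [h0, Finset.card_empty] at this
      omega
    have : σ \ τ ∈ link K τ := by
      refine ⟨(h.1 σ hσ).2 _ Finset.sdiff_subset h3, Finset.disjoint_sdiff, ?_⟩
      rw [Finset.union_sdiff_of_subset hτ]; exact hσ
    rw [h2] at this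
    exact this

theorem combSphere_mfd {K : Set (Finset α)} {m : ℤ} {N : ℕ} (hm : (N : ℤ) = m + 1) (h : IsCombTriSphere m K) :
    Mfd N (insert ∅ K) ∅ := by
  obtain ⟨e⟩ := h.2.1
  obtain ⟨e'⟩ := sph_model m N hm
  have : CompactSpace (spc K) := (e.trans e').symm.compactSpace
  obtain ⟨S, hS⟩ := finC_of_compact h.1
  have hS' : FinC (insert ∅ K) S := by
    rintro σ (rfl | hσ)
    · exact Finset.empty_subset _
    · exact hS σ hσ
  have hdc := h.1.dc
  refine ⟨hdc, fun σ hσ => hσ.elim, fun σ hσ => hσ.elim, ⟨S, hS'⟩, ?_, fun σ hσ => hσ.elim⟩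
  intro σ hσ _
  by_cases h0 : σ = ∅
  · subst h0
    refine ⟨N, by simp, ?_⟩
    rw [lk_empty]
    refine Sph.of_homeo hdc ⟨∅, Or.inl rfl⟩ hS' ?_
    rw [insert_diff_K h.1]
    exact ⟨e.trans e'⟩
  · have hσK : σ ∈ K := hσ.resolve_left h0
    have hc := combSphere_card (by omega) h hσK
    obtain ⟨e2⟩ := h.2.2 σ hσK
    obtain ⟨e3⟩ := sph_model (m - σ.card) (N - σ.card) (by omega)
    refine ⟨N - σ.card, by omega, Sph.of_homeo (S := S) (hdc.lk σ) ⟨∅, empty_mem_lk hσ⟩ (hS'.lk σ) ?_⟩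
    rw [← link_eq hdc h0, insert_diff_K h.1]
    exact ⟨e2.trans e3⟩

theorem mfd_combSphere {L : Set (Finset α)} {N : ℕ} (h : Mfd N L ∅) (h0 : ∅ ∈ L) : IsCombTriSphere ((N : ℤ) - 1) (L \ {∅}) := by
  obtain ⟨S, hS⟩ := h.fin
  have key : ∀ σ ∈ L, Nonempty (spc (lk L σ \ {∅}) ≃ₜ sphereSpace ((N : ℤ) - 1 - σ.card)) := by
    intro σ hσ
    obtain ⟨n, hn, hs⟩ := h.sph σ hσ (fun h => h)
    obtain ⟨e⟩ := hs.homeo (h.dcL.lk σ) (hS.lk σ)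
    obtain ⟨e'⟩ := sph_model ((N : ℤ) - 1 - σ.card) n (by omega)
    exact ⟨e.trans e'.symm⟩
  refine ⟨h.dcL.complex, ?_, fun σ hσ => ?_⟩
  · have := key ∅ h0
    rwa [lk_empty, Finset.card_empty, Nat.cast_zero, sub_zero] at this
  · rw [link_eq h.dcL hσ.2]; exact key σ hσ.1

theorem mfd_combDisc {L K : Set (Finset α)} {N : ℕ} (h : Mfd (N+1) L K) (h0 : ∅ ∈ K)
    (hC4 : ∀ n, ¬ Nonempty (Metric.closedBall (0 : EE n) 1 ≃ₜ Metric.sphere (0 : EE (n+1)) 1)) :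
    IsCombTriDisc (N : ℤ) (L \ {∅}) ∧ discBoundary (N : ℤ) (L \ {∅}) = K \ {∅} := by
  obtain ⟨S, hS⟩ := h.fin
  have k1 : ∀ σ ∈ L, σ ∉ K → Nonempty (spc (lk L σ \ {∅}) ≃ₜ sphereSpace ((N : ℤ) - σ.card)) := by
    intro σ hσ hσ'
    obtain ⟨n, hn, hs⟩ := h.sph σ hσ hσ'
    obtain ⟨e⟩ := hs.homeo (h.dcL.lk σ) (hS.lk σ)
    obtain ⟨e'⟩ := sph_model ((N : ℤ) - σ.card) n (by omega)
    exact ⟨e.trans e'.symm⟩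
  have k2 : ∀ σ ∈ K, ∃ n : ℕ, n + σ.card = N ∧ Nonempty (spc (lk L σ \ {∅}) ≃ₜ Metric.closedBall (0 : EE n) 1) := by
    intro σ hσ
    obtain ⟨n, hn, hs⟩ := h.dsk σ hσ
    exact ⟨n, by omega, hs.homeo (h.dcL.lk σ) (hS.lk σ)⟩
  have k3 : ∀ σ ∈ K, Nonempty (spc (lk L σ \ {∅}) ≃ₜ discSpace ((N : ℤ) - σ.card)) := by
    intro σ hσ
    obtain ⟨n, hn, ⟨e⟩⟩ := k2 σ hσ
    obtain ⟨e'⟩ := dsk_model ((N : ℤ) - σ.card) n (by omega)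
    exact ⟨e.trans e'.symm⟩
  refine ⟨⟨h.dcL.complex, ?_, fun σ hσ => ?_⟩, ?_⟩
  · have := k3 ∅ h0
    rwa [lk_empty, Finset.card_empty, Nat.cast_zero, sub_zero] at this
  · rw [link_eq h.dcL hσ.2]
    by_cases hK : σ ∈ K
    · exact Or.inr (k3 σ hK)
    · exact Or.inl (k1 σ hσ.1 hK)
  · ext σ
    constructor
    · rintro ⟨h1, h2⟩
      rw [link_eq h.dcL h1.2] at h2
      exact ⟨by_contra fun h3 => h2 (k1 σ h1.1 h3), h1.2⟩
    · rintro ⟨h1, h2⟩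
      refine ⟨⟨h.sub h1, h2⟩, ?_⟩
      rw [link_eq h.dcL h2]
      rintro ⟨e⟩
      obtain ⟨n, hn, ⟨e1⟩⟩ := k2 σ h1
      obtain ⟨e2⟩ := sph_model ((N : ℤ) - σ.card) (n+1) (by push_cast; omega)
      exact hC4 n ⟨(e1.symm.trans e).trans e2⟩
end

section
variable {α : Type}

theorem top_even {g : α → α} {S T : Finset α} {a : α} {N : ℕ} (ha : a ∈ S) (hS : S.card = N + 1) (hT : T.card = N + 1)
    (h1 : T.image g ⊆ S) (h2 : T.image g ≠ S) :
    Even ((T.powersetCard N).filter fun ρ => ρ.image g = S.erase a).card := by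
  have hcS : (S.erase a).card = N := by rw [Finset.card_erase_of_mem ha, hS]; rfl
  by_cases h : S.erase a ⊆ T.image g
  · have hlt : (T.image g).card < S.card := Finset.card_lt_card (Finset.ssubset_iff_subset_ne.2 ⟨h1, h2⟩)
    have heq : S.erase a = T.image g := Finset.eq_of_subset_of_card_le h (by omega)
    obtain ⟨x, hx, y, hy, hxy, hg⟩ := Finset.exists_ne_map_eq_of_card_lt_of_maps_to (s := T) (t := T.image g) (f := g)
      (by omega) (fun v hv => Finset.mem_image_of_mem g hv)
    have key : ∀ x y, x ∈ T → y ∈ T → x ≠ y → g x = g y → (T.erase x).image g = T.image g := by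
      intro x y hx hy hxy hg
      refine Finset.Subset.antisymm (Finset.image_subset_image (Finset.erase_subset _ _)) ?_
      intro u hu
      obtain ⟨v, hv, rfl⟩ := Finset.mem_image.1 hu
      by_cases hvx : v = x
      · subst hvx
        exact Finset.mem_image.2 ⟨y, Finset.mem_erase.2 ⟨hxy.symm, hy⟩, hg.symm⟩
      · exact Finset.mem_image_of_mem g (Finset.mem_erase.2 ⟨hvx, hv⟩)
    have : ((T.powersetCard N).filter fun ρ => ρ.image g = S.erase a) = {T.erase x, T.erase y} := by
      ext ρ
      simp only [Finset.mem_filter, Finset.mem_powersetCard, Finset.mem_insert, Finset.mem_singleton]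
      constructor
      · rintro ⟨⟨hρ, hc⟩, hi⟩
        have h3 : ¬ (x ∈ ρ ∧ y ∈ ρ) := by
          rintro ⟨hxρ, hyρ⟩
          have h4 : (ρ.erase x).image g = ρ.image g := by
            refine Finset.Subset.antisymm (Finset.image_subset_image (Finset.erase_subset _ _)) ?_
            intro u hu
            obtain ⟨v, hv, rfl⟩ := Finset.mem_image.1 hu
            by_cases hvx : v = x
            · subst hvx
              exact Finset.mem_image.2 ⟨y, Finset.mem_erase.2 ⟨hxy.symm, hyρ⟩, hg.symm⟩
            · exact Finset.mem_image_of_mem g (Finset.mem_erase.2 ⟨hvx, hv⟩)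
          have h5 := Finset.card_image_le (s := ρ.erase x) (f := g)
          rw [h4, hi, hcS, Finset.card_erase_of_mem hxρ, hc] at h5
          have : 0 < ρ.card := Finset.card_pos.2 ⟨x, hxρ⟩
          omega
        have h6 : ∀ z ∈ T, z ∉ ρ → ρ = T.erase z := fun z hz hzρ =>
          Finset.eq_of_subset_of_card_le (Finset.subset_erase.2 ⟨hρ, hzρ⟩) (by rw [Finset.card_erase_of_mem hz]; omega)
        by_cases h7 : x ∈ ρ
        · exact Or.inr (h6 y hy fun h8 => h3 ⟨h7, h8⟩)
        · exact Or.inl (h6 x hx h7)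
      · rintro (rfl | rfl)
        · exact ⟨⟨Finset.erase_subset _ _, by rw [Finset.card_erase_of_mem hx, hT]; rfl⟩, by
            rw [heq]; exact key x y hx hy hxy hg⟩
        · exact ⟨⟨Finset.erase_subset _ _, by rw [Finset.card_erase_of_mem hy, hT]; rfl⟩, by
            rw [heq]; exact key y x hy hx hxy.symm hg.symm⟩
    rw [this, Finset.card_pair]
    · exact even_two
    · intro he
      have : y ∈ T.erase x := Finset.mem_erase.2 ⟨hxy.symm, hy⟩
      rw [he] at this
      simp at this
  · rw [Finset.card_eq_zero.2]
    · exact Even.zero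
    · rw [Finset.filter_eq_empty_iff]
      intro ρ hρ hi
      rw [← hi] at h
      exact h (Finset.image_subset_image (Finset.mem_powersetCard.1 hρ).1)

/-- the realization of a zero dimensional complex -/
theorem pts_equiv {A : Set (Finset α)} (h1 : ∀ σ ∈ A, σ.card ≤ 1) :
    Nonempty (spc (A \ {∅}) ≃ {v : α // {v} ∈ A}) := by
  have hp : ∀ v : {v : α // {v} ∈ A}, ∃ z : spc (A \ {∅}), z.1 = Finsupp.single v.1 1 := fun v =>
    exists_vertex_pt ⟨v.2, by simp⟩
  choose f hf using hp
  refine ⟨(Equiv.ofBijective f ⟨?_, ?_⟩).symm⟩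
  · intro v w hvw
    have := congrArg Subtype.val hvw
    rw [hf, hf] at this
    exact Subtype.ext (Finsupp.single_left_injective one_ne_zero this)
  · intro z
    have hc : z.1.support.card = 1 := by
      have := h1 _ z.2.1.1
      have h3 : z.1.support.card ≠ 0 := by
        rw [Ne, Finset.card_eq_zero]; exact z.2.1.2
      omega
    obtain ⟨v, hv⟩ := Finset.card_eq_one.1 hc
    refine ⟨⟨v, hv ▸ z.2.1.1⟩, ?_⟩
    apply Subtype.ext
    rw [hf]
    have hs := z.2.2.2
    rw [Finsupp.sum, hv, Finset.sum_singleton] at hs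
    ext u
    rw [Finsupp.single_apply]
    split_ifs with h
    · rw [← h, hs]
    · symm
      rw [← Finsupp.notMem_support_iff, hv]
      simpa using Ne.symm h

theorem tops_card {L : Set (Finset α)} (hfin : L.Finite) {ρ : Finset α} {N : ℕ} (hρ : ρ.card = N) (hmax : ∀ σ ∈ L, σ.card ≤ N + 1)
    {k : ℕ} (hk : Nat.card (spc (lk L ρ \ {∅})) = k) :
    (hfin.toFinset.filter fun T => T.card = N + 1 ∧ ρ ⊆ T).card = k := by
  have h1 : ∀ σ ∈ lk L ρ, σ.card ≤ 1 := by
    intro σ hσ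
    have := hmax _ hσ.2
    rw [Finset.card_union_of_disjoint hσ.1] at this
    omega
  obtain ⟨e⟩ := pts_equiv h1
  rw [← hk, Nat.card_congr e, ← Nat.card_eq_finsetCard]
  symm
  refine Nat.card_congr (Equiv.ofBijective (fun v => ⟨ρ ∪ {v.1}, ?_⟩) ⟨?_, ?_⟩)
  · rw [Finset.mem_filter, hfin.mem_toFinset]
    refine ⟨v.2.2, ?_, Finset.subset_union_left⟩
    rw [Finset.card_union_of_disjoint v.2.1, hρ, Finset.card_singleton]
  · rintro ⟨v, hv⟩ ⟨w, hw⟩ h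
    simp only [Subtype.mk.injEq] at h ⊢
    have hv' : v ∉ ρ := by have := hv.1; simpa using this
    have : v ∈ ρ ∪ {w} := by rw [← h]; simp
    simp only [Finset.mem_union, Finset.mem_singleton] at this
    exact this.resolve_left hv'
  · rintro ⟨T, hT⟩
    rw [Finset.mem_filter, hfin.mem_toFinset] at hT
    obtain ⟨hTL, hTc, hs⟩ := hT
    have : (T \ ρ).card = 1 := by rw [Finset.card_sdiff_of_subset hs]; omega
    obtain ⟨v, hv⟩ := Finset.card_eq_one.1 this
    have hu : ρ ∪ {v} = T := by rw [← hv]; exact Finset.union_sdiff_of_subset hs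
    refine ⟨⟨v, ?_, hu ▸ hTL⟩, Subtype.ext hu⟩
    rw [← hv]; exact Finset.disjoint_sdiff

theorem card_sph1 : Nat.card (Metric.sphere (0 : EE 1) 1) = 2 := by
  have e : Metric.sphere (0 : EE 1) 1 ≃ ({1, -1} : Finset ℝ) := by
    refine
      { toFun := fun x => ⟨x.1 0, ?_⟩
        invFun := fun r => ⟨WithLp.toLp 2 fun _ => r.1, ?_⟩
        left_inv := ?_
        right_inv := ?_ }
    · have := x.2
      simp only [mem_sphere_iff_norm, sub_zero, EuclideanSpace.norm_eq, Fin.sum_univ_one] at this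
      have h2 : |x.1 0| = 1 := by simpa [Real.sqrt_sq_eq_abs] using this
      rcases (abs_eq zero_le_one).1 h2 with h | h <;> simp [h]
    · have := r.2
      simp only [mem_sphere_iff_norm, sub_zero, EuclideanSpace.norm_eq]
      simp only [Finset.mem_insert, Finset.mem_singleton] at this
      rcases this with h | h <;> simp [h]
    · intro x
      apply Subtype.ext
      ext i
      rw [Subsingleton.elim i 0]
    · intro r; rfl
  rw [Nat.card_congr e, Nat.card_eq_finsetCard, Finset.card_pair (by norm_num)]

theorem card_ball0 : Nat.card (Metric.closedBall (0 : EE 0) 1) = 1 := by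
  rw [Nat.card_eq_one_iff_unique]
  exact ⟨⟨fun x y => Subtype.ext (Subsingleton.elim _ _)⟩, ⟨⟨0, by simp⟩⟩⟩

/-- no retraction onto the boundary of a simplex -/
theorem no_retract {S : Finset α} {N : ℕ} (hS : S.card = N + 1) {L : Set (Finset α)} (hL : Mfd (N+1) L (bdS S)) {g : α → α}
    (hg : ∀ v, {v} ∈ bdS S → g v = v) (hs : Smp L (bdS S \ {∅}) g) : False := by
  have hfin := hL.finite
  obtain ⟨W, hW⟩ := hL.fin
  obtain ⟨a, ha⟩ : S.Nonempty := Finset.card_pos.1 (by omega)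
  have hcS : (S.erase a).card = N := by rw [Finset.card_erase_of_mem ha, hS]; rfl
  have hτ0 : S.erase a ∈ bdS S := mem_bdS.2 ⟨Finset.erase_subset _ _, fun h => by rw [h] at hcS; omega⟩
  have hmax : ∀ σ ∈ L, σ.card ≤ N + 1 := fun σ hσ => hL.card_le hσ
  have hid : ∀ ρ ∈ bdS S, ρ.image g = ρ := by
    intro ρ hρ
    rw [Finset.image_congr (g := id), Finset.image_id]
    intro v hv
    exact hg v ((mfd_bdS hS).dcL ρ hρ _ (by simpa using hv))
  let RR := hfin.toFinset.filter fun ρ => ρ.card = N ∧ ρ.image g = S.erase a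
  let TT := hfin.toFinset.filter fun T => T.card = N + 1
  have hdc := Finset.sum_card_bipartiteAbove_eq_sum_card_bipartiteBelow (s := RR) (t := TT) (fun ρ T : Finset α => ρ ⊆ T)
  have hab : ∀ ρ, TT.bipartiteAbove (fun ρ T : Finset α => ρ ⊆ T) ρ = hfin.toFinset.filter fun T => T.card = N + 1 ∧ ρ ⊆ T := by
    intro ρ
    ext T
    simp [TT, Finset.bipartiteAbove, and_assoc]
  have hbe : ∀ T ∈ TT, Even (RR.bipartiteBelow (fun ρ T : Finset α => ρ ⊆ T) T).card := by
    intro T hT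
    simp only [TT, Finset.mem_filter, hfin.mem_toFinset] at hT
    have h1 := hs T hT.1 (Finset.card_pos.1 (by omega))
    have h2 := mem_bdS.1 h1.1
    have := top_even (g := g) ha hS hT.2 h2.1 h2.2
    convert this using 2
    ext ρ
    simp only [RR, Finset.bipartiteBelow, Finset.mem_filter, hfin.mem_toFinset, Finset.mem_powersetCard]
    constructor
    · rintro ⟨⟨h3, h4, h5⟩, h6⟩
      exact ⟨⟨h6, h4⟩, h5⟩
    · rintro ⟨⟨h3, h4⟩, h5⟩
      exact ⟨⟨hL.dcL T hT.1 _ h3, h4, h5⟩, h3⟩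
  have hmem : S.erase a ∈ RR := by
    simp only [RR, Finset.mem_filter, hfin.mem_toFinset]
    exact ⟨hL.sub hτ0, hcS, hid _ hτ0⟩
  have hone : (TT.bipartiteAbove (fun ρ T : Finset α => ρ ⊆ T) (S.erase a)).card = 1 := by
    rw [hab]
    refine tops_card hfin hcS hmax ?_
    obtain ⟨n, hn, hd⟩ := hL.dsk _ hτ0
    have : n = 0 := by omega
    subst this
    obtain ⟨e⟩ := hd.homeo (hL.dcL.lk _) (hW.lk _)
    rw [Nat.card_congr e.toEquiv, card_ball0]
  have htwo : ∀ ρ ∈ RR.erase (S.erase a), Even (TT.bipartiteAbove (fun ρ T : Finset α => ρ ⊆ T) ρ).card := by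
    intro ρ hρ
    rw [Finset.mem_erase] at hρ
    obtain ⟨hne, hρ⟩ := hρ
    simp only [RR, Finset.mem_filter, hfin.mem_toFinset] at hρ
    obtain ⟨hρL, hc, hi⟩ := hρ
    have hnb : ρ ∉ bdS S := fun h => hne (by rw [← hi, hid ρ h])
    rw [hab, tops_card (k := 2) hfin hc hmax]
    · exact even_two
    obtain ⟨n, hn, hd⟩ := hL.sph _ hρL hnb
    have : n = 1 := by omega
    subst this
    obtain ⟨e⟩ := hd.homeo (hL.dcL.lk _) (hW.lk _)
    rw [Nat.card_congr e.toEquiv, card_sph1]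
  rw [← Finset.add_sum_erase _ _ hmem, hone] at hdc
  have e1 := Finset.even_sum _ hbe
  have e2 := Finset.even_sum _ htwo
  rw [← hdc] at e1
  obtain ⟨x, hx⟩ := e1
  obtain ⟨y, hy⟩ := e2
  omega

theorem ball_ne_sphere_aux (α : Type) [Infinite α] (n : ℕ) :
    ¬ Nonempty (Metric.closedBall (0 : EE n) 1 ≃ₜ Metric.sphere (0 : EE (n+1)) 1) := by
  rintro ⟨e⟩
  obtain ⟨S, hS⟩ := Infinite.exists_subset_card_eq α (n + 1 + 1)
  have hK := mfd_bdS hS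
  have h0 : ∅ ∈ bdS S := mem_bdS.2 ⟨Finset.empty_subset _, fun h => by rw [← h] at hS; simp at hS⟩
  obtain ⟨W, hW⟩ := hK.fin
  obtain ⟨N, hN, hs⟩ := hK.sph ∅ h0 (fun h => h)
  rw [lk_empty] at hs
  have : N = n + 1 := by simpa using hN
  subst this
  obtain ⟨e'⟩ := hs.homeo hK.dcL hW
  have e'' := e'.trans e.symm
  have hE : ExtN (n+1) (spc (bdS S \ {∅})) := by
    intro f hf
    let f1 : C(Metric.sphere (0 : EE (n+1)) 1, Metric.closedBall (0 : EE n) 1) := ⟨fun x => e'' (f x), e''.continuous.comp hf⟩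
    obtain ⟨F, hF⟩ := f1.exists_restrict_eq Metric.isClosed_sphere
    refine ⟨fun x => e''.symm (F x), e''.symm.continuous.comp F.continuous, fun x => ?_⟩
    have := congrArg (fun h => h x) hF
    have h2 : F x.1 = e'' (f x) := this
    dsimp only
    rw [h2, e''.symm_apply_apply]
  have hsm : Smp (bdS S) (bdS S \ {∅}) id := fun σ hσ hne => ⟨by simpa using hσ, by simpa using hne.ne_empty⟩
  obtain ⟨L, g, h1, -, -, h2, h3⟩ := fill0 (R := ∅) hK h0 hK.dcL.complex hsm hE (by simpa using Set.infinite_univ)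
  exact no_retract hS h1 h2 h3

theorem ball_ne_sphere (n : ℕ) :
    ¬ Nonempty (Metric.closedBall (0 : EE n) 1 ≃ₜ Metric.sphere (0 : EE (n+1)) 1) := ball_ne_sphere_aux ℕ n
end

section
variable {α U : Type}

abbrev Slice (L : Set (Finset α)) (S : Finset α) : Type := {x : α → ℝ // x ∈ cn L ∧ mass S x = 1}

theorem homotopic_of_supp {T : Type} [TopologicalSpace T] {X : Set (Finset U)} (hX : IsComplex X) (F G : C(T, spc X))
    (h : ∀ t u, (G t).1 u ≠ 0 → (F t).1 u ≠ 0) : F.Homotopic G := by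
  have hm : ∀ q : unitInterval × T, ((1 - (q.1 : ℝ)) • (F q.2).1 + (q.1 : ℝ) • (G q.2).1).support ∈ X ∧
      (∀ v, 0 ≤ ((1 - (q.1 : ℝ)) • (F q.2).1 + (q.1 : ℝ) • (G q.2).1) v) ∧
      (((1 - (q.1 : ℝ)) • (F q.2).1 + (q.1 : ℝ) • (G q.2).1).sum fun _ c => c) = 1 := by
    rintro ⟨s, t⟩
    have hs0 := s.2.1
    have hs1 : 0 ≤ 1 - (s : ℝ) := by linarith [s.2.2]
    have hsum : (((1 - (s : ℝ)) • (F t).1 + (s : ℝ) • (G t).1).sum fun _ c => c) = 1 := by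
      rw [Finsupp.sum_add_index' (by simp) (by simp), Finsupp.sum_smul_index (by simp), Finsupp.sum_smul_index (by simp),
        ← Finsupp.mul_sum, ← Finsupp.mul_sum, (F t).2.2.2, (G t).2.2.2]
      ring
    refine ⟨?_, fun v => ?_, hsum⟩
    · refine (hX _ (F t).2.1).2 _ ?_ ?_
      · intro u hu
        rw [Finsupp.mem_support_iff] at hu ⊢
        intro h0
        have h1 : (G t).1 u = 0 := by_contra fun h2 => h t u h2 h0
        apply hu
        simp [h0, h1]
      · intro h0
        rw [Finsupp.support_eq_empty] at h0
        dsimp only at h0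
        rw [h0] at hsum
        simp at hsum
    · simp only [Finsupp.add_apply, Finsupp.smul_apply, smul_eq_mul]
      exact add_nonneg (mul_nonneg hs1 ((F t).2.2.1 v)) (mul_nonneg hs0 ((G t).2.2.1 v))
  refine ⟨⟨⟨fun q => ⟨_, hm q⟩, ?_⟩, ?_, ?_⟩⟩
  · refine spc_cont fun u => ?_
    simp only [Finsupp.add_apply, Finsupp.smul_apply, smul_eq_mul]
    have h1 : Continuous fun q : unitInterval × T => (F q.2).1 u := (spc_coord u).comp (F.continuous.comp continuous_snd)
    have h2 : Continuous fun q : unitInterval × T => (G q.2).1 u := (spc_coord u).comp (G.continuous.comp continuous_snd)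
    have h3 : Continuous fun q : unitInterval × T => (q.1 : ℝ) := continuous_subtype_val.comp continuous_fst
    exact ((continuous_const.sub h3).mul h1).add (h3.mul h2)
  · intro t
    apply Subtype.ext
    simp
  · intro t
    apply Subtype.ext
    simp

theorem slice_G {L : Set (Finset α)} {S : Finset α} (hdc : DC L) (hS : FinC L S) {X : Set (Finset U)} {g : α → U}
    (hg : Smp L X g) : ∃ G : C(Slice L S, spc X), ∀ x, (G x).1 = mkP S g x.1 :=
  ⟨⟨fun x => ⟨mkP S g x.1, mkP_mem hdc hS hg x.2.1 x.2.2⟩, spc_cont fun u => (mkP_cont S g u).comp continuous_subtype_val⟩,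
    fun _ => rfl⟩

/-- the homotopy statement preserved by replacements -/
def HQ {Y : Type} [TopologicalSpace Y] {X : Set (Finset U)} (f : C(Y, spc X)) (L : Set (Finset α)) (g : α → U) : Prop :=
  ∃ (S : Finset α) (e : Slice L S ≃ₜ Y) (G : C(Slice L S, spc X)), FinC L S ∧ (∀ x, (G x).1 = mkP S g x.1) ∧
    (f.comp (e : C(Slice L S, Y))).Homotopic G

theorem mass_eq {L : Set (Finset α)} {S S' : Finset α} (hS : FinC L S) (h : S ⊆ S') {x : α → ℝ} (hx : x ∈ cn L) :
    mass S' x = mass S x :=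
  (Finset.sum_subset h fun v _ hv => hS.cn_zero hx hv).symm

theorem mkP_eq {L : Set (Finset α)} {S S' : Finset α} (hdc : DC L) (hS : FinC L S) (h : S ⊆ S') {x : α → ℝ} (hx : x ∈ cn L)
    {g g' : α → U} (hg : ∀ v, {v} ∈ L → g' v = g v) : mkP S' g' x = mkP S g x := by
  ext u
  rw [mkP_apply, mkP_apply]
  rw [← Finset.sum_subset h]
  · refine Finset.sum_congr rfl fun v _ => ?_
    by_cases h0 : x v = 0
    · simp [h0]
    · have := adj_of hdc hx h0 h0
      rw [hg v (by simpa using this)]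
  · intro v _ hv
    simp [hS.cn_zero hx hv]

theorem HQ_step {Y : Type} [TopologicalSpace Y] {X : Set (Finset U)} (f : C(Y, spc X)) {P M : ℕ} {L B : Set (Finset α)}
    {g g' : α → U} {σ : Finset α} {A : Set (Finset α)} (h : Rp P L B X g σ A g' M) (hq : HQ f L g) :
    HQ f (Repl L σ A) g' := by
  obtain ⟨S, e, G, hS, hG, hf⟩ := hq
  obtain ⟨W, hW⟩ := h.rh.mA.fin
  obtain ⟨n, φ, ψ, hr⟩ := h.rh.rep
  have hdcM : DC {τ | τ ∈ L ∨ τ \ σ ∈ A} := by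
    rintro τ (hτ | hτ) ρ hρ
    · exact Or.inl (hr.dcL τ hτ ρ hρ)
    · exact Or.inr (hr.dcA _ hτ _ (Finset.sdiff_subset_sdiff hρ (Finset.Subset.refl _)))
  have hfM : FinC {τ | τ ∈ L ∨ τ \ σ ∈ A} (S ∪ W) := by
    rintro τ (hτ | hτ)
    · exact (hS τ hτ).trans Finset.subset_union_left
    · intro v hv
      by_cases hvσ : v ∈ σ
      · exact Finset.mem_union_left _ (hS σ h.rh.hL hvσ)
      · exact Finset.mem_union_right _ (hW _ hτ (Finset.mem_sdiff.2 ⟨hv, hvσ⟩))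
  have hsubR : Repl L σ A ⊆ {τ | τ ∈ L ∨ τ \ σ ∈ A} := fun τ hτ => hτ.2
  have hsubL : L ⊆ {τ | τ ∈ L ∨ τ \ σ ∈ A} := fun τ hτ => Or.inl hτ
  have hfR : FinC (Repl L σ A) (S ∪ W) := fun τ hτ => hfM τ (hsubR hτ)
  have hdcR : DC (Repl L σ A) := hr.dcL.rep hr.dcA σ
  have hcr : ∀ x : α → ℝ, x = res σ x + cut σ x := by
    intro x
    funext v
    simp only [res, cut, Pi.add_apply]
    split_ifs <;> simp
  -- the track of the homotopy
  have hχ : ∀ t ∈ Icc (0:ℝ) 1, ∀ x ∈ cn (Repl L σ A), x ≠ 0 →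
      chiT σ A φ ψ t x ∈ cn {τ | τ ∈ L ∨ τ \ σ ∈ A} ∧ chiT σ A φ ψ t x ≠ 0 := by
    intro t ht x hx hx0
    by_cases hc : cut σ x ∈ cn A
    · have hs := hr.phi_nonneg hc
      have ht1 : 0 ≤ 1 - t := by linarith [ht.2]
      have hpm := hr.psi_mem (φ (cut σ x)).1 (mul_nonneg ht1 hs)
      have hre : ∀ v, 0 ≤ res σ x v := by
        intro v; unfold res; split_ifs
        · exact hx.1 v
        · exact le_rfl
      have hin : ∀ v, 0 ≤ ((t * (φ (cut σ x)).2) • ind σ) v := by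
        intro v
        simp only [Pi.smul_apply, smul_eq_mul, ind]
        refine mul_nonneg (mul_nonneg ht.1 hs) ?_
        split_ifs <;> norm_num
      unfold chiT
      rw [if_pos hc]
      constructor
      · obtain ⟨ρ, hρ, h2⟩ := cn_supp hr.dcA hpm
        refine ⟨fun v => add_nonneg (add_nonneg (hre v) (hpm.1 v)) (hin v), ρ ∪ σ, Or.inr ?_, ?_⟩
        · have : (ρ ∪ σ) \ σ ⊆ ρ := by
            intro v hv
            simp only [Finset.mem_sdiff, Finset.mem_union] at hv
            tauto
          exact hr.dcA _ hρ _ this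
        · intro v hv
          rw [Finset.mem_union, not_or] at hv
          have : ψ ((φ (cut σ x)).1, (1 - t) * (φ (cut σ x)).2) v = 0 := by_contra fun h3 => hv.1 ((h2 v).1 h3)
          simp [this, res, ind, hv.2]
      · intro h0
        have hz : ∀ v, res σ x v = 0 ∧ ψ ((φ (cut σ x)).1, (1 - t) * (φ (cut σ x)).2) v = 0 ∧
            ((t * (φ (cut σ x)).2) • ind σ) v = 0 := by
          intro v
          have h1 := congrFun h0 v
          simp only [Pi.add_apply, Pi.zero_apply] at h1
          have h2 := hre v
          have h3 := hpm.1 v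
          have h4 := hin v
          refine ⟨?_, ?_, ?_⟩ <;> linarith
        have hA : A.Nonempty := ⟨_, hpm.2.choose_spec.1⟩
        have hφ0 : φ 0 = 0 := hr.hh.zero (zero_mem_cn hA)
        have h1 : ψ ((φ (cut σ x)).1, (1 - t) * (φ (cut σ x)).2) = 0 := funext fun v => (hz v).2.1
        have h2 := hr.phi_psi (φ (cut σ x)).1 (mul_nonneg ht1 hs)
        rw [h1, hφ0] at h2
        have h3 : (φ (cut σ x)).1 = 0 := (congrArg Prod.fst h2).symm
        have h4 : (1 - t) * (φ (cut σ x)).2 = 0 := (congrArg Prod.snd h2).symm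
        obtain ⟨w, hw⟩ := hr.hσ
        have h5 := (hz w).2.2
        simp only [Pi.smul_apply, smul_eq_mul, ind, hw, if_true, mul_one] at h5
        have h6 : (φ (cut σ x)).2 = 0 := by linarith
        have h7 : φ (cut σ x) = 0 := Prod.ext h3 h6
        have h8 := hr.hh.left _ hc
        rw [h7, ← hφ0, hr.hh.left _ (zero_mem_cn hA)] at h8
        apply hx0
        rw [hcr x, ← h8, add_zero]
        exact funext fun v => (hz v).1
    · have : chiT σ A φ ψ t x = x := by unfold chiT; rw [if_neg hc]
      rw [this]
      exact ⟨cn_mono hsubR hx, hx0⟩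
  have hχ0 : ∀ x ∈ cn (Repl L σ A), chiT σ A φ ψ 0 x = x := by
    intro x hx
    by_cases hc : cut σ x ∈ cn A
    · unfold chiT
      rw [if_pos hc]
      simp only [sub_zero, one_mul, zero_mul, zero_smul, add_zero, Prod.mk.eta]
      rw [hr.hh.left _ hc, ← hcr]
    · unfold chiT; rw [if_neg hc]
  have hsl0 : ∀ x : Slice (Repl L σ A) (S ∪ W), x.1 ≠ 0 := by
    intro x h0
    have := x.2.2
    rw [h0] at this
    simp [mass] at this
  obtain ⟨e', he'⟩ := slice_homeo hr.hhχ cn_hsmul cn_hsmul (mass_cont (S ∪ W)) (mass_cont S)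
    (fun r _ x => mass_smul _ r x) (fun r _ x => mass_smul _ r x)
    (by
      intro y hy hm
      refine mass_pos hfR (hr.hhχ.map' y hy) fun h0 => ?_
      have h1 := hr.hhχ.right y hy
      rw [h0, hr.hhχ.zero (zero_mem_cn ⟨_, (hr.hhχ.map' y hy).2.choose_spec.1⟩)] at h1
      rw [← h1] at hm
      simp [mass] at hm)
    (by
      intro x hx hm
      exact mass_pos hS (hr.hhχ.map x hx) (hχ 1 ⟨by norm_num, le_rfl⟩ x hx (hsl0 ⟨x, hx, hm⟩)).2)
  obtain ⟨G', hG'⟩ := slice_G hdcR hfR (fun τ hτ => h.smp τ (hsubR hτ))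
  refine ⟨S ∪ W, e'.trans e, G', hfR, hG', ?_⟩
  have s1 : (f.comp (e'.trans e : C(Slice (Repl L σ A) (S ∪ W), Y))).Homotopic
      (G.comp (e' : C(Slice (Repl L σ A) (S ∪ W), Slice L S))) :=
    ContinuousMap.Homotopic.comp hf (ContinuousMap.Homotopic.refl (e' : C(Slice (Repl L σ A) (S ∪ W), Slice L S)))
  refine s1.trans (ContinuousMap.Homotopic.symm ?_)
  have hpos : ∀ q : unitInterval × Slice (Repl L σ A) (S ∪ W), 0 < mass (S ∪ W) (chiT σ A φ ψ q.1 q.2.1) := fun q =>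
    mass_pos hfM (hχ q.1 q.1.2 q.2.1 q.2.2.1 (hsl0 q.2)).1 (hχ q.1 q.1.2 q.2.1 q.2.2.1 (hsl0 q.2)).2
  have hmem : ∀ q : unitInterval × Slice (Repl L σ A) (S ∪ W),
      (mass (S ∪ W) (chiT σ A φ ψ q.1 q.2.1))⁻¹ • chiT σ A φ ψ q.1 q.2.1 ∈ cn {τ | τ ∈ L ∨ τ \ σ ∈ A} ∧
      mass (S ∪ W) ((mass (S ∪ W) (chiT σ A φ ψ q.1 q.2.1))⁻¹ • chiT σ A φ ψ q.1 q.2.1) = 1 := fun q =>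
    ⟨cn_smul (hχ q.1 q.1.2 q.2.1 q.2.2.1 (hsl0 q.2)).1 (inv_nonneg.2 (hpos q).le), by
      rw [mass_smul, inv_mul_cancel₀ (hpos q).ne']⟩
  obtain ⟨GM, hGM⟩ := slice_G hdcM hfM h.smp
  have hcc : Continuous fun q : unitInterval × Slice (Repl L σ A) (S ∪ W) => chiT σ A φ ψ q.1 q.2.1 :=
    hr.chi_contT.comp_continuous (f := fun q : unitInterval × Slice (Repl L σ A) (S ∪ W) => ((q.1 : ℝ), q.2.1))
      (by fun_prop) fun q => ⟨q.1.2, q.2.2.1⟩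
  refine ⟨⟨⟨fun q => GM ⟨_, hmem q⟩, ?_⟩, ?_, ?_⟩⟩
  · refine GM.continuous.comp (Continuous.subtype_mk ?_ _)
    exact (((mass_cont _).comp hcc).inv₀ fun q => (hpos q).ne').smul hcc
  · intro x
    apply Subtype.ext
    dsimp only
    rw [hGM, hG']
    dsimp only
    have : ((0 : unitInterval) : ℝ) = 0 := rfl
    rw [this, hχ0 _ x.2.1, x.2.2, inv_one, one_smul]
  · intro x
    apply Subtype.ext
    dsimp only
    rw [hGM]
    have h1 := hr.hhχ.map _ x.2.1
    have : ((1 : unitInterval) : ℝ) = 1 := rfl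
    have h2 : (G.comp (e' : C(Slice (Repl L σ A) (S ∪ W), Slice L S))) x = G (e' x) := rfl
    rw [h2, hG, he']
    dsimp only
    rw [this, mass_eq hS Finset.subset_union_left h1]
    refine mkP_eq hr.dcL hS Finset.subset_union_left (cn_smul h1 ?_) h.old
    exact inv_nonneg.2 (mass_nonneg h1)
end

section
variable {α U : Type}

theorem HQ_init [Infinite α] {m : ℤ} (hm : 0 ≤ m) {X : Set (Finset U)} (hX : IsComplex X) (f : C(sphereSpace m, spc X)) :
    ∃ (L : Set (Finset α)) (g : α → U), Mfd (m+1).toNat L ∅ ∧ ∅ ∈ L ∧ Smp L X g ∧ HQ f L g := by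
  obtain ⟨N, hN⟩ : ∃ N : ℕ, (N : ℤ) = m + 1 := ⟨(m+1).toNat, by omega⟩
  have hN' : (m+1).toNat = N := by omega
  rw [hN']
  obtain ⟨S0, hS0⟩ := Infinite.exists_subset_card_eq α (N + 1)
  have hK := mfd_bdS hS0
  have h0 : ∅ ∈ bdS S0 := mem_bdS.2 ⟨Finset.empty_subset _, fun h => by rw [← h] at hS0; simp at hS0⟩
  have hF0 : FinC (bdS S0) S0 := fun τ hτ => (mem_bdS.1 hτ).1
  obtain ⟨n, hn, hs⟩ := hK.sph ∅ h0 (fun h => h)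
  rw [lk_empty] at hs
  have : n = N := by simpa using hn
  subst this
  obtain ⟨e1⟩ := hs.homeo hK.dcL hF0
  obtain ⟨e2, -⟩ := spc_slice hK.dcL hF0
  obtain ⟨e3⟩ := sph_model m n hN
  let e0 : Slice (bdS S0) S0 ≃ₜ sphereSpace m := (e2.symm.trans e1).trans e3.symm
  -- a vertex
  obtain ⟨c, hc⟩ : S0.Nonempty := Finset.card_pos.1 (by omega)
  have hcK : {c} ∈ bdS S0 := mem_bdS.2 ⟨by simpa using hc, fun h => by
    rw [← h, Finset.card_singleton] at hS0; omega⟩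
  have hcZ : ind {c} ∈ cn (bdS S0) ∧ mass S0 (ind {c}) = 1 := ⟨ind_mem_cn hcK, by simp [mass, ind, hc]⟩
  classical
  let Φ : (α → ℝ) → spc X := fun z => if h : z ∈ cn (bdS S0) ∧ mass S0 z = 1 then f (e0 ⟨z, h⟩) else f (e0 ⟨_, hcZ⟩)
  have hΦ : ∀ z (h : z ∈ cn (bdS S0) ∧ mass S0 z = 1), Φ z = f (e0 ⟨z, h⟩) := fun z h => dif_pos h
  have hΦc : ContinuousOn Φ {z | z ∈ cn (bdS S0) ∧ mass S0 z = 1} := by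
    rw [continuousOn_iff_continuous_domRestrict]
    have : ({z | z ∈ cn (bdS S0) ∧ mass S0 z = 1} : Set (α → ℝ)).domRestrict Φ = fun z => f (e0 z) := by
      funext z; exact hΦ z.1 z.2
    rw [this]
    exact f.continuous.comp e0.continuous
  obtain ⟨ε, hε, hleb⟩ := lebesgue (S0 := S0) (Z_compact hK.dcL hF0) (fun z hz v hv => hF0.cn_zero hz.1 hv) hΦc
  have hst := St.start (R := ∅) hK (fun τ _ hne hv => by
    obtain ⟨v, hv'⟩ := hne
    exact (hv v hv').elim) hF0 (fun _ _ _ _ h => h.elim)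
  obtain ⟨L, S, p, h, -, hFi⟩ := mesh (by simpa using Set.infinite_univ) c hst (fun _ _ h => h.elim) hε
  have hg : ∀ w, ∃ u, {w} ∈ L → ∀ z' ∈ {z | z ∈ cn (bdS S0) ∧ mass S0 z = 1}, D2 S0 (p w) z' ≤ ε → 0 < (Φ z').1 u := by
    intro w
    by_cases hwL : {w} ∈ L
    · obtain ⟨u, hu⟩ := hleb (p w) ⟨h.pmem hwL, h.mass1 w hwL⟩
      exact ⟨u, fun _ => hu⟩
    · obtain ⟨u, -⟩ := hleb _ hcZ
      exact ⟨u, fun h => absurd h hwL⟩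
  choose g hg using hg
  have key : ∀ x ∈ cn L, mass S x = 1 → ∀ w, 0 < x w → 0 < (Φ (PP S p x)).1 (g w) := by
    intro x hx hm w hw
    have hwL : {w} ∈ L := by simpa using adj_of h.mfd.dcL hx hw.ne' hw.ne'
    refine hg w hwL _ (h.PP_mem hx hm) (D2_jensen hx.1 hm fun v hv h0 => ?_)
    exact hFi w v (fun h => h) (fun h => h) (adj_of h.mfd.dcL hx hw.ne' h0)
  have hsm : Smp L X g := smp_of h.fin hX (Ψ := fun x => Φ (PP S p x)) key
  obtain ⟨ω, hω⟩ := h.hh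
  obtain ⟨e, he⟩ := slice_homeo hω cn_hsmul cn_hsmul (mass_cont S) (mass_cont S0)
    (fun r _ x => mass_smul _ r x) (fun r _ x => mass_smul _ r x)
    (by
      intro y hy hm
      rw [← h.massPP (hω.map' y hy), hω.right y hy, hm]
      norm_num)
    (by
      intro x hx hm
      rw [h.massPP hx, hm]
      norm_num)
  have hL0 : ∅ ∈ L := h.mfd.dcL _ (hω.map' _ hcZ.1).2.choose_spec.1 _ (Finset.empty_subset _)
  obtain ⟨G, hG⟩ := slice_G h.mfd.dcL h.fin hsm
  refine ⟨L, g, h.mfd, hL0, hsm, S, e.trans e0, G, h.fin, hG, ?_⟩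
  refine homotopic_of_supp hX _ _ fun x u hu => ?_
  have h1 : (f.comp ((e.trans e0 : Slice L S ≃ₜ sphereSpace m) : C(Slice L S, sphereSpace m))) x = f (e0 (e x)) := rfl
  have h2 : Φ (PP S p x.1) = f (e0 (e x)) := by
    rw [hΦ _ (h.PP_mem x.2.1 x.2.2)]
    congr 2
    apply Subtype.ext
    dsimp only
    rw [he, h.massPP x.2.1, x.2.2, inv_one, one_smul]
  rw [h1, ← h2]
  rw [hG] at hu
  obtain ⟨τ, hτ, h3⟩ := cn_supp h.mfd.dcL x.2.1
  have h4 : u ∈ τ.image g := by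
    rw [← mkP_supp x.2.1.1 h3 (h.fin τ hτ)]
    exact Finsupp.mem_support_iff.2 hu
  obtain ⟨w, hw, rfl⟩ := Finset.mem_image.1 h4
  exact (key x.1 x.2.1 x.2.2 w (lt_of_le_of_ne (x.2.1.1 w) ((h3 w).2 hw).symm)).ne'

theorem sphere_aux [Infinite α] {m d : ℤ} (hm : 0 ≤ m) (hmd : m ≤ d) {X : Set (Finset U)} (hX : IsComplex X) (hW : WCM X d)
    (f : C(sphereSpace m, spc X)) :
    ∃ (K : Set (Finset α)) (g : α → U) (e : spc K ≃ₜ sphereSpace m)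
      (G : C(spc K, spc X)),
      IsCombTriSphere m K ∧ IsSimplicial K X g ∧ LocInj K g ∧ Realizes K X g G ∧
      (f.comp (e : C(spc K, sphereSpace m))).Homotopic G := by
  obtain ⟨L0, g0, h1, h2, h3, h4⟩ := HQ_init (α := α) hm hX f
  obtain ⟨L, g, k1, -, -, k2, k3, -, ⟨S, e, G, hS, hG, hh⟩, hL0⟩ := remove (R := ∅) hX hW (by omega) (by simpa using Set.infinite_univ)
    (fun n _ => fill n) (fun L g => HQ f L g ∧ ∅ ∈ L)
    (fun L g σ A g' M hr hq => ⟨HQ_step f hr hq.1, fun h => hr.rh.hσ.ne_empty (Finset.subset_empty.1 h), Or.inl hq.2⟩) _ L0 g0 h1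
    (fun τ _ hne hv => by
      obtain ⟨v, hv'⟩ := hne
      exact (hv v hv').elim) (fun _ _ _ _ h => h.elim) h3 (fun _ h => h.elim) ⟨h4, h2⟩ le_rfl
  obtain ⟨e1, he1⟩ := spc_slice k1.dcL hS
  have hc := mfd_combSphere k1 hL0
  rw [show (((m + 1).toNat : ℕ) : ℤ) - 1 = m by omega] at hc
  refine ⟨L \ {∅}, g, e1.trans e, G.comp (e1 : C(spc (L \ {∅}), Slice L S)), hc, ?_, fun σ hσ => k3 σ hσ.1, ?_, ?_⟩
  · intro σ hσ
    exact k2 σ hσ.1 (Finset.nonempty_iff_ne_empty.2 hσ.2)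
  · intro w
    have h5 : (G.comp (e1 : C(spc (L \ {∅}), Slice L S))) w = G (e1 w) := rfl
    rw [h5, hG]
    have h6 : (e1 w).1 = ⇑w.1 := funext (he1 w)
    rw [h6]
    unfold mkP Finsupp.mapDomain Finsupp.sum
    symm
    refine Finset.sum_subset (hS _ w.2.1.1) fun v _ hv => ?_
    rw [Finsupp.notMem_support_iff.1 hv]; exact Finsupp.single_zero _
  · exact ContinuousMap.Homotopic.comp hh (ContinuousMap.Homotopic.refl (e1 : C(spc (L \ {∅}), Slice L S)))
end

section
variable {V W U : Type}

theorem sphere_empty {m : ℤ} (hm : m < 0) : IsEmpty (sphereSpace m) :=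
  ⟨fun x => absurd x.2.2 (by omega)⟩

theorem disc_empty {m : ℤ} (hm : m < 0) : IsEmpty (discSpace m) :=
  ⟨fun x => absurd x.2.2 (by omega)⟩

theorem spc_empty_set : IsEmpty (spc (∅ : Set (Finset V))) := ⟨fun x => x.2.1⟩

theorem combSphere_empty {m : ℤ} (hm : m < 0) : IsCombTriSphere m (∅ : Set (Finset V)) := by
  haveI := sphere_empty hm
  haveI := spc_empty_set (V := V)
  exact ⟨fun σ h => h.elim, ⟨Homeomorph.empty⟩, fun σ h => h.elim⟩

theorem combDisc_empty {m : ℤ} (hm : m < 0) : IsCombTriDisc m (∅ : Set (Finset V)) := by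
  haveI := disc_empty hm
  haveI := spc_empty_set (V := V)
  exact ⟨fun σ h => h.elim, ⟨Homeomorph.empty⟩, fun σ h => h.elim⟩

theorem hasSphere {X : Set (Finset U)} {d : ℤ} (hX : IsComplex X) (hW : WCM X d) : HasSphereLII X d := by
  intro m hmd f
  rcases le_or_gt 0 m with hm | hm
  · obtain ⟨K, g, e, G, h⟩ := sphere_aux (α := ℕ) hm hmd hX hW f
    exact ⟨ℕ, K, g, e, G, h⟩
  · haveI := sphere_empty hm
    haveI := spc_empty_set (V := Empty)
    let e : spc (∅ : Set (Finset Empty)) ≃ₜ sphereSpace m := Homeomorph.empty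
    exact ⟨Empty, ∅, Empty.elim, e, f.comp (e : C(spc (∅ : Set (Finset Empty)), sphereSpace m)), combSphere_empty hm,
      fun σ h => h.elim, fun σ h => h.elim, fun w => isEmptyElim w, ContinuousMap.Homotopic.refl _⟩

theorem disc_main {X : Set (Finset U)} {d : ℤ} (hX : IsComplex X) (hW : WCM X d) {m : ℤ} (hm : -1 ≤ m) (hmd : m ≤ d - 1)
    {K : Set (Finset V)} {f : V → U} (hK : IsCombTriSphere m K) (hs : IsSimplicial K X f) (hi : LocInj K f)
    {j : V → W} (hj : Function.Injective j) (hR : (range j)ᶜ.Infinite) :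
    ∃ (L : Set (Finset W)) (F : W → U), IsCombTriDisc (m + 1) L ∧ Function.Injective j ∧
    (∀ σ ∈ K, σ.image j ∈ L) ∧
    ((fun σ : Finset V => σ.image j) '' K = discBoundary (m + 1) L) ∧
    (∀ v, F (j v) = f v) ∧ IsSimplicial L X F ∧ LocInj L F := by
  obtain ⟨N, hN⟩ : ∃ N : ℕ, (N : ℤ) = m + 1 := ⟨(m+1).toNat, by omega⟩
  have hU : Nonempty U := by
    haveI := sphere_empty (m := -1) (by omega)
    obtain ⟨F, -⟩ := hW.1 (-1) (by omega) ⟨fun x => isEmptyElim x, continuous_of_const fun x => isEmptyElim x⟩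
    have x : discSpace (-1 + 1) := ⟨0, by simp, by norm_num⟩
    obtain ⟨u, -⟩ := Finset.nonempty_iff_ne_empty.2 (hX _ (F x).2.1).1
    exact ⟨u⟩
  have u0 : U := hU.some
  let f' : W → U := Function.extend j f fun _ => u0
  have hf' : ∀ v, f' (j v) = f v := fun v => hj.extend_apply _ _ _
  have him : ∀ σ : Finset V, (σ.image j).image f' = σ.image f := by
    intro σ
    rw [Finset.image_image]
    exact img_congr fun v _ => hf' v
  have hM : Mfd N (imC j (insert ∅ K)) ∅ := (combSphere_mfd hN hK).imC hj
  have hne : ∅ ∉ K := fun h => (hK.1 _ h).1 rfl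
  have h0 : ∅ ∈ imC j (insert ∅ K) := ⟨∅, Or.inl rfl, Finset.image_empty _⟩
  obtain ⟨L, F, hF⟩ := fill N X d hX hW (by omega) (imC j (insert ∅ K)) f' hM h0
    (by
      rintro _ ⟨σ, hσ, rfl⟩ hn
      dsimp only at hn ⊢
      rw [him]
      rcases hσ with rfl | hσ
      · simp at hn
      · exact hs σ hσ)
    (by
      rintro _ ⟨σ, hσ, rfl⟩
      dsimp only
      rw [him, Finset.card_image_of_injective _ hj]
      rcases hσ with rfl | hσ
      · simp
      · exact hi σ hσ) (range j) hR
  obtain ⟨hd, hb⟩ := mfd_combDisc hF.mfd h0 ball_ne_sphere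
  rw [hN] at hd hb
  have hKe : imC j (insert ∅ K) \ {∅} = (fun σ : Finset V => σ.image j) '' K := by
    ext τ
    constructor
    · rintro ⟨⟨σ, hσ | hσ, rfl⟩, h2⟩
      · subst hσ
        exact (h2 (Finset.image_empty _)).elim
      · exact ⟨σ, hσ, rfl⟩
    · rintro ⟨σ, hσ, rfl⟩
      refine ⟨⟨σ, Or.inr hσ, rfl⟩, fun h => hne ?_⟩
      rw [← Finset.image_eq_empty.1 h]
      exact hσ
  rw [hKe] at hb
  let F' : W → U := Function.extend j f F
  have hFF : ∀ τ ∈ L, ∀ v ∈ τ, F' v = F v := by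
    intro τ hτ v hv
    by_cases h : v ∈ range j
    · rw [hF.ext v (hF.avoid τ hτ v hv h)]
      obtain ⟨x, rfl⟩ := h
      rw [hf' x]
      exact hj.extend_apply _ _ _
    · exact Function.extend_apply' _ _ _ h
  refine ⟨L \ {∅}, F', hd, hj, ?_, hb.symm, ?_, ?_, ?_⟩
  · intro σ hσ
    have : σ.image j ∈ discBoundary (m + 1) (L \ {∅}) := by
      rw [hb]
      exact ⟨σ, hσ, rfl⟩
    exact this.1
  · intro v
    exact hj.extend_apply _ _ _
  · intro σ hσ
    rw [img_congr (hFF σ hσ.1)]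
    exact hF.smp σ hσ.1 (Finset.nonempty_iff_ne_empty.2 hσ.2)
  · intro σ hσ
    rw [img_congr (hFF σ hσ.1)]
    exact hF.inj σ hσ.1

theorem hasDisc {X : Set (Finset U)} {d : ℤ} (hX : IsComplex X) (hW : WCM X d) : HasDiscLII X (d - 1) := by
  intro m hmd V K f hK hs hi
  rcases le_or_gt (-1) m with hm | hm
  · have hR : (range (Sum.inl : V → V ⊕ ℕ))ᶜ.Infinite := by
      refine (Set.infinite_range_of_injective (Sum.inr_injective (α := V) (β := ℕ))).mono ?_
      rintro _ ⟨n, rfl⟩ ⟨v, hv⟩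
      cases hv
    obtain ⟨L, F, h⟩ := disc_main hX hW hm hmd hK hs hi Sum.inl_injective hR
    exact ⟨V ⊕ ℕ, L, Sum.inl, F, h⟩
  · haveI := sphere_empty (m := m) (by omega)
    obtain ⟨e⟩ := hK.2.1
    have hE : K = ∅ := empty_of_spc hK.1 ⟨fun x => isEmptyElim (e x)⟩
    subst hE
    refine ⟨V, ∅, id, f, combDisc_empty (by omega), Function.injective_id, fun σ h => h.elim, ?_, fun _ => rfl,
      fun σ h => h.elim, fun σ h => h.elim⟩
    rw [Set.image_empty]
    symm
    exact Set.eq_empty_of_forall_notMem fun σ h => h.1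
end

/-- A simplicial complex that is weakly Cohen–Macaulay of dimension
`d` has the sphere local injectivity property up to dimension `d` and the disc local
injectivity property up to dimension `d - 1`. -/
theorem stmt7 {U : Type} (X : Set (Finset U)) (d : ℤ) (hX : IsComplex X)
    (h : WCM X d) :
    HasSphereLII X d ∧ HasDiscLII X (d - 1) := by
  exact ⟨hasSphere hX h, hasDisc hX h⟩
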